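/- Let k be a field, I an ideal in Q = k[x_1,…,x_t] generated by monomials of degree at least 2 with minimal generating set M of cardinality n, and R = Q/I. Then deg b_R(z) ≤ 2n, with equality if and only if R is a complete intersection (equivalently, if and only if the monomials in M are pairwise without common factors). -/

import Mathlib

noncomputable section
attribute [local instance] Classical.propDecidable

namespace MonomialRings

/-- Monomials in variables indexed by `σ`, represented by their exponent vectors. -/
abbrev Mon (σ : Type*) := σ → ℕ

/-- Two monomials have a non-trivial common factor. -/
def NCF {σ : Type*} (a b : Mon σ) : Prop := ∃ i, a i ≠ 0 ∧ b i ≠ 0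

/-- Adjacency in the graph associated to a set of monomials: edges go between distinct
monomials having a non-trivial common factor. -/
def mAdj {σ : Type*} (a b : Mon σ) : Prop := a ≠ b ∧ NCF a b

/-- `a` and `b` are joined by a path inside `S`. -/
def ConnIn {σ : Type*} (S : Finset (Mon σ)) (a b : Mon σ) : Prop :=
  a ∈ S ∧ b ∈ S ∧ Relation.ReflTransGen (fun u v => u ∈ S ∧ v ∈ S ∧ mAdj u v) a b

/-- A monomial set is connected (in particular nonempty). -/
def IsConnected {σ : Type*} (S : Finset (Mon σ)) : Prop :=
  S.Nonempty ∧ ∀ a ∈ S, ∀ b ∈ S, ConnIn S a b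

/-- The connected component of `a` in `S`. -/
def compOf {σ : Type*} (S : Finset (Mon σ)) (a : Mon σ) : Finset (Mon σ) :=
  S.filter (fun b => ConnIn S a b)

/-- The set of connected components of a monomial set. -/
def components {σ : Type*} (S : Finset (Mon σ)) : Finset (Finset (Mon σ)) :=
  S.image (compOf S)

/-- The number of connected components of a monomial set. -/
def ncomp {σ : Type*} (S : Finset (Mon σ)) : ℕ := (components S).card

/-- The least common multiple `m_S` of a finite set of monomials (`m_∅ = 1`). -/
def mlcm {σ : Type*} (S : Finset (Mon σ)) : Mon σ := S.sup id

/-- `S` is saturated in `M`: for all `m ∈ M` and every connected subset `T ⊆ S`,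
`m ∣ m_T` implies `m ∈ S`. -/
def Saturated {σ : Type*} (M S : Finset (Mon σ)) : Prop :=
  S ⊆ M ∧ ∀ m ∈ M, ∀ T ⊆ S, IsConnected T → m ≤ mlcm T → m ∈ S

/-- The set `sat M` of non-empty saturated subsets of `M`. -/
def satSets {σ : Type*} (M : Finset (Mon σ)) : Finset (Finset (Mon σ)) :=
  M.powerset.filter (fun S => S.Nonempty ∧ Saturated M S)

/-- The saturation `S̄` of `S` in `M`. -/
def saturation {σ : Type*} (M S : Finset (Mon σ)) : Finset (Mon σ) :=
  M.filter (fun m => ∃ C ∈ components S, m ≤ mlcm C)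

/-- The simplicial complex `Δ'_S`: faces are the `T ⊆ S` with `m_T ≠ m_S`, or such that
`S_i ∩ T` is disconnected for some connected component `S_i` of `S`. -/
def dprime {σ : Type*} (S : Finset (Mon σ)) : Set (Finset (Mon σ)) :=
  {T | T ⊆ S ∧ (mlcm T ≠ mlcm S ∨ ∃ C ∈ components S, ¬ IsConnected (C ∩ T))}

/-- The simplicial complex `Δ_N`: faces are the `S ⊆ N` with `m_S ≠ m_N` or `S`
disconnected. -/
def dcomplex {σ : Type*} (N : Finset (Mon σ)) : Set (Finset (Mon σ)) :=
  {T | T ⊆ N ∧ (mlcm T ≠ mlcm N ∨ ¬ IsConnected T)}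

/-- A discrete monomial set: the monomials are pairwise without common factors. -/
def Discrete {σ : Type*} (S : Finset (Mon σ)) : Prop :=
  ∀ a ∈ S, ∀ b ∈ S, a ≠ b → ¬ NCF a b

/-- The lcm-lattice of the monomial set `M` (as a finite set of monomials,
ordered by divisibility i.e. by `≤` on exponent vectors). -/
def lcmLattice {σ : Type*} (M : Finset (Mon σ)) : Finset (Mon σ) :=
  M.powerset.image mlcm

/-- `M_l`: the set of monomials in `M` dividing the monomial `l`. -/
def divisorsIn {σ : Type*} (M : Finset (Mon σ)) (l : Mon σ) : Finset (Mon σ) :=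
  M.filter (fun m => m ≤ l)

/-- `M_N`: the set of monomials in `M` dividing some monomial of `N`. -/
def divisorsInSet {σ : Type*} (M N : Finset (Mon σ)) : Finset (Mon σ) :=
  M.filter (fun m => ∃ l ∈ N, m ≤ l)

/-- An antichain of monomials (the minimal generating set of the monomial ideal
it generates). -/
def IsAntichain' {σ : Type*} (M : Finset (Mon σ)) : Prop :=
  ∀ m ∈ M, ∀ n ∈ M, m ≤ n → m = n

/-- total degree of a monomial -/
def mdeg {t : ℕ} (m : Mon (Fin t)) : ℕ := ∑ i, m i

end MonomialRings
namespace MonomialRings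

/-! ### The multigraded Poincaré series, via the bar resolution

For a monomial ring `R = k[x₁,…,x_t]/I`, the multigraded vector spaces `Tor^R_{i,α}(k,k)`
are computed by the (normalized) bar resolution of `k` over `R`.  The monomial ring is
determined by the set `J` of exponents of monomials lying in `I`; `R` has `k`-basis the
monomials `x^β` with `β ∉ J`, and the degree-`(i,α)` part of the bar complex has basis the
lists `[β₁,…,β_i]` of nonzero exponent vectors not in `J` with `β₁ + ⋯ + β_i = α`. -/

/-- Lists forming the basis of the multigraded piece of the bar complex. -/
def barBasis {σ : Type*} (J : Set (Mon σ)) (i : ℕ) (α : Mon σ) : Set (List (Mon σ)) :=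
  {l | l.length = i ∧ l.sum = α ∧ ∀ β ∈ l, β ≠ 0 ∧ β ∉ J}

/-- Merging the entries at positions `j` and `j+1` of a list. -/
def mergeAt {σ : Type*} (l : List (Mon σ)) (j : ℕ) : List (Mon σ) :=
  l.take j ++ [l.getD j 0 + l.getD (j + 1) 0] ++ l.drop (j + 2)

/-- The bar differential on a basis element. -/
def barAux (k : Type*) [Field k] {σ : Type*} (J : Set (Mon σ)) (l : List (Mon σ)) :
    List (Mon σ) →₀ k :=
  ∑ j ∈ Finset.range (l.length - 1),
    if l.getD j 0 + l.getD (j + 1) 0 ∉ J then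
      ((-1 : k) ^ (j + 1)) • Finsupp.single (mergeAt l j) (1 : k)
    else 0

/-- The bar differential. -/
def barD (k : Type*) [Field k] {σ : Type*} (J : Set (Mon σ)) :
    (List (Mon σ) →₀ k) →ₗ[k] (List (Mon σ) →₀ k) :=
  Finsupp.linearCombination k (barAux k J)

/-- The degree-`(i,α)` part of the bar complex. -/
def barSub (k : Type*) [Field k] {σ : Type*} (J : Set (Mon σ)) (i : ℕ) (α : Mon σ) :
    Submodule k (List (Mon σ) →₀ k) :=
  Submodule.span k ((fun l => Finsupp.single l (1 : k)) '' barBasis J i α)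

/-- `dim_k Tor^R_{i,α}(k,k)` for the monomial ring `R` determined by `J`. -/
def torDim (k : Type*) [Field k] {σ : Type*} (J : Set (Mon σ)) (i : ℕ) (α : Mon σ) : ℕ :=
  Module.finrank k ↥(barSub k J i α ⊓ LinearMap.ker (barD k J))
    - Module.finrank k ↥(Submodule.map (barD k J) (barSub k J (i + 1) α))

/-- The set of exponent vectors of monomials lying in the ideal `I`. -/
def expSet {t : ℕ} {k : Type*} [Field k] (I : Ideal (MvPolynomial (Fin t) k)) :
    Set (Mon (Fin t)) :=
  {β | MvPolynomial.monomial (Finsupp.equivFunOnFinite.symm β) (1 : k) ∈ I}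

/-- The exponent (in `ℕ^t × ℕ`) of the monomial `x^α z^d`; the extra variable `none`
is the homological variable `z`. -/
def expOf {t : ℕ} (α : Mon (Fin t)) (d : ℕ) : Option (Fin t) →₀ ℕ :=
  Finsupp.equivFunOnFinite.symm (fun o => Option.elim o d α)

/-- The multigraded Poincaré series
`P^R_k(x,z) = ∑_{i,α} dim_k Tor^R_{i,α}(k,k) x^α z^i` of the monomial ring `R`
determined by `J`, as a formal power series in `x₁,…,x_t` and `z` (the variable `none`). -/
def poincareSeries (k : Type*) [Field k] {t : ℕ} (J : Set (Mon (Fin t))) :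
    MvPowerSeries (Option (Fin t)) ℤ :=
  fun e => (torDim k J (e none) (fun i => e (some i)) : ℤ)

/-- The statement that `b` is the Backelin denominator of the Poincaré series:
`P^R_k(x,z) = ∏ᵢ(1+xᵢz) / b(x,z)`. -/
def IsDenominator (k : Type*) [Field k] {t : ℕ} (J : Set (Mon (Fin t)))
    (b : MvPolynomial (Option (Fin t)) ℤ) : Prop :=
  (b : MvPowerSeries (Option (Fin t)) ℤ) * poincareSeries k J
    = ∏ i : Fin t, (1 + MvPowerSeries.X (some i) * MvPowerSeries.X none)

/-- The multigraded ideal of a monomial set: the exponents `β` with `x^m ∣ x^β` for some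
`m ∈ M`. -/
def upperSet {σ : Type*} (M : Finset (Mon σ)) : Set (Mon σ) :=
  {β | ∃ m ∈ M, m ≤ β}

/-- `I` is the monomial ideal generated by the monomial set `M`. -/
def IsMonomialIdealOf {t : ℕ} {k : Type*} [Field k] (M : Finset (Mon (Fin t)))
    (I : Ideal (MvPolynomial (Fin t) k)) : Prop :=
  I = Ideal.span ((fun m => MvPolynomial.monomial (Finsupp.equivFunOnFinite.symm m) (1 : k)) '' ↑M)

/-- The specialization `b(z) = b(1,…,1,z)` of a polynomial in `x₁,…,x_t,z`. -/
def zSpecialize {t : ℕ} (b : MvPolynomial (Option (Fin t)) ℤ) : Polynomial ℤ :=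
  MvPolynomial.aeval (fun o : Option (Fin t) => Option.elim o Polynomial.X (fun _ => 1)) b

end MonomialRings
open MonomialRings

section Homology

variable {k : Type*} [Field k]

/-- The dimension of the homology `(G₁ ∩ ker D) / D G₂`. -/
def hdim {X : Type*} [AddCommGroup X] [Module k X] (D : X →ₗ[k] X) (G₁ G₂ : Submodule k X) : ℕ :=
  Module.finrank k (↥(G₁ ⊓ LinearMap.ker D) ⧸
    (Submodule.map D G₂).comap (G₁ ⊓ LinearMap.ker D).subtype)

theorem hdim_eq_sub {X : Type*} [AddCommGroup X] [Module k X] (D : X →ₗ[k] X)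
    (G₁ G₂ : Submodule k X) [FiniteDimensional k G₁]
    (h : Submodule.map D G₂ ≤ G₁ ⊓ LinearMap.ker D) :
    hdim D G₁ G₂ = Module.finrank k ↥(G₁ ⊓ LinearMap.ker D) -
      Module.finrank k ↥(Submodule.map D G₂) := by
  have : FiniteDimensional k ↥(G₁ ⊓ LinearMap.ker D) :=
    Submodule.finiteDimensional_of_le inf_le_left
  unfold hdim
  rw [Submodule.finrank_quotient]
  congr 1
  exact (Submodule.comapSubtypeEquivOfLe h).finrank_eq

theorem hdim_eq_of_exact {X Y : Type*} [AddCommGroup X] [Module k X] [AddCommGroup Y]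
    [Module k Y] (D : X →ₗ[k] X) (D' : Y →ₗ[k] Y) (f : X →ₗ[k] Y)
    (G₀ G₁ G₂ : Submodule k X) (hDD : ∀ x, D (D x) = 0)
    (h21 : ∀ x ∈ G₂, D x ∈ G₁) (h10 : ∀ x ∈ G₁, D x ∈ G₀)
    (c1 : ∀ x ∈ G₁, f (D x) = D' (f x)) (c2 : ∀ x ∈ G₂, f (D x) = D' (f x))
    (e1 : ∀ z ∈ G₁, f z = 0 → D z = 0 → ∃ w ∈ G₂, f w = 0 ∧ D w = z)
    (e0 : ∀ z ∈ G₀, f z = 0 → D z = 0 → ∃ w ∈ G₁, f w = 0 ∧ D w = z) :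
    hdim D G₁ G₂ = hdim D' (G₁.map f) (G₂.map f) := by
  have hZ : ∀ x ∈ G₁ ⊓ LinearMap.ker D, f x ∈ G₁.map f ⊓ LinearMap.ker D' := by
    rintro x ⟨h1, h2⟩
    refine ⟨⟨x, h1, rfl⟩, ?_⟩
    change D x = 0 at h2
    change D' (f x) = 0
    rw [← c1 x h1, h2, map_zero]
  let B' := (Submodule.map D' (G₂.map f)).comap (G₁.map f ⊓ LinearMap.ker D').subtype
  let φ : ↥(G₁ ⊓ LinearMap.ker D) →ₗ[k] (↥(G₁.map f ⊓ LinearMap.ker D') ⧸ B') :=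
    B'.mkQ ∘ₗ f.restrict hZ
  have hsurj : Function.Surjective φ := by
    intro q
    obtain ⟨⟨z, hz1, hz2⟩, rfl⟩ := B'.mkQ_surjective q
    obtain ⟨x, hx, rfl⟩ := hz1
    have hx' : f (D x) = 0 := by rw [c1 x hx]; exact hz2
    obtain ⟨w, hw, hw1, hw2⟩ := e0 (D x) (h10 x hx) hx' (hDD x)
    refine ⟨⟨x - w, G₁.sub_mem hx hw, ?_⟩, ?_⟩
    · change D (x - w) = 0
      rw [map_sub, hw2, sub_self]
    · change B'.mkQ _ = _
      congr 1
      ext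
      change f (x - w) = f x
      rw [map_sub, hw1, sub_zero]
  have hker : LinearMap.ker φ =
      (Submodule.map D G₂).comap (G₁ ⊓ LinearMap.ker D).subtype := by
    ext ⟨z, hz1, hz2⟩
    rw [LinearMap.mem_ker, Submodule.mem_comap]
    change B'.mkQ _ = 0 ↔ z ∈ _
    rw [Submodule.mkQ_apply, Submodule.Quotient.mk_eq_zero, Submodule.mem_comap]
    change f z ∈ _ ↔ _
    constructor
    · rintro ⟨_, ⟨y, hy, rfl⟩, hyz⟩
      rw [← c2 y hy] at hyz
      obtain ⟨w, hw, -, hw2⟩ := e1 (z - D y) (G₁.sub_mem hz1 (h21 y hy))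
        (by rw [map_sub, hyz, sub_self])
        (by rw [map_sub, hDD, sub_zero]; exact hz2)
      refine ⟨w + y, G₂.add_mem hw hy, ?_⟩
      rw [map_add, hw2, sub_add_cancel]
    · rintro ⟨y, hy, rfl⟩
      exact ⟨f y, ⟨y, hy, rfl⟩, (c2 y hy).symm⟩
  unfold hdim
  rw [← (LinearMap.quotKerEquivOfSurjective φ hsurj).finrank_eq]
  exact (Submodule.quotEquivOfEq _ _ hker.symm).finrank_eq

/-- A triangular matching on a based complex makes it exact. -/
theorem exact_of_matching {Λ κ : Type*} [LinearOrder κ] (D : (Λ →₀ k) →ₗ[k] (Λ →₀ k))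
    (N s₁ s₂ : Set Λ) (hfin : s₁.Finite) (R : Λ → Λ → Prop) (key : Λ → κ)
    (hDD : ∀ x, D (D x) = 0)
    (hD : ∀ u ∈ N ∩ s₂, D (Finsupp.single u 1) ∈ Finsupp.supported k k (N ∩ s₁))
    (hcl : ∀ x ∈ N ∩ s₁, (∃ u ∈ N ∩ s₂, R u x) ∨ ∃ d, R x d)
    (hnot : ∀ x d u, R x d → ¬ R u x)
    (hinj : ∀ u u' d, R u d → R u' d → u = u')
    (hdiag : ∀ u d, R u d → D (Finsupp.single u 1) d ≠ 0)
    (htri : ∀ u d u' d', R u d → R u' d' → D (Finsupp.single u 1) d' ≠ 0 → d' ≠ d →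
      key d' < key d)
    (z : Λ →₀ k) (hz : z ∈ Finsupp.supported k k (N ∩ s₁)) (hDz : D z = 0) :
    ∃ y ∈ Finsupp.supported k k (N ∩ s₂), D y = z := by
  have hD' : ∀ y ∈ Finsupp.supported k k (N ∩ s₂), D y ∈ Finsupp.supported k k (N ∩ s₁) := by
    intro y hy
    rw [Finsupp.supported_eq_span_single] at hy
    induction hy using Submodule.span_induction with
    | mem x h => obtain ⟨u, hu, rfl⟩ := h; exact hD u hu
    | zero => simp
    | add x y _ _ hx hy => rw [map_add]; exact Submodule.add_mem _ hx hy
    | smul a x _ hx => rw [map_smul]; exact Submodule.smul_mem _ _ hx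
  let W : Submodule k (Λ →₀ k) :=
    { carrier := {v | ∃ y ∈ Finsupp.supported k k (N ∩ s₂), ∀ u d, R u d → v d = D y d}
      add_mem' := by
        rintro a b ⟨y, hy, h⟩ ⟨y', hy', h'⟩
        refine ⟨y + y', Submodule.add_mem _ hy hy', fun u d hr => ?_⟩
        rw [map_add, Finsupp.add_apply, Finsupp.add_apply, h u d hr, h' u d hr]
      zero_mem' := ⟨0, Submodule.zero_mem _, by simp⟩
      smul_mem' := by
        rintro c a ⟨y, hy, h⟩
        refine ⟨c • y, Submodule.smul_mem _ _ hy, fun u d hr => ?_⟩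
        rw [map_smul, Finsupp.smul_apply, Finsupp.smul_apply, h u d hr] }
  have hup : ∀ x d, R x d → Finsupp.single x (1 : k) ∈ W := by
    intro x d hx
    refine ⟨0, Submodule.zero_mem _, fun u d' hr => ?_⟩
    rw [map_zero, Finsupp.single_apply, if_neg]
    · rfl
    · rintro rfl
      exact hnot _ _ _ hx hr
  have hmem : ∀ x ∈ N ∩ s₁, Finsupp.single x (1 : k) ∈ W := by
    by_contra! hcon
    obtain ⟨d, ⟨hd, hdW⟩, hmin⟩ := Set.exists_min_image
      {x | x ∈ N ∩ s₁ ∧ Finsupp.single x (1 : k) ∉ W} key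
      (hfin.subset fun x hx => hx.1.2) hcon
    rcases hcl d hd with ⟨u, hu, hr⟩ | ⟨d', hr⟩
    swap
    · exact hdW (hup _ _ hr)
    have huW : D (Finsupp.single u 1) ∈ W :=
      ⟨Finsupp.single u 1, Finsupp.single_mem_supported k 1 hu, fun _ _ _ => rfl⟩
    have hrest : (D (Finsupp.single u 1)).erase d ∈ W := by
      rw [← Finsupp.sum_single ((D (Finsupp.single u 1)).erase d)]
      refine Submodule.sum_mem _ fun x hx => ?_
      rw [Finsupp.support_erase, Finset.mem_erase, Finsupp.mem_support_iff] at hx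
      have hxm : x ∈ N ∩ s₁ := hD u hu (Finsupp.mem_support_iff.2 hx.2)
      have : Finsupp.single x (1 : k) ∈ W := by
        rcases hcl x hxm with ⟨u', -, hr'⟩ | ⟨d', hr'⟩
        · by_contra hxW
          exact absurd (hmin x ⟨hxm, hxW⟩) (not_le.2 (htri _ _ _ _ hr hr' hx.2 hx.1))
        · exact hup _ _ hr'
      have h2 := W.smul_mem (((D (Finsupp.single u 1)).erase d) x) this
      rwa [Finsupp.smul_single, smul_eq_mul, mul_one] at h2
    apply hdW
    have h3 := W.smul_mem ((D (Finsupp.single u 1) d)⁻¹) (W.sub_mem huW hrest)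
    convert h3 using 1
    have h4 := Finsupp.single_add_erase d (D (Finsupp.single u 1))
    rw [← eq_sub_of_add_eq h4, Finsupp.smul_single, smul_eq_mul, inv_mul_cancel₀ (hdiag _ _ hr)]
  have hzW : z ∈ W := by
    rw [← Finsupp.sum_single z]
    refine Submodule.sum_mem _ fun x hx => ?_
    have h2 := W.smul_mem (z x) (hmem x (hz hx))
    rwa [Finsupp.smul_single, smul_eq_mul, mul_one] at h2
  obtain ⟨y, hy, hyz⟩ := hzW
  refine ⟨y, hy, ?_⟩
  by_contra hne
  set v := z - D y with hv
  have hv0 : v ≠ 0 := fun h => hne (sub_eq_zero.1 h).symm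
  have hDv : D v = 0 := by rw [hv, map_sub, hDz, hDD, sub_zero]
  have hvs : v ∈ Finsupp.supported k k (N ∩ s₁) := Submodule.sub_mem _ hz (hD' y hy)
  have hvup : ∀ x, v x ≠ 0 → ∃ d, R x d := by
    intro x hx
    rcases hcl x (hvs (Finsupp.mem_support_iff.2 hx)) with ⟨u, -, hr⟩ | h
    · exact absurd (by rw [hv, Finsupp.sub_apply, hyz _ _ hr, sub_self]) hx
    · exact h
  choose! g hg using hvup
  obtain ⟨u, hu, hmax⟩ := Finset.exists_max_image v.support (fun x => key (g x))
    (Finsupp.support_nonempty_iff.2 hv0)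
  rw [Finsupp.mem_support_iff] at hu
  have hcoef : D v (g u) = v u * D (Finsupp.single u 1) (g u) := by
    conv_lhs => rw [← Finsupp.sum_single v, Finsupp.sum, map_sum, Finsupp.finsetSum_apply]
    rw [Finset.sum_eq_single u]
    · rw [← mul_one (v u), ← smul_eq_mul, ← Finsupp.smul_single, map_smul]; simp
    · intro x hx hxu
      by_contra hc
      rw [Finsupp.mem_support_iff] at hx
      rw [← mul_one (v x), ← smul_eq_mul, ← Finsupp.smul_single, map_smul, Finsupp.smul_apply,
        smul_eq_mul] at hc
      have hgne : g u ≠ g x := fun h =>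
        hxu (hinj _ _ _ (hg x hx) (h ▸ hg u hu))
      exact absurd (hmax x (Finsupp.mem_support_iff.2 hx)) (not_le.2
        (htri _ _ _ _ (hg x hx) (hg u hu) (right_ne_zero_of_mul hc) hgne))
    · intro h
      rw [Finsupp.notMem_support_iff.1 h]; simp
  rw [hDv] at hcoef
  exact mul_ne_zero hu (hdiag _ _ (hg u hu)) hcoef.symm

/-- Restriction of finitely supported functions along `ι`, keeping the coordinates in `Good`. -/
def pullGood {Λ Λ' : Type*} (ι : Λ' → Λ) (hι : Function.Injective ι) (Good : Set Λ') :
    (Λ →₀ k) →ₗ[k] (Λ' →₀ k) where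
  toFun x := (Finsupp.comapDomain ι x hι.injOn).filter (· ∈ Good)
  map_add' x y := by
    ext a
    by_cases h : a ∈ Good <;> simp [h]
  map_smul' c x := by
    ext a
    by_cases h : a ∈ Good <;> simp [h]

theorem pullGood_apply {Λ Λ' : Type*} (ι : Λ' → Λ) (hι : Function.Injective ι) (Good : Set Λ')
    (x : Λ →₀ k) (a : Λ') : pullGood ι hι Good x a = if a ∈ Good then x (ι a) else 0 := by
  change Finsupp.filter _ _ a = _
  rw [Finsupp.filter_apply]
  rfl

theorem map_pullGood {Λ Λ' : Type*} (ι : Λ' → Λ) (hι : Function.Injective ι) (Good : Set Λ')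
    (s : Set Λ) : (Finsupp.supported k k s).map (pullGood ι hι Good) =
      Finsupp.supported k k {a | a ∈ Good ∧ ι a ∈ s} := by
  apply le_antisymm
  · rintro _ ⟨x, hx, rfl⟩ a ha
    rw [Finset.mem_coe, Finsupp.mem_support_iff, pullGood_apply] at ha
    by_cases h : a ∈ Good
    · rw [if_pos h] at ha
      exact ⟨h, hx (Finsupp.mem_support_iff.2 ha)⟩
    · simp [h] at ha
  · rw [Finsupp.supported_eq_span_single, Submodule.span_le]
    rintro _ ⟨a, ⟨h1, h2⟩, rfl⟩
    refine ⟨Finsupp.single (ι a) 1, Finsupp.single_mem_supported k 1 h2, ?_⟩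
    ext b
    rw [pullGood_apply, Finsupp.single_apply, Finsupp.single_apply]
    by_cases hab : a = b
    · subst hab; simp [h1]
    · simp [hab, hι.ne_iff]

theorem hdim_eq_of_matching {Λ Λ' κ : Type*} [LinearOrder κ] (D : (Λ →₀ k) →ₗ[k] (Λ →₀ k))
    (D' : (Λ' →₀ k) →ₗ[k] (Λ' →₀ k)) (ι : Λ' → Λ) (hι : Function.Injective ι) (Good : Set Λ')
    (s : ℕ → Set Λ) (hfin : ∀ j, (s j).Finite) (R : Λ → Λ → Prop) (key : Λ → κ)
    (hDD : ∀ x, D (D x) = 0)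
    (hs : ∀ j, ∀ x ∈ s (j + 1), D (Finsupp.single x 1) ∈ Finsupp.supported k k (s j))
    (hf : ∀ j, ∀ x ∈ s j, pullGood ι hι Good (D (Finsupp.single x 1)) =
      D' (pullGood ι hι Good (Finsupp.single x 1)))
    (hcl : ∀ j, ∀ x ∈ s j, x ∉ ι '' Good →
      (∃ u, u ∉ ι '' Good ∧ u ∈ s (j + 1) ∧ R u x) ∨ ∃ d, R x d)
    (hnot : ∀ x d u, R x d → ¬ R u x)
    (hinj : ∀ u u' d, R u d → R u' d → u = u')
    (hdiag : ∀ u d, R u d → D (Finsupp.single u 1) d ≠ 0)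
    (htri : ∀ u d u' d', R u d → R u' d' → D (Finsupp.single u 1) d' ≠ 0 → d' ≠ d →
      key d' < key d) (j : ℕ) :
    hdim D (Finsupp.supported k k (s (j + 1))) (Finsupp.supported k k (s (j + 2))) =
      hdim D' (Finsupp.supported k k {a | a ∈ Good ∧ ι a ∈ s (j + 1)})
        (Finsupp.supported k k {a | a ∈ Good ∧ ι a ∈ s (j + 2)}) := by
  set f : (Λ →₀ k) →ₗ[k] (Λ' →₀ k) := pullGood ι hι Good with hfdef
  have hs' : ∀ j, ∀ x ∈ Finsupp.supported k k (s (j + 1)), D x ∈ Finsupp.supported k k (s j) := by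
    intro j y hy
    rw [Finsupp.supported_eq_span_single] at hy
    induction hy using Submodule.span_induction with
    | mem x h => obtain ⟨u, hu, rfl⟩ := h; exact hs j u hu
    | zero => simp
    | add x y _ _ hx hy => rw [map_add]; exact Submodule.add_mem _ hx hy
    | smul a x _ hx => rw [map_smul]; exact Submodule.smul_mem _ _ hx
  have hf' : ∀ j, ∀ x ∈ Finsupp.supported k k (s j), f (D x) = D' (f x) := by
    intro j y hy
    rw [Finsupp.supported_eq_span_single] at hy
    induction hy using Submodule.span_induction with
    | mem x h => obtain ⟨u, hu, rfl⟩ := h; exact hf j u hu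
    | zero => simp
    | add x y _ _ hx hy => simp only [map_add, hx, hy]
    | smul a x _ hx => simp only [map_smul, hx]
  have hker : ∀ j, ∀ x ∈ Finsupp.supported k k (s j), f x = 0 →
      x ∈ Finsupp.supported k k ((ι '' Good)ᶜ ∩ s j) := by
    intro j x hx h0 a ha
    refine ⟨?_, hx ha⟩
    rintro ⟨b, hb, rfl⟩
    have := DFunLike.congr_fun h0 b
    rw [hfdef, pullGood_apply, if_pos hb] at this
    exact Finsupp.mem_support_iff.1 ha this
  have hker' : ∀ j, ∀ x ∈ Finsupp.supported k k ((ι '' Good)ᶜ ∩ s j), f x = 0 := by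
    intro j x hx
    ext b
    rw [hfdef, pullGood_apply]
    split_ifs with h
    · by_contra hc
      exact (hx (Finsupp.mem_support_iff.2 hc)).1 ⟨b, h, rfl⟩
    · rfl
  have hex : ∀ j, ∀ z ∈ Finsupp.supported k k (s j), f z = 0 → D z = 0 →
      ∃ w ∈ Finsupp.supported k k (s (j + 1)), f w = 0 ∧ D w = z := by
    intro j z hz hfz hDz
    obtain ⟨y, hy, hyz⟩ := exact_of_matching D (ι '' Good)ᶜ (s j) (s (j + 1)) (hfin j) R key hDD
      (fun u hu => hker j _ (hs j u hu.2) (by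
        have hus := Finsupp.single_mem_supported k (1 : k) hu.2
        rw [hf' _ _ hus, hker' (j + 1) _ (Finsupp.single_mem_supported k 1 hu), map_zero]))
      (fun x hx => by
        rcases hcl j x hx.2 hx.1 with ⟨u, h1, h2, h3⟩ | h
        · exact Or.inl ⟨u, ⟨h1, h2⟩, h3⟩
        · exact Or.inr h)
      hnot hinj hdiag htri z (hker j z hz hfz) hDz
    exact ⟨y, Finsupp.supported_mono Set.inter_subset_right hy, hker' _ y hy, hyz⟩
  rw [hdim_eq_of_exact D D' f (Finsupp.supported k k (s j)) _ _ hDD (hs' (j + 1)) (hs' j)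
    (hf' _) (hf' _) (hex _) (hex _), map_pullGood, map_pullGood]

end Homology

/-- Basis elements of the Taylor algebra with a monomial coefficient: a total exponent together
with a set of indices of generators. -/
abbrev Blk (t n : ℕ) := Mon (Fin t) × Finset (Fin n)

section Signs

variable (k : Type*) [Field k] {n : ℕ}

/-- The sign of moving `s` in front of the elements of `S` preceding it. -/
def eps (S : Finset (Fin n)) (s : Fin n) : k := ∏ x ∈ S, if x < s then -1 else 1

/-- The sign of the shuffle of `S` and `T`. -/
def sg (S T : Finset (Fin n)) : k := ∏ s ∈ S, eps k T s

variable {k}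

theorem eps_mul_self (S : Finset (Fin n)) (s : Fin n) : eps k S s * eps k S s = 1 := by
  unfold eps
  rw [← Finset.prod_mul_distrib]
  refine Finset.prod_eq_one fun x _ => ?_
  split_ifs <;> simp

theorem eps_ne_zero (S : Finset (Fin n)) (s : Fin n) : eps k S s ≠ 0 := fun h => by
  have := eps_mul_self (k := k) S s
  simp [h] at this

theorem sg_ne_zero (S T : Finset (Fin n)) : sg k S T ≠ 0 :=
  Finset.prod_ne_zero_iff.2 fun s _ => eps_ne_zero T s

theorem eps_union {S T : Finset (Fin n)} (h : Disjoint S T) (s : Fin n) :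
    eps k (S ∪ T) s = eps k S s * eps k T s := Finset.prod_union h

theorem sg_union_left {S T : Finset (Fin n)} (h : Disjoint S T) (U : Finset (Fin n)) :
    sg k (S ∪ T) U = sg k S U * sg k T U := Finset.prod_union h

theorem sg_union_right {S T : Finset (Fin n)} (h : Disjoint S T) (U : Finset (Fin n)) :
    sg k U (S ∪ T) = sg k U S * sg k U T := by
  unfold sg
  rw [← Finset.prod_mul_distrib]
  exact Finset.prod_congr rfl fun s _ => eps_union h s

theorem eps_erase (S : Finset (Fin n)) (s : Fin n) : eps k (S.erase s) s = eps k S s := by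
  unfold eps
  by_cases h : s ∈ S
  · rw [← Finset.mul_prod_erase S _ h]; simp
  · rw [Finset.erase_eq_of_notMem h]

theorem eps_erase_mul {S : Finset (Fin n)} {x : Fin n} (hx : x ∈ S) (s : Fin n) :
    eps k S s = (if x < s then -1 else 1) * eps k (S.erase x) s :=
  (Finset.mul_prod_erase S _ hx).symm

theorem sg_erase_left {S : Finset (Fin n)} {s : Fin n} (hs : s ∈ S) (T : Finset (Fin n)) :
    sg k S T = eps k T s * sg k (S.erase s) T := (Finset.mul_prod_erase S _ hs).symm

theorem sg_erase_right {T : Finset (Fin n)} {s : Fin n} (hs : s ∈ T) {S : Finset (Fin n)}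
    (hS : s ∉ S) :
    eps k S s * sg k S T = (-1) ^ S.card * sg k S (T.erase s) := by
  unfold sg eps
  rw [← Finset.prod_const, ← Finset.prod_mul_distrib, ← Finset.prod_mul_distrib]
  refine Finset.prod_congr rfl fun x hx => ?_
  rw [← Finset.mul_prod_erase T _ hs, ← mul_assoc]
  congr 1
  have hne : x ≠ s := fun h => hS (h ▸ hx)
  rcases lt_or_gt_of_ne hne with h | h
  · simp [h, h.not_gt]
  · simp [h, h.not_gt]

end Signs

section BarTaylor

variable (k : Type*) [Field k] {t n : ℕ}

/-- The Taylor differential of a block. -/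
def blkD (a : Blk t n) : Blk t n →₀ k :=
  ∑ s ∈ a.2, eps k a.2 s • Finsupp.single (a.1, a.2.erase s) 1

/-- The product of two blocks in the Taylor algebra. -/
def blkMul (a b : Blk t n) : Blk t n →₀ k :=
  if Disjoint a.2 b.2 then sg k a.2 b.2 • Finsupp.single (a.1 + b.1, a.2 ∪ b.2) 1 else 0

/-- The Taylor differential. -/
def tayD : (Blk t n →₀ k) →ₗ[k] (Blk t n →₀ k) := Finsupp.linearCombination k (blkD k)

/-- The Taylor product. -/
def tayMul : (Blk t n →₀ k) →ₗ[k] (Blk t n →₀ k) →ₗ[k] (Blk t n →₀ k) :=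
  Finsupp.linearCombination k fun a => Finsupp.linearCombination k (blkMul k a)

/-- The grading automorphism. -/
def taySgn : (Blk t n →₀ k) →ₗ[k] (Blk t n →₀ k) :=
  Finsupp.linearCombination k fun a => (-1 : k) ^ a.2.card • Finsupp.single a 1

/-- Concatenating a block in front of a list, bilinearly. -/
def consB : (Blk t n →₀ k) →ₗ[k] (List (Blk t n) →₀ k) →ₗ[k] (List (Blk t n) →₀ k) :=
  Finsupp.linearCombination k fun a => Finsupp.lmapDomain k k (List.cons a)

/-- Multiplying a block onto the first entry of a list. -/
def headMulAux (a : Blk t n) : List (Blk t n) → (List (Blk t n) →₀ k)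
  | [] => 0
  | b :: l => consB k (blkMul k a b) (Finsupp.single l 1)

/-- Multiplying onto the first entry of a list, bilinearly. -/
def headMul : (Blk t n →₀ k) →ₗ[k] (List (Blk t n) →₀ k) →ₗ[k] (List (Blk t n) →₀ k) :=
  Finsupp.linearCombination k fun a => Finsupp.linearCombination k (headMulAux k a)

/-- The differential of the bar construction on the Taylor algebra, on basis elements. -/
def btAux : List (Blk t n) → (List (Blk t n) →₀ k)
  | [] => 0
  | a :: l => -consB k (blkD k a) (Finsupp.single l 1) -
      (-1 : k) ^ a.2.card • (consB k (Finsupp.single a 1) (btAux l) +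
        headMul k (Finsupp.single a 1) (Finsupp.single l 1))

/-- The differential of the bar construction on the Taylor algebra. -/
def btD : (List (Blk t n) →₀ k) →ₗ[k] (List (Blk t n) →₀ k) :=
  Finsupp.linearCombination k (btAux k)

variable {k}

@[simp] theorem tayD_single (a : Blk t n) : tayD k (Finsupp.single a 1) = blkD k a := by
  simp [tayD]

@[simp] theorem tayMul_single (a b : Blk t n) :
    tayMul k (Finsupp.single a 1) (Finsupp.single b 1) = blkMul k a b := by
  simp [tayMul]

@[simp] theorem taySgn_single (a : Blk t n) :
    taySgn k (Finsupp.single a 1) = (-1 : k) ^ a.2.card • Finsupp.single a 1 := by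
  simp [taySgn]

@[simp] theorem consB_single (a : Blk t n) (l : List (Blk t n)) :
    consB k (Finsupp.single a 1) (Finsupp.single l 1) = Finsupp.single (a :: l) 1 := by
  simp [consB]

@[simp] theorem headMul_nil (v : Blk t n →₀ k) :
    headMul k v (Finsupp.single [] 1) = 0 := by
  induction v using Finsupp.induction_linear with
  | zero => simp
  | add x y hx hy => simp [hx, hy]
  | single a c => simp [headMul, headMulAux]

theorem btD_single (l : List (Blk t n)) : btD k (Finsupp.single l 1) = btAux k l := by
  simp [btD]

@[simp] theorem btD_nil : btD k (Finsupp.single ([] : List (Blk t n)) 1) = 0 := by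
  simp [btD, btAux]

theorem finsupp_lin_induction {α : Type*} {p : (α →₀ k) → Prop} (zero : p 0)
    (add : ∀ x y, p x → p y → p (x + y)) (smul : ∀ (c : k) x, p x → p (c • x))
    (single : ∀ a, p (Finsupp.single a 1)) (x : α →₀ k) : p x := by
  induction x using Finsupp.induction_linear with
  | zero => exact zero
  | add x y hx hy => exact add x y hx hy
  | single a c => simpa using smul c _ (single a)

theorem headMul_consB (v w : Blk t n →₀ k) (x : List (Blk t n) →₀ k) :
    headMul k v (consB k w x) = consB k (tayMul k v w) x := by
  induction v using finsupp_lin_induction with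
  | zero => simp only [map_zero, LinearMap.zero_apply]
  | add x₁ x₂ h₁ h₂ => simp only [map_add, LinearMap.add_apply, h₁, h₂]
  | smul c x₁ h₁ =>
    simp only [map_smul, LinearMap.smul_apply, h₁]
  | single a =>
    induction w using finsupp_lin_induction with
    | zero => simp only [map_zero, LinearMap.zero_apply]
    | add x₁ x₂ h₁ h₂ => simp only [map_add, LinearMap.add_apply, h₁, h₂]
    | smul c x₁ h₁ =>
      simp only [map_smul, LinearMap.smul_apply, h₁]
    | single b =>
      induction x using finsupp_lin_induction with
      | zero => simp only [map_zero]
      | add x₁ x₂ h₁ h₂ => simp only [map_add, h₁, h₂]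
      | smul c x₁ h₁ =>
        simp only [map_smul, h₁]
      | single l =>
        simp [headMul, headMulAux]

theorem btD_consB (v : Blk t n →₀ k) (x : List (Blk t n) →₀ k) :
    btD k (consB k v x) = -consB k (tayD k v) x - consB k (taySgn k v) (btD k x) -
      headMul k (taySgn k v) x := by
  induction v using finsupp_lin_induction with
  | zero => simp only [map_zero, LinearMap.zero_apply, neg_zero, sub_zero]
  | add x₁ x₂ h₁ h₂ => simp only [map_add, LinearMap.add_apply, h₁, h₂] <;> abel
  | smul c x₁ h₁ =>
    simp only [map_smul, LinearMap.smul_apply, h₁, smul_sub, smul_neg]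
  | single a =>
    induction x using finsupp_lin_induction with
    | zero => simp only [map_zero, neg_zero, sub_zero]
    | add x₁ x₂ h₁ h₂ => simp only [map_add, h₁, h₂] <;> abel
    | smul c x₁ h₁ =>
      simp only [map_smul, h₁, smul_sub, smul_neg]
    | single l =>
      rw [consB_single, btD_single, btD_single, btAux, tayD_single, taySgn_single, map_smul, map_smul,
        LinearMap.smul_apply, LinearMap.smul_apply, smul_add]
      abel

theorem tayMul_tayD (v w : Blk t n →₀ k) :
    tayD k (tayMul k v w) = tayMul k (tayD k v) w + tayMul k (taySgn k v) (tayD k w) := by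
  induction v using finsupp_lin_induction with
  | zero => simp only [map_zero, LinearMap.zero_apply, add_zero]
  | add x₁ x₂ h₁ h₂ => simp only [map_add, LinearMap.add_apply, h₁, h₂] <;> abel
  | smul c x₁ h₁ =>
    simp only [map_smul, LinearMap.smul_apply, h₁, smul_add]
  | single a =>
    induction w using finsupp_lin_induction with
    | zero => simp only [map_zero, add_zero]
    | add x₁ x₂ h₁ h₂ => simp only [map_add, h₁, h₂] <;> abel
    | smul c x₁ h₁ =>
      simp only [map_smul, h₁, smul_add]
    | single b =>
      obtain ⟨β, S⟩ := a
      obtain ⟨γ, T⟩ := b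
      simp only [tayMul_single, tayD_single, taySgn_single, blkD, map_sum, LinearMap.sum_apply,
        map_smul, LinearMap.smul_apply, blkMul]
      by_cases hd : Disjoint S T
      · rw [if_pos hd, map_smul, tayD_single, blkD, Finset.sum_union hd, smul_add, Finset.smul_sum,
          Finset.smul_sum]
        dsimp only
        congr 1
        · refine Finset.sum_congr rfl fun s hs => ?_
          rw [if_pos (hd.mono_left (Finset.erase_subset _ _)), smul_smul, smul_smul, eps_union hd,
            sg_erase_left hs T]
          have hsT : s ∉ T := Finset.disjoint_left.1 hd hs
          rw [Finset.erase_union_distrib, Finset.erase_eq_of_notMem hsT]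
          congr 1
          linear_combination (eps k S s * sg k (S.erase s) T) * eps_mul_self (k := k) T s
        · refine Finset.sum_congr rfl fun s hs => ?_
          have hsS : s ∉ S := Finset.disjoint_right.1 hd hs
          rw [if_pos (hd.mono_right (Finset.erase_subset _ _)), smul_smul, smul_smul, smul_smul,
            eps_union hd, Finset.erase_union_distrib, Finset.erase_eq_of_notMem hsS]
          congr 1
          linear_combination eps k T s * sg_erase_right (k := k) hs hsS
      · rw [if_neg hd, map_zero]
        obtain ⟨s, hsS, hsT⟩ := Finset.not_disjoint_iff.1 hd
        have hS : ∀ x ∈ S, x ≠ s → ¬ Disjoint (S.erase x) T := fun x _ hx =>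
          Finset.not_disjoint_iff.2 ⟨s, Finset.mem_erase.2 ⟨hx.symm, hsS⟩, hsT⟩
        have hT : ∀ x ∈ T, x ≠ s → ¬ Disjoint S (T.erase x) := fun x _ hx =>
          Finset.not_disjoint_iff.2 ⟨s, hsS, Finset.mem_erase.2 ⟨hx.symm, hsT⟩⟩
        rw [Finset.sum_eq_single s (fun x hx hxs => by rw [if_neg (hS x hx hxs), smul_zero])
            (fun h => absurd hsS h),
          Finset.sum_eq_single s (fun x hx hxs => by rw [if_neg (hT x hx hxs), smul_zero, smul_zero])
            (fun h => absurd hsT h)]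
        have e1 : Disjoint (S.erase s) T ↔ S ∩ T = {s} := by
          rw [Finset.disjoint_left, Finset.ext_iff]
          constructor
          · intro h x
            rw [Finset.mem_inter, Finset.mem_singleton]
            constructor
            · rintro ⟨h1, h2⟩
              by_contra hx
              exact h (Finset.mem_erase.2 ⟨hx, h1⟩) h2
            · rintro rfl; exact ⟨hsS, hsT⟩
          · intro h x hx hxT
            have := (h x).1 (Finset.mem_inter.2 ⟨Finset.mem_of_mem_erase hx, hxT⟩)
            exact Finset.ne_of_mem_erase hx (Finset.mem_singleton.1 this)
        have e2 : Disjoint S (T.erase s) ↔ Disjoint (S.erase s) T := by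
          rw [Finset.disjoint_left, Finset.disjoint_left]
          constructor
          · intro h x hx hxT
            exact h (Finset.mem_of_mem_erase hx)
              (Finset.mem_erase.2 ⟨Finset.ne_of_mem_erase hx, hxT⟩)
          · intro h x hx hxT
            exact h (Finset.mem_erase.2 ⟨Finset.ne_of_mem_erase hxT, hx⟩)
              (Finset.mem_of_mem_erase hxT)
        by_cases h : Disjoint (S.erase s) T
        · rw [if_pos h, if_pos (e2.2 h)]
          have hu1 : S.erase s ∪ T = S ∪ T := by
            ext x
            simp only [Finset.mem_union, Finset.mem_erase]
            by_cases hx : x = s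
            · subst hx; simp [hsT]
            · simp [hx]
          have hu2 : S ∪ T.erase s = S ∪ T := by
            ext x
            simp only [Finset.mem_union, Finset.mem_erase]
            by_cases hx : x = s
            · subst hx; simp [hsS]
            · simp [hx]
          rw [hu1, hu2, smul_smul, smul_smul, smul_smul, ← add_smul]
          have h1 := sg_erase_right (k := k) hsT (Finset.notMem_erase s S)
          rw [eps_erase] at h1
          have h2 := sg_erase_left (k := k) hsS (T.erase s)
          rw [eps_erase] at h2
          have hc : (-1 : k) ^ S.card = -(-1) ^ (S.erase s).card := by
            rw [← Finset.card_erase_add_one hsS, pow_succ]; ring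
          have : eps k S s * sg k (S.erase s) T +
              (-1) ^ S.card * (eps k T s * sg k S (T.erase s)) = 0 := by
            rw [h1, h2, hc]
            linear_combination (-(-1) ^ (S.erase s).card * sg k (S.erase s) (T.erase s)) *
              eps_mul_self (k := k) T s
          rw [mul_comm (eps k T s), mul_assoc, this, zero_smul]
        · rw [if_neg h, if_neg fun h' => h (e2.1 h')]
          simp

theorem tayMul_assoc (u v w : Blk t n →₀ k) :
    tayMul k u (tayMul k v w) = tayMul k (tayMul k u v) w := by
  induction u using finsupp_lin_induction with
  | zero => simp only [map_zero, LinearMap.zero_apply]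
  | add x₁ x₂ h₁ h₂ => simp only [map_add, LinearMap.add_apply, h₁, h₂]
  | smul c x₁ h₁ =>
    simp only [map_smul, LinearMap.smul_apply, h₁]
  | single a =>
    induction v using finsupp_lin_induction with
    | zero => simp only [map_zero, LinearMap.zero_apply]
    | add x₁ x₂ h₁ h₂ => simp only [map_add, LinearMap.add_apply, h₁, h₂]
    | smul c x₁ h₁ =>
      simp only [map_smul, LinearMap.smul_apply, h₁]
    | single b =>
      induction w using finsupp_lin_induction with
      | zero => simp only [map_zero]
      | add x₁ x₂ h₁ h₂ => simp only [map_add, h₁, h₂]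
      | smul c x₁ h₁ =>
        simp only [map_smul, h₁]
      | single c =>
        obtain ⟨α, S⟩ := a
        obtain ⟨β, T⟩ := b
        obtain ⟨γ, U⟩ := c
        simp only [tayMul_single, blkMul]
        by_cases h1 : Disjoint T U
        · by_cases h2 : Disjoint S T
          · by_cases h3 : Disjoint S U
            · rw [if_pos h1, if_pos h2, map_smul, map_smul, LinearMap.smul_apply, tayMul_single,
                tayMul_single, blkMul, blkMul, if_pos (Finset.disjoint_union_right.2 ⟨h2, h3⟩),
                if_pos (Finset.disjoint_union_left.2 ⟨h3, h1⟩), smul_smul, smul_smul,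
                sg_union_right h1, sg_union_left h2]
              dsimp only
              rw [add_assoc, Finset.union_assoc]
              congr 1
              ring
            · rw [if_pos h1, if_pos h2, map_smul, map_smul, LinearMap.smul_apply, tayMul_single,
                tayMul_single, blkMul, blkMul,
                if_neg fun h => h3 (Finset.disjoint_union_right.1 h).2,
                if_neg fun h => h3 (Finset.disjoint_union_left.1 h).1]
              simp
          · rw [if_pos h1, if_neg h2, map_smul, tayMul_single, blkMul,
              if_neg fun h => h2 (Finset.disjoint_union_right.1 h).1]
            simp
        · rw [if_neg h1, map_zero]
          split_ifs with h2
          · rw [map_smul, LinearMap.smul_apply, tayMul_single, blkMul,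
              if_neg fun h => h1 (Finset.disjoint_union_left.1 h).2, smul_zero]
          · simp

theorem taySgn_tayMul (v w : Blk t n →₀ k) :
    taySgn k (tayMul k v w) = tayMul k (taySgn k v) (taySgn k w) := by
  induction v using finsupp_lin_induction with
  | zero => simp only [map_zero, LinearMap.zero_apply]
  | add x₁ x₂ h₁ h₂ => simp only [map_add, LinearMap.add_apply, h₁, h₂]
  | smul c x₁ h₁ =>
    simp only [map_smul, LinearMap.smul_apply, h₁]
  | single a =>
    induction w using finsupp_lin_induction with
    | zero => simp only [map_zero]
    | add x₁ x₂ h₁ h₂ => simp only [map_add, h₁, h₂]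
    | smul c x₁ h₁ =>
      simp only [map_smul, h₁]
    | single b =>
      simp only [tayMul_single, taySgn_single, map_smul, LinearMap.smul_apply, blkMul]
      split_ifs with h
      · rw [map_smul, taySgn_single, Finset.card_union_of_disjoint h, pow_add, smul_smul, smul_smul,
          smul_smul]
        congr 1
        ring
      · simp

theorem taySgn_tayD (v : Blk t n →₀ k) : taySgn k (tayD k v) = -tayD k (taySgn k v) := by
  induction v using finsupp_lin_induction with
  | zero => simp only [map_zero, neg_zero]
  | add x₁ x₂ h₁ h₂ => simp only [map_add, h₁, h₂] <;> abel
  | smul c x₁ h₁ =>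
    simp only [map_smul, h₁, smul_neg]
  | single a =>
    simp only [tayD_single, taySgn_single, map_smul, blkD, map_sum]
    rw [Finset.smul_sum, ← Finset.sum_neg_distrib]
    refine Finset.sum_congr rfl fun s hs => ?_
    rw [smul_smul, smul_smul, ← neg_smul]
    congr 1
    rw [← Finset.card_erase_add_one hs, pow_succ]
    ring

theorem tayD_tayD (v : Blk t n →₀ k) : tayD k (tayD k v) = 0 := by
  induction v using finsupp_lin_induction with
  | zero => simp only [map_zero]
  | add x₁ x₂ h₁ h₂ => simp only [map_add, h₁, h₂] <;> abel
  | smul c x₁ h₁ =>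
    simp only [map_smul, h₁, smul_zero]
  | single a =>
    obtain ⟨β, S⟩ := a
    simp only [tayD_single, blkD, map_sum, map_smul]
    simp only [Finset.smul_sum, smul_smul]
    rw [Finset.sum_sigma']
    refine Finset.sum_involution (fun p _ => ⟨p.2, p.1⟩) ?_ ?_ ?_ ?_
    · rintro ⟨x, y⟩ h
      rw [Finset.mem_sigma] at h
      obtain ⟨hx, hy⟩ := h
      dsimp only at hx hy ⊢
      obtain ⟨hne, hyS⟩ := Finset.mem_erase.1 hy
      rw [Finset.erase_right_comm, ← add_smul]
      convert zero_smul k _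
      rw [eps_erase_mul hyS x, eps_erase_mul hx y]
      rcases lt_or_gt_of_ne hne with h | h
      · simp only [h, h.not_gt, if_true, if_false]; ring
      · simp only [h, h.not_gt, if_true, if_false]; ring
    · rintro ⟨x, y⟩ h _ heq
      rw [Finset.mem_sigma] at h
      have : y = x := (Sigma.mk.inj heq).1
      exact (Finset.mem_erase.1 h.2).1 this
    · rintro ⟨x, y⟩ h
      rw [Finset.mem_sigma] at h ⊢
      obtain ⟨hx, hy⟩ := h
      obtain ⟨hne, hyS⟩ := Finset.mem_erase.1 hy
      exact ⟨hyS, Finset.mem_erase.2 ⟨hne.symm, hx⟩⟩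
    · rintro ⟨x, y⟩ h
      rfl

theorem btD_headMul (v : Blk t n →₀ k) (x : List (Blk t n) →₀ k) :
    btD k (headMul k v x) = -headMul k (tayD k v) x + headMul k (taySgn k v) (btD k x) := by
  induction x using finsupp_lin_induction with
  | zero => simp only [map_zero, neg_zero, add_zero]
  | add x₁ x₂ h₁ h₂ => simp only [map_add, h₁, h₂] <;> abel
  | smul c x₁ h₁ =>
    simp only [map_smul, h₁, smul_add, smul_neg]
  | single l =>
    cases l with
    | nil => simp
    | cons b l =>
      have hh : ∀ u w : Blk t n →₀ k, ∀ x : List (Blk t n) →₀ k,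
          headMul k u (headMul k w x) = headMul k (tayMul k u w) x := by
        intro u w x
        induction x using finsupp_lin_induction with
        | zero => simp only [map_zero]
        | add x₁ x₂ h₁ h₂ => simp only [map_add, h₁, h₂]
        | smul c x₁ h₁ =>
          simp only [map_smul, h₁]
        | single l =>
          cases l with
          | nil => simp
          | cons c l =>
            rw [← consB_single, headMul_consB, headMul_consB, headMul_consB, tayMul_assoc]
      rw [← consB_single, headMul_consB, btD_consB, headMul_consB, btD_consB, map_sub, map_sub,
        map_neg, headMul_consB, headMul_consB, hh, tayMul_tayD, taySgn_tayMul, map_add,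
        LinearMap.add_apply]
      abel

theorem btD_btD (x : List (Blk t n) →₀ k) : btD k (btD k x) = 0 := by
  induction x using finsupp_lin_induction with
  | zero => simp only [map_zero]
  | add x₁ x₂ h₁ h₂ => simp only [map_add, h₁, h₂] <;> abel
  | smul c x₁ h₁ =>
    simp only [map_smul, h₁, smul_zero]
  | single l =>
    induction l with
    | nil => simp
    | cons a l ih =>
      rw [← consB_single, btD_consB, map_sub, map_sub, map_neg, btD_consB, btD_consB, btD_headMul,
        tayD_tayD, ih, taySgn_tayD]
      simp only [map_zero, map_neg, LinearMap.neg_apply, LinearMap.zero_apply]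
      abel

theorem headMulAux_cons (a b : Blk t n) (l : List (Blk t n)) :
    headMulAux k a (b :: l) = if Disjoint a.2 b.2 then
      sg k a.2 b.2 • Finsupp.single ((a.1 + b.1, a.2 ∪ b.2) :: l) 1 else 0 := by
  change consB k (blkMul k a b) _ = _
  unfold blkMul
  split_ifs
  · rw [map_smul, LinearMap.smul_apply, consB_single]
  · simp

theorem btAux_cons (a : Blk t n) (l : List (Blk t n)) :
    btAux k (a :: l) =
      -(∑ s ∈ a.2, eps k a.2 s • Finsupp.single ((a.1, a.2.erase s) :: l) 1) -
      ((-1 : k) ^ a.2.card • (btAux k l).mapDomain (List.cons a) +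
        (-1 : k) ^ a.2.card • headMulAux k a l) := by
  rw [btAux, smul_add]
  congr 1
  · congr 1
    simp only [blkD, map_sum, LinearMap.sum_apply, map_smul, LinearMap.smul_apply, consB_single]
  · congr 1
    · simp [consB]
    · simp [headMul]

/-- `BStep l d`: the list `d` can occur in the bar differential of `l`. -/
inductive BStep : List (Blk t n) → List (Blk t n) → Prop
  | del (a : Blk t n) (s : Fin n) (l : List (Blk t n)) (h : s ∈ a.2) :
      BStep (a :: l) ((a.1, a.2.erase s) :: l)
  | mul (a b : Blk t n) (l : List (Blk t n)) (h : Disjoint a.2 b.2) :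
      BStep (a :: b :: l) ((a.1 + b.1, a.2 ∪ b.2) :: l)
  | cons (a : Blk t n) (l l' : List (Blk t n)) (h : BStep l l') : BStep (a :: l) (a :: l')

theorem mapDomain_cons_ne_zero {a : Blk t n} {x : List (Blk t n) →₀ k} {d : List (Blk t n)}
    (h : x.mapDomain (List.cons a) d ≠ 0) : ∃ l, d = a :: l ∧ x l ≠ 0 := by
  by_cases hd : d ∈ Set.range (List.cons a)
  · obtain ⟨l, rfl⟩ := hd
    exact ⟨l, rfl, by rwa [Finsupp.mapDomain_apply (List.cons_injective)] at h⟩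
  · exact absurd (Finsupp.mapDomain_of_notMem_range _ _ hd) h

theorem headMulAux_ne_zero {a : Blk t n} {l d : List (Blk t n)} (h : headMulAux k a l d ≠ 0) :
    ∃ b x, l = b :: x ∧ Disjoint a.2 b.2 ∧ d = (a.1 + b.1, a.2 ∪ b.2) :: x := by
  cases l with
  | nil => exact absurd rfl h
  | cons b x =>
    rw [headMulAux_cons] at h
    split_ifs at h with hd
    · refine ⟨b, x, rfl, hd, ?_⟩
      rw [Finsupp.smul_apply, Finsupp.single_apply] at h
      split_ifs at h with hx
      · exact hx.symm
      · simp at h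
    · exact absurd rfl h

theorem bstep_of_ne_zero {l d : List (Blk t n)} (h : btAux k l d ≠ 0) : BStep l d := by
  induction l generalizing d with
  | nil => exact absurd rfl h
  | cons a l ih =>
    by_contra hc
    apply h
    rw [btAux_cons]
    have h1 : (∑ s ∈ a.2, eps k a.2 s •
        (Finsupp.single ((a.1, a.2.erase s) :: l) 1 : List (Blk t n) →₀ k)) d = 0 := by
      rw [Finsupp.finsetSum_apply]
      refine Finset.sum_eq_zero fun s hs => ?_
      rw [Finsupp.smul_apply, Finsupp.single_apply, if_neg, smul_zero]
      rintro rfl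
      exact hc (BStep.del a s l hs)
    have h2 : (btAux k l).mapDomain (List.cons a) d = 0 := by
      by_contra h2
      obtain ⟨x, rfl, hx⟩ := mapDomain_cons_ne_zero h2
      exact hc (BStep.cons a l x (ih hx))
    have h3 : headMulAux k a l d = 0 := by
      by_contra h3
      obtain ⟨b, x, rfl, hd, rfl⟩ := headMulAux_ne_zero h3
      exact hc (BStep.mul a b x hd)
    rw [Finsupp.sub_apply, Finsupp.neg_apply, h1, Finsupp.add_apply, Finsupp.smul_apply,
      Finsupp.smul_apply, h2, h3]
    simp

theorem btAux_del (a : Blk t n) {s : Fin n} (hs : s ∈ a.2) (l : List (Blk t n)) :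
    btAux k (a :: l) ((a.1, a.2.erase s) :: l) ≠ 0 := by
  rw [btAux_cons]
  have h1 : (∑ x ∈ a.2, eps k a.2 x •
      (Finsupp.single ((a.1, a.2.erase x) :: l) 1 : List (Blk t n) →₀ k))
        ((a.1, a.2.erase s) :: l) = eps k a.2 s := by
    rw [Finsupp.finsetSum_apply, Finset.sum_eq_single s]
    · simp
    · intro x hx hxs
      rw [Finsupp.smul_apply, Finsupp.single_apply, if_neg, smul_zero]
      intro h
      have h' : a.2.erase x = a.2.erase s := congrArg Prod.snd (List.cons.inj h).1
      exact Finset.notMem_erase x a.2 (h' ▸ Finset.mem_erase.2 ⟨hxs, hx⟩)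
    · exact fun h => absurd hs h
  have h2 : (btAux k l).mapDomain (List.cons a) ((a.1, a.2.erase s) :: l) = 0 := by
    by_contra h2
    obtain ⟨x, hx, -⟩ := mapDomain_cons_ne_zero h2
    have h' : a.2.erase s = a.2 := congrArg Prod.snd (List.cons.inj hx).1
    exact Finset.notMem_erase s a.2 (h'.symm ▸ hs)
  have h3 : headMulAux k a l ((a.1, a.2.erase s) :: l) = 0 := by
    by_contra h3
    obtain ⟨b, x, rfl, hd, hx⟩ := headMulAux_ne_zero h3
    have := congrArg List.length hx
    simp at this
  rw [Finsupp.sub_apply, Finsupp.neg_apply, h1, Finsupp.add_apply, Finsupp.smul_apply,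
    Finsupp.smul_apply, h2, h3]
  simp [eps_ne_zero]

theorem btAux_mul (a b : Blk t n) (hd : Disjoint a.2 b.2) (hb : b.1 ≠ 0) (l : List (Blk t n)) :
    btAux k (a :: b :: l) ((a.1 + b.1, a.2 ∪ b.2) :: l) ≠ 0 := by
  rw [btAux_cons]
  have h1 : (∑ x ∈ a.2, eps k a.2 x •
      (Finsupp.single ((a.1, a.2.erase x) :: b :: l) 1 : List (Blk t n) →₀ k))
        ((a.1 + b.1, a.2 ∪ b.2) :: l) = 0 := by
    rw [Finsupp.finsetSum_apply]
    refine Finset.sum_eq_zero fun x hx => ?_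
    rw [Finsupp.smul_apply, Finsupp.single_apply, if_neg, smul_zero]
    intro h
    have := congrArg List.length h
    simp at this
  have h2 : (btAux k (b :: l)).mapDomain (List.cons a) ((a.1 + b.1, a.2 ∪ b.2) :: l) = 0 := by
    by_contra h2
    obtain ⟨x, hx, -⟩ := mapDomain_cons_ne_zero h2
    have h' : a.1 + b.1 = a.1 := congrArg Prod.fst (List.cons.inj hx).1
    exact hb (add_eq_left.1 h')
  rw [Finsupp.sub_apply, Finsupp.neg_apply, h1, Finsupp.add_apply, Finsupp.smul_apply, h2,
    headMulAux_cons, if_pos hd]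
  simp [sg_ne_zero]

theorem btAux_tail (a : Blk t n) (l d : List (Blk t n)) (hl : ∀ b ∈ l, b.1 ≠ 0)
    (h : btAux k l d ≠ 0) : btAux k (a :: l) (a :: d) ≠ 0 := by
  rw [btAux_cons]
  have h1 : (∑ x ∈ a.2, eps k a.2 x •
      (Finsupp.single ((a.1, a.2.erase x) :: l) 1 : List (Blk t n) →₀ k)) (a :: d) = 0 := by
    rw [Finsupp.finsetSum_apply]
    refine Finset.sum_eq_zero fun x hx => ?_
    rw [Finsupp.smul_apply, Finsupp.single_apply, if_neg, smul_zero]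
    intro h
    have h' : a.2.erase x = a.2 := congrArg Prod.snd (List.cons.inj h).1
    exact Finset.notMem_erase x a.2 (h'.symm ▸ hx)
  have h3 : headMulAux k a l (a :: d) = 0 := by
    by_contra h3
    obtain ⟨b, x, rfl, hd, hx⟩ := headMulAux_ne_zero h3
    have h' : a.1 = a.1 + b.1 := congrArg Prod.fst (List.cons.inj hx).1
    exact hl b (by simp) (left_eq_add.1 h')
  rw [Finsupp.sub_apply, Finsupp.neg_apply, h1, Finsupp.add_apply, Finsupp.smul_apply,
    Finsupp.smul_apply, h3, Finsupp.mapDomain_apply List.cons_injective]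
  simpa using h

/-- Valid blocks: the exponent is nonzero and divisible by all the chosen generators. -/
def BlkV (m : Fin n → Mon (Fin t)) (a : Blk t n) : Prop := a.1 ≠ 0 ∧ ∀ s ∈ a.2, m s ≤ a.1

/-- The basis of the part of multidegree `α` and (shifted) homological degree `j`. -/
def btPiece (m : Fin n → Mon (Fin t)) (α : Mon (Fin t)) (j : ℕ) : Set (List (Blk t n)) :=
  {l | (∀ a ∈ l, BlkV m a) ∧ (l.map Prod.fst).sum = α ∧
    (l.map fun a => a.2.card + 1).sum + 1 = j}

theorem finite_lists {α : Type*} {s : Set α} (hs : s.Finite) (N : ℕ) :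
    {l : List α | (∀ a ∈ l, a ∈ s) ∧ l.length ≤ N}.Finite := by
  have : Finite s := hs
  refine ((List.finite_length_le s N).image (List.map Subtype.val)).subset ?_
  rintro l ⟨h1, h2⟩
  lift l to List s using h1
  exact ⟨l, by simpa using h2, rfl⟩

theorem le_sum_of_mem {M : Type*} [AddCommMonoid M] [PartialOrder M] [CanonicallyOrderedAdd M]
    {l : List M} {a : M} (h : a ∈ l) : a ≤ l.sum := by
  induction l with
  | nil => simp at h
  | cons b l ih =>
    rw [List.sum_cons]
    rcases List.mem_cons.1 h with rfl | h
    · exact le_self_add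
    · exact (ih h).trans le_add_self

theorem btPiece_finite (m : Fin n → Mon (Fin t)) (α : Mon (Fin t)) (j : ℕ) :
    (btPiece m α j).Finite := by
  refine (finite_lists (s := {a : Blk t n | a.1 ≤ α}) ?_ j).subset ?_
  · refine ((Set.finite_Iic α).prod (Set.finite_univ (α := Finset (Fin n)))).subset ?_
    intro a ha
    exact ⟨ha, trivial⟩
  · rintro l ⟨h1, h2, h3⟩
    refine ⟨fun a ha => ?_, ?_⟩
    · change a.1 ≤ α
      rw [← h2]
      exact le_sum_of_mem (List.mem_map_of_mem ha)
    · have : l.length ≤ (l.map fun a => a.2.card + 1).sum := by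
        simp
      omega

theorem BStep.valid {m : Fin n → Mon (Fin t)} {l d : List (Blk t n)} (h : BStep l d)
    (hl : ∀ a ∈ l, BlkV m a) : ∀ a ∈ d, BlkV m a := by
  induction h with
  | del a s l hs =>
    simp only [List.forall_mem_cons] at hl ⊢
    exact ⟨⟨hl.1.1, fun x hx => hl.1.2 x (Finset.mem_of_mem_erase hx)⟩, hl.2⟩
  | mul a b l hd =>
    simp only [List.forall_mem_cons] at hl ⊢
    refine ⟨⟨fun h => hl.1.1 ?_, fun x hx => ?_⟩, hl.2.2⟩
    · exact (add_eq_zero.1 h).1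
    · rcases Finset.mem_union.1 hx with hx | hx
      · exact (hl.1.2 x hx).trans le_self_add
      · exact (hl.2.1.2 x hx).trans le_add_self
  | cons a l l' _ ih =>
    simp only [List.forall_mem_cons] at hl ⊢
    exact ⟨hl.1, ih hl.2⟩

theorem BStep.sum_eq {l d : List (Blk t n)} (h : BStep l d) :
    (d.map Prod.fst).sum = (l.map Prod.fst).sum := by
  induction h with
  | del a s l hs => simp
  | mul a b l hd => simp [add_assoc]
  | cons a l l' _ ih => simp [ih]

theorem BStep.deg_eq {l d : List (Blk t n)} (h : BStep l d) :
    (d.map fun a => a.2.card + 1).sum + 1 = (l.map fun a => a.2.card + 1).sum := by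
  induction h with
  | del a s l hs =>
    have := Finset.card_erase_add_one hs
    simp only [List.map_cons, List.sum_cons]
    omega
  | mul a b l hd =>
    simp only [List.map_cons, List.sum_cons, Finset.card_union_of_disjoint hd]
    omega
  | cons a l l' _ ih =>
    simp only [List.map_cons, List.sum_cons]
    omega

theorem btD_mem_piece (m : Fin n → Mon (Fin t)) (α : Mon (Fin t)) (j : ℕ) (l : List (Blk t n))
    (hl : l ∈ btPiece m α (j + 1)) :
    btD k (Finsupp.single l 1) ∈ Finsupp.supported k k (btPiece m α j) := by
  intro d hd
  have h : BStep l d := bstep_of_ne_zero (k := k) (by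
    rw [← btD_single]; exact Finsupp.mem_support_iff.1 hd)
  refine ⟨h.valid hl.1, h.sum_eq.trans hl.2.1, ?_⟩
  have := hl.2.2
  rw [h.deg_eq]
  omega

end BarTaylor

section BarToTaylor

variable {k : Type*} [Field k] {t n : ℕ}

/-- The embedding of words in monomials into words in blocks. -/
def monBlk (l : List (Mon (Fin t))) : List (Blk t n) := l.map fun β => (β, ∅)

theorem monBlk_injective : Function.Injective (monBlk : List (Mon (Fin t)) → List (Blk t n)) :=
  List.map_injective_iff.2 fun _ _ h => (Prod.mk.inj h).1

/-- Exponents divisible by one of the monomials `m s`. -/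
def idealExp (m : Fin n → Mon (Fin t)) : Set (Mon (Fin t)) := {β | ∃ s, m s ≤ β}

/-- Words of nonzero monomials outside the ideal. -/
def redWords (m : Fin n → Mon (Fin t)) : Set (List (Mon (Fin t))) :=
  {l | ∀ β ∈ l, β ≠ 0 ∧ β ∉ idealExp m}

/-- The matching which toggles the least generator dividing the first reducible block. -/
inductive RedPair (m : Fin n → Mon (Fin t)) : List (Blk t n) → List (Blk t n) → Prop
  | here (β : Mon (Fin t)) (S : Finset (Fin n)) (s : Fin n) (l : List (Blk t n)) (h : m s ≤ β)
      (hmin : ∀ x < s, ¬ m x ≤ β) (hs : s ∈ S) : RedPair m ((β, S) :: l) ((β, S.erase s) :: l)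
  | there (a : Blk t n) (l d : List (Blk t n)) (ha : a.1 ∉ idealExp m) (h : RedPair m l d) :
      RedPair m (a :: l) (a :: d)

variable {m : Fin n → Mon (Fin t)}

theorem least_eq {m : Fin n → Mon (Fin t)} {β : Mon (Fin t)} {s s' : Fin n} (h : m s ≤ β)
    (hmin : ∀ x < s, ¬ m x ≤ β) (h' : m s' ≤ β) (hmin' : ∀ x < s', ¬ m x ≤ β) : s = s' := by
  rcases lt_trichotomy s s' with hlt | heq | hlt
  · exact absurd h (hmin' _ hlt)
  · exact heq
  · exact absurd h' (hmin _ hlt)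

theorem RedPair.not_down {x d u : List (Blk t n)} (h : RedPair m x d) : ¬ RedPair m u x := by
  induction h generalizing u with
  | here β S s l h hmin hs =>
    intro h2
    cases h2 with
    | here _ S' s' _ h' hmin' hs' =>
      rw [least_eq h hmin h' hmin'] at hs
      exact Finset.notMem_erase _ _ hs
    | there _ _ _ ha _ => exact ha ⟨s, h⟩
  | there a l d ha _ ih =>
    intro h2
    cases h2 with
    | here β S s _ h' => exact ha ⟨s, h'⟩
    | there _ l' _ _ h' => exact ih h'

theorem RedPair.inj {u u' d : List (Blk t n)} (h : RedPair m u d) (h' : RedPair m u' d) :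
    u = u' := by
  induction h generalizing u' with
  | here β S s l h hmin hs =>
    generalize hd : ((β, S.erase s) :: l : List (Blk t n)) = d at h'
    cases h' with
    | here β' S' s' l' h2 hmin' hs' =>
      obtain ⟨h3, rfl⟩ := List.cons.inj hd
      obtain ⟨rfl, h4⟩ := Prod.mk.inj h3
      obtain rfl := least_eq h hmin h2 hmin'
      rw [← Finset.insert_erase hs, h4, Finset.insert_erase hs']
    | there a l' d' ha _ =>
      obtain ⟨rfl, -⟩ := List.cons.inj hd
      exact absurd ⟨s, h⟩ ha
  | there a l d ha _ ih =>
    cases h' with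
    | here β S s _ h' => exact absurd ⟨s, h'⟩ ha
    | there _ l' _ _ h' => rw [ih h']

theorem RedPair.ne_zero {u d : List (Blk t n)} (h : RedPair m u d) (hu : ∀ a ∈ u, BlkV m a) :
    btAux k u d ≠ 0 := by
  induction h with
  | here β S s l h hmin hs => exact btAux_del (β, S) hs l
  | there a l d ha _ ih =>
    rw [List.forall_mem_cons] at hu
    exact btAux_tail a l d (fun b hb => (hu.2 b hb).1) (ih hu.2)

theorem RedPair.notMem {u d : List (Blk t n)} (h : RedPair m u d) : u ∉ monBlk '' redWords m := by
  induction h with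
  | here β S s l h hmin hs =>
    rintro ⟨y, hy, hyx⟩
    cases y with
    | nil => simp [monBlk] at hyx
    | cons b y =>
      obtain ⟨h1, -⟩ := List.cons.inj hyx
      obtain ⟨-, rfl⟩ := Prod.mk.inj h1
      simp at hs
  | there a l d ha _ ih =>
    rintro ⟨y, hy, hyx⟩
    cases y with
    | nil => simp [monBlk] at hyx
    | cons b y =>
      exact ih ⟨y, fun β hβ => hy β (List.mem_cons_of_mem _ hβ), (List.cons.inj hyx).2⟩

theorem RedPair.triangular {u d u' d' : List (Blk t n)} (h : RedPair m u d)
    (hu : ∀ a ∈ u, BlkV m a) (hb : BStep u d') (h' : RedPair m u' d') :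
    d' = d ∨ d'.length < d.length := by
  induction h generalizing u' d' with
  | here β S s l h hmin hs =>
    cases hb with
    | del _ s' _ hs' =>
      left
      generalize hd : ((β, S.erase s') :: l : List (Blk t n)) = e at h'
      refine hd.symm.trans ?_
      cases h' with
      | here β' S' s'' l' h2 hmin' hs'' =>
        obtain ⟨h3, rfl⟩ := List.cons.inj hd
        obtain ⟨rfl, h4⟩ := Prod.mk.inj h3
        obtain rfl := least_eq h hmin h2 hmin'
        have : s ∉ S.erase s' := h4 ▸ Finset.notMem_erase s S'
        have hss : s = s' := by
          by_contra hne
          exact this (Finset.mem_erase.2 ⟨hne, hs⟩)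
        rw [hss]
      | there a l' d' ha _ =>
        obtain ⟨rfl, -⟩ := List.cons.inj hd
        exact absurd ⟨s, h⟩ ha
    | mul _ b l _ => right; simp
    | cons _ _ l' _ =>
      exfalso
      cases h' with
      | here _ S' s' _ h2 hmin' hs' =>
        rw [least_eq h hmin h2 hmin'] at hs
        exact Finset.notMem_erase _ _ hs
      | there _ _ _ ha _ => exact ha ⟨s, h⟩
  | there a l d ha h ih =>
    rw [List.forall_mem_cons] at hu
    cases hb with
    | del _ s _ hs => exact absurd ⟨s, hu.1.2 s hs⟩ ha
    | mul _ b l _ =>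
      right
      have : ∀ {x y : List (Blk t n)}, RedPair m x y → x.length = y.length := by
        intro x y hxy
        induction hxy with
        | here => simp
        | there _ _ _ _ _ ih => simp [ih]
      have := this h
      simp only [List.length_cons] at this ⊢
      omega
    | cons _ _ l' hb =>
      cases h' with
      | here β S s _ h' => exact absurd ⟨s, h'⟩ ha
      | there _ u' _ _ h' =>
        rcases ih hu.2 hb h' with rfl | h3
        · left; rfl
        · right; simpa using h3

theorem exists_redPair {x : List (Blk t n)} (hx : ∀ a ∈ x, BlkV m a)
    (hn : x ∉ monBlk '' redWords m) :
    (∃ u, (∀ a ∈ u, BlkV m a) ∧ RedPair m u x) ∨ ∃ d, RedPair m x d := by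
  induction x with
  | nil => exact absurd ⟨[], by simp [redWords], rfl⟩ hn
  | cons a l ih =>
    rw [List.forall_mem_cons] at hx
    by_cases ha : a.1 ∈ idealExp m
    · obtain ⟨s, hs, hmin⟩ := Finset.exists_min_image (Finset.univ.filter fun s => m s ≤ a.1) id
        (by obtain ⟨s, hs⟩ := ha; exact ⟨s, by simpa using hs⟩)
      simp only [Finset.mem_filter, Finset.mem_univ, true_and, id] at hs hmin
      have hmin' : ∀ x < s, ¬ m x ≤ a.1 := fun x hx h => absurd (hmin x h) (not_le.2 hx)
      obtain ⟨β, S⟩ := a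
      by_cases hsS : s ∈ S
      · exact Or.inr ⟨_, RedPair.here β S s l hs hmin' hsS⟩
      · left
        refine ⟨(β, insert s S) :: l, ?_, ?_⟩
        · rw [List.forall_mem_cons]
          refine ⟨⟨hx.1.1, fun y hy => ?_⟩, hx.2⟩
          rcases Finset.mem_insert.1 hy with rfl | hy
          · exact hs
          · exact hx.1.2 y hy
        · have := RedPair.here β (insert s S) s l hs hmin' (Finset.mem_insert_self _ _)
          rwa [Finset.erase_insert hsS] at this
    · have hl : l ∉ monBlk '' redWords m := by
        rintro ⟨y, hy, rfl⟩
        refine hn ⟨a.1 :: y, ?_, ?_⟩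
        · intro β hβ
          rcases List.mem_cons.1 hβ with rfl | hβ
          · exact ⟨hx.1.1, ha⟩
          · exact hy β hβ
        · obtain ⟨β, S⟩ := a
          have : S = ∅ := Finset.eq_empty_of_forall_notMem fun s hs => ha ⟨s, hx.1.2 s hs⟩
          subst this
          rfl
      rcases ih hx.2 hl with ⟨u, hu, h⟩ | ⟨d, h⟩
      · exact Or.inl ⟨a :: u, List.forall_mem_cons.2 ⟨hx.1, hu⟩, RedPair.there a u l ha h⟩
      · exact Or.inr ⟨a :: d, RedPair.there a l d ha h⟩

theorem BStep.redWords {x : List (Blk t n)} {y : List (Mon (Fin t))} (hx : ∀ a ∈ x, BlkV m a)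
    (hy : y ∈ redWords m) (h : BStep x (monBlk y)) : x ∈ monBlk '' redWords m := by
  generalize hd : (monBlk y : List (Blk t n)) = d at h
  induction h generalizing y with
  | del a s l hs =>
    cases y with
    | nil => simp [monBlk] at hd
    | cons b y =>
      obtain ⟨h1, -⟩ := List.cons.inj hd
      obtain ⟨rfl, -⟩ := Prod.mk.inj h1
      exact absurd ⟨s, (hx a (by simp)).2 s hs⟩ (hy a.1 (by simp)).2
  | mul a b l _ =>
    cases y with
    | nil => simp [monBlk] at hd
    | cons c y =>
      obtain ⟨h1, rfl⟩ := List.cons.inj hd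
      obtain ⟨rfl, h2⟩ := Prod.mk.inj h1
      obtain ⟨h3, h4⟩ := Finset.union_eq_empty.1 h2.symm
      simp only [List.forall_mem_cons] at hx
      have hc := (hy (a.1 + b.1) (by simp)).2
      refine ⟨a.1 :: b.1 :: y, ?_, ?_⟩
      · intro β hβ
        simp only [List.mem_cons] at hβ
        rcases hβ with rfl | rfl | hβ
        · exact ⟨hx.1.1, fun ⟨s, hs⟩ => hc ⟨s, hs.trans le_self_add⟩⟩
        · exact ⟨hx.2.1.1, fun ⟨s, hs⟩ => hc ⟨s, hs.trans le_add_self⟩⟩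
        · exact hy β (by simp [hβ])
      · obtain ⟨_, _⟩ := a
        obtain ⟨_, _⟩ := b
        dsimp only at h3 h4
        subst h3 h4
        rfl
  | cons a l l' _ ih =>
    cases y with
    | nil => simp [monBlk] at hd
    | cons c y =>
      obtain ⟨rfl, h1⟩ := List.cons.inj hd
      obtain ⟨z, hz, rfl⟩ := ih (fun b hb => hx b (by simp [hb]))
        (fun β hβ => hy β (by simp [hβ])) h1
      exact ⟨c :: z, List.forall_mem_cons.2 ⟨hy c (by simp), hz⟩, rfl⟩

theorem mergeAt_zero (a b : Mon (Fin t)) (l : List (Mon (Fin t))) :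
    mergeAt (a :: b :: l) 0 = (a + b) :: l := by
  simp [mergeAt]

theorem mergeAt_succ (a : Mon (Fin t)) (l : List (Mon (Fin t))) (j : ℕ) :
    mergeAt (a :: l) (j + 1) = a :: mergeAt l j := by
  simp [mergeAt]

theorem btAux_monBlk (l : List (Mon (Fin t))) :
    btAux k (monBlk l : List (Blk t n)) = ∑ j ∈ Finset.range (l.length - 1),
      ((-1 : k) ^ (j + 1)) • Finsupp.single (monBlk (mergeAt l j)) 1 := by
  induction l with
  | nil => simp [monBlk, btAux]
  | cons a l ih =>
    change btAux k (((a, ∅) : Blk t n) :: monBlk l) = _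
    rw [btAux_cons, ih]
    cases l with
    | nil => simp [monBlk, headMulAux]
    | cons b l =>
      rw [show (monBlk (b :: l) : List (Blk t n)) = (b, ∅) :: monBlk l from rfl, headMulAux_cons]
      simp only [List.length_cons, Nat.add_sub_cancel]
      rw [Finset.sum_range_succ', mergeAt_zero]
      simp only [mergeAt_succ, ← Finsupp.mapDomain.addMonoidHom_apply, map_sum]
      simp only [Finsupp.mapDomain.addMonoidHom_apply, Finsupp.mapDomain_smul,
        Finsupp.mapDomain_single, Finset.sum_empty, Finset.card_empty, pow_zero, one_smul,
        Finset.disjoint_empty_left, if_true, Finset.empty_union, sg, Finset.prod_empty, zero_add,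
        pow_one, neg_smul, neg_zero, zero_sub, neg_add]
      rw [← Finset.sum_neg_distrib]
      congr 1
      refine Finset.sum_congr rfl fun j _ => ?_
      rw [pow_succ _ (j + 1), mul_neg, mul_one, neg_smul]
      rfl

theorem mergeAt_mem_redWords {l : List (Mon (Fin t))} (hl : l ∈ redWords m) {j : ℕ}
    (hj : j < l.length - 1) :
    mergeAt l j ∈ redWords m ↔ l.getD j 0 + l.getD (j + 1) 0 ∉ idealExp m := by
  constructor
  · intro h
    exact (h _ (by simp [mergeAt])).2
  · intro h β hβ
    simp only [mergeAt, List.mem_append, List.mem_singleton] at hβ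
    rcases hβ with (hβ | rfl) | hβ
    · exact hl β (List.mem_of_mem_take hβ)
    · refine ⟨fun h0 => ?_, h⟩
      have h1 : l.getD j 0 ∈ l := by
        rw [List.getD_eq_getElem _ _ (by omega)]
        exact List.getElem_mem _
      exact (hl _ h1).1 (add_eq_zero.1 h0).1
    · exact hl β (List.mem_of_mem_drop hβ)

theorem pullGood_btAux_monBlk {l : List (Mon (Fin t))} (hl : l ∈ redWords m) :
    pullGood monBlk monBlk_injective (redWords m) (btAux k (monBlk l : List (Blk t n))) =
      barAux k (idealExp m) l := by
  rw [btAux_monBlk, map_sum, barAux]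
  refine Finset.sum_congr rfl fun j hj => ?_
  rw [Finset.mem_range] at hj
  rw [map_smul]
  have key : pullGood monBlk monBlk_injective (redWords m)
      (Finsupp.single (monBlk (mergeAt l j) : List (Blk t n)) (1 : k)) =
      if mergeAt l j ∈ redWords m then Finsupp.single (mergeAt l j) 1 else 0 := by
    ext x
    rw [pullGood_apply, Finsupp.single_apply]
    by_cases hx : mergeAt l j = x
    · subst hx
      by_cases h : mergeAt l j ∈ redWords m <;> simp [h]
    · rw [if_neg (monBlk_injective.ne hx)]
      by_cases h : mergeAt l j ∈ redWords m <;> simp [h, hx]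
  rw [key]
  simp only [mergeAt_mem_redWords hl hj]
  split_ifs <;> simp

theorem barSub_eq (m : Fin n → Mon (Fin t)) (i : ℕ) (α : Mon (Fin t)) :
    barSub k (idealExp m) i α = Finsupp.supported k k
      {a | a ∈ redWords m ∧ (monBlk a : List (Blk t n)) ∈ btPiece m α (i + 1)} := by
  rw [Finsupp.supported_eq_span_single]
  unfold barSub
  congr 2
  ext l
  simp only [barBasis, Set.mem_ofPred_eq, btPiece, redWords, monBlk, List.map_map,
    Function.comp_def, List.map_id', List.mem_map, Finset.card_empty, zero_add, List.map_const',
    List.sum_replicate, smul_eq_mul, mul_one]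
  constructor
  · rintro ⟨rfl, rfl, h⟩
    refine ⟨h, ?_, rfl, rfl⟩
    rintro a ⟨β, hβ, rfl⟩
    exact ⟨(h β hβ).1, by simp⟩
  · rintro ⟨h, -, h2, h3⟩
    exact ⟨by omega, h2, h⟩

theorem finiteDimensional_supported {Λ : Type*} {s : Set Λ} (hs : s.Finite) :
    FiniteDimensional k (Finsupp.supported k k s) := by
  rw [Finsupp.supported_eq_span_single]
  exact FiniteDimensional.span_of_finite k (hs.image _)

theorem torDim_eq_hdim_btD (m : Fin n → Mon (Fin t)) (i : ℕ) (α : Mon (Fin t)) :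
    torDim k (idealExp m) i α = hdim (btD k) (Finsupp.supported k k (btPiece m α (i + 1)))
      (Finsupp.supported k k (btPiece m α (i + 2))) := by
  have hf : ∀ j, ∀ x ∈ btPiece m α j,
      pullGood monBlk monBlk_injective (redWords m) (btD k (Finsupp.single x 1)) =
        barD k (idealExp m)
          (pullGood monBlk monBlk_injective (redWords m) (Finsupp.single x 1)) := by
    intro j x hx
    rw [btD_single]
    by_cases hg : x ∈ monBlk '' redWords m
    · obtain ⟨y, hy, rfl⟩ := hg
      have : pullGood monBlk monBlk_injective (redWords m)
          (Finsupp.single (monBlk y : List (Blk t n)) (1 : k)) = Finsupp.single y 1 := by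
        ext z
        rw [pullGood_apply, Finsupp.single_apply, Finsupp.single_apply]
        by_cases hz : y = z
        · subst hz; simp [hy]
        · simp [hz, monBlk_injective.ne hz]
      rw [this, pullGood_btAux_monBlk hy, barD, Finsupp.linearCombination_single, one_smul]
    · have h1 : pullGood monBlk monBlk_injective (redWords m)
          (Finsupp.single x (1 : k)) = 0 := by
        ext z
        rw [pullGood_apply, Finsupp.single_apply]
        by_cases hz : z ∈ redWords m
        · rw [if_pos hz, if_neg fun h => hg ⟨z, hz, h.symm⟩]; rfl
        · rw [if_neg hz]; rfl
      rw [h1, map_zero]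
      ext z
      rw [pullGood_apply]
      split_ifs with hz
      · by_contra hc
        exact hg ((bstep_of_ne_zero hc).redWords hx.1 hz)
      · rfl
  have hmain := hdim_eq_of_matching (btD k) (barD k (idealExp m)) monBlk monBlk_injective
    (redWords m) (btPiece m α) (btPiece_finite m α)
    (fun u d => (∀ a ∈ u, BlkV m a) ∧ RedPair m u d) (fun d => d.length) btD_btD
    (fun j x hx => btD_mem_piece m α j x hx) hf
    (fun j x hx hn => by
      rcases exists_redPair hx.1 hn with ⟨u, hu, h⟩ | ⟨d, h⟩
      · refine Or.inl ⟨u, h.notMem, ⟨hu, ?_, ?_⟩, hu, h⟩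
        · rw [← hx.2.1]
          exact (bstep_of_ne_zero (h.ne_zero (k := k) hu)).sum_eq.symm
        · rw [← (bstep_of_ne_zero (h.ne_zero (k := k) hu)).deg_eq, hx.2.2]
      · exact Or.inr ⟨d, hx.1, h⟩)
    (fun x d u h h' => h.2.not_down h'.2)
    (fun u u' d h h' => h.2.inj h'.2)
    (fun u d h => by rw [btD_single]; exact h.2.ne_zero h.1)
    (fun u d u' d' h h' hne hd => by
      rw [btD_single] at hne
      exact (h.2.triangular h.1 (bstep_of_ne_zero hne) h'.2).resolve_left hd) i
  rw [hmain, ← barSub_eq, ← barSub_eq (i := i + 1)]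
  have : FiniteDimensional k (barSub k (idealExp m) i α) := by
    rw [barSub_eq]
    refine finiteDimensional_supported ?_
    exact ((btPiece_finite m α (i + 1)).preimage monBlk_injective.injOn).subset fun x hx => hx.2
  rw [hdim_eq_sub, torDim]
  rintro _ ⟨y, hy, rfl⟩
  rw [barSub_eq] at hy
  rw [barSub_eq, Submodule.mem_inf, LinearMap.mem_ker]
  rw [← map_pullGood monBlk monBlk_injective] at hy ⊢
  obtain ⟨x, hx, rfl⟩ := hy
  have hs : ∀ j, ∀ x ∈ Finsupp.supported k k (btPiece m α j),
      pullGood monBlk monBlk_injective (redWords m) (btD k x) =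
        barD k (idealExp m) (pullGood monBlk monBlk_injective (redWords m) x) := by
    intro j x hx
    rw [Finsupp.supported_eq_span_single] at hx
    induction hx using Submodule.span_induction with
    | mem x h => obtain ⟨u, hu, rfl⟩ := h; exact hf j u hu
    | zero => simp
    | add x y _ _ hx hy => simp only [map_add, hx, hy]
    | smul a x _ hx => simp only [map_smul, hx]
  have hm : btD k x ∈ Finsupp.supported k k (btPiece m α (i + 1)) := by
    rw [Finsupp.supported_eq_span_single] at hx
    induction hx using Submodule.span_induction with
    | mem x h => obtain ⟨u, hu, rfl⟩ := h; exact btD_mem_piece m α (i + 1) u hu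
    | zero => simp
    | add x y _ _ hx hy => rw [map_add]; exact Submodule.add_mem _ hx hy
    | smul a x _ hx => rw [map_smul]; exact Submodule.smul_mem _ _ hx
  rw [← hs _ x hx]
  refine ⟨⟨_, hm, rfl⟩, ?_⟩
  rw [← hs _ _ hm, btD_btD, map_zero]

end BarToTaylor

section Blocks

variable {t n : ℕ}

/-- The sets `S` and `T` of generators are coprime. -/
def Cop (m : Fin n → Mon (Fin t)) (S T : Finset (Fin n)) : Prop :=
  ∀ x ∈ S, ∀ y ∈ T, ¬ NCF (m x) (m y)

/-- The set `S` of generators is connected: it admits no coprime splitting. -/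
def Conn (m : Fin n → Mon (Fin t)) (S : Finset (Fin n)) : Prop :=
  S.Nonempty ∧ ∀ A ⊆ S, A.Nonempty → Cop m A (S \ A) → A = S

/-- Prime blocks: variables, and connected sets of generators with their least common multiple. -/
def PrimeB (m : Fin n → Mon (Fin t)) (a : Blk t n) : Prop :=
  (∃ i, a = (Pi.single i 1, ∅)) ∨ (Conn m a.2 ∧ a.1 = a.2.sup m)

/-- The prime block `p` is a factor of the block `a`. -/
def Fac (m : Fin n → Mon (Fin t)) (a p : Blk t n) : Prop :=
  PrimeB m p ∧ p.2 ⊆ a.2 ∧ Cop m p.2 (a.2 \ p.2) ∧ p.1 + (a.2 \ p.2).sup m ≤ a.1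

variable {m : Fin n → Mon (Fin t)}

theorem ncf_comm {a b : Mon (Fin t)} : NCF a b ↔ NCF b a := by
  simp only [NCF, and_comm]

theorem ncf_mono {a b a' b' : Mon (Fin t)} (ha : a ≤ a') (hb : b ≤ b') (h : NCF a b) :
    NCF a' b' := by
  obtain ⟨i, h1, h2⟩ := h
  have h3 : a i ≤ a' i := ha i
  have h4 : b i ≤ b' i := hb i
  exact ⟨i, by omega, by omega⟩

theorem Cop.symm {S T : Finset (Fin n)} (h : Cop m S T) : Cop m T S :=
  fun x hx y hy hn => h y hy x hx (ncf_comm.1 hn)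

theorem Cop.mono {S T S' T' : Finset (Fin n)} (h : Cop m S T) (hS : S' ⊆ S) (hT : T' ⊆ T) :
    Cop m S' T' := fun x hx y hy => h x (hS hx) y (hT hy)

theorem Cop.union_right {S T U : Finset (Fin n)} (h : Cop m S T) (h' : Cop m S U) :
    Cop m S (T ∪ U) := fun x hx y hy =>
  (Finset.mem_union.1 hy).elim (h x hx y) (h' x hx y)

theorem sup_apply_ne_zero {S : Finset (Fin n)} {i : Fin t} (h : S.sup m i ≠ 0) :
    ∃ s ∈ S, m s i ≠ 0 := by
  by_contra! hc
  apply h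
  rw [Finset.sup_apply]
  exact (Finset.sup_eq_bot_iff (α := ℕ) _ _).2 hc

theorem Cop.not_ncf {S T : Finset (Fin n)} (h : Cop m S T) : ¬ NCF (S.sup m) (T.sup m) := by
  rintro ⟨i, h1, h2⟩
  obtain ⟨s, hs, h1⟩ := sup_apply_ne_zero h1
  obtain ⟨s', hs', h2⟩ := sup_apply_ne_zero h2
  exact h s hs s' hs' ⟨i, h1, h2⟩

theorem cop_of_not_ncf {S T : Finset (Fin n)} (h : ¬ NCF (S.sup m) (T.sup m)) : Cop m S T :=
  fun _ hx _ hy hn => h (ncf_mono (Finset.le_sup hx) (Finset.le_sup hy) hn)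

theorem sup_union_apply (S T : Finset (Fin n)) (i : Fin t) :
    (S ∪ T).sup m i = max (S.sup m i) (T.sup m i) := by
  rw [Finset.sup_union]; rfl

theorem sup_union_le (S T : Finset (Fin n)) : (S ∪ T).sup m ≤ S.sup m + T.sup m := fun i => by
  rw [sup_union_apply]
  exact max_le (Nat.le_add_right _ _) (Nat.le_add_left _ _)

theorem Cop.sup_union {S T : Finset (Fin n)} (h : Cop m S T) :
    (S ∪ T).sup m = S.sup m + T.sup m := by
  ext i
  rw [sup_union_apply, Pi.add_apply]
  have : S.sup m i = 0 ∨ T.sup m i = 0 := by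
    by_contra! hc
    exact h.not_ncf ⟨i, hc.1, hc.2⟩
  omega

theorem cop_of_sup_union {S T : Finset (Fin n)} (h : (S ∪ T).sup m = S.sup m + T.sup m) :
    Cop m S T := by
  refine cop_of_not_ncf ?_
  rintro ⟨i, h1, h2⟩
  have := congrFun h i
  rw [sup_union_apply, Pi.add_apply] at this
  omega

theorem exists_ne_zero {a : Mon (Fin t)} (h : a ≠ 0) : ∃ i, a i ≠ 0 := Function.ne_iff.1 h

theorem mdeg_mono {a b : Mon (Fin t)} (h : a ≤ b) : mdeg a ≤ mdeg b :=
  Finset.sum_le_sum fun i _ => h i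

theorem mdeg_add (a b : Mon (Fin t)) : mdeg (a + b) = mdeg a + mdeg b :=
  Finset.sum_add_distrib

theorem mdeg_single (i : Fin t) : mdeg (Pi.single i 1 : Mon (Fin t)) = 1 := by
  simp [mdeg]

theorem single_one_ne_zero (i : Fin t) : (Pi.single i 1 : Mon (Fin t)) ≠ 0 := by
  simp

variable (hm : ∀ s, 2 ≤ mdeg (m s))
include hm

theorem gen_ne_zero (s : Fin n) : m s ≠ 0 := fun h => by
  have := hm s; rw [h] at this; simp [mdeg] at this

theorem Cop.disjoint {S T : Finset (Fin n)} (h : Cop m S T) : Disjoint S T := by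
  rw [Finset.disjoint_left]
  intro s hs ht
  obtain ⟨i, hi⟩ := exists_ne_zero (gen_ne_zero hm s)
  exact h s hs s ht ⟨i, hi, hi⟩

theorem two_le_mdeg_sup {S : Finset (Fin n)} (h : S.Nonempty) : 2 ≤ mdeg (S.sup m) := by
  obtain ⟨s, hs⟩ := h
  exact (hm s).trans (mdeg_mono (Finset.le_sup hs))

theorem PrimeB.blkV {a : Blk t n} (h : PrimeB m a) : BlkV m a := by
  rcases h with ⟨i, rfl⟩ | ⟨h1, h2⟩
  · exact ⟨single_one_ne_zero i, by simp⟩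
  · refine ⟨fun h => ?_, fun s hs => h2 ▸ Finset.le_sup hs⟩
    have := two_le_mdeg_sup hm h1.1
    rw [← h2, h] at this
    simp [mdeg] at this

omit hm in
theorem BlkV.sup_le {a : Blk t n} (h : BlkV m a) : a.2.sup m ≤ a.1 := Finset.sup_le h.2

omit hm in
/-- A connected set inside a union of coprime sets lies in one of them. -/
theorem Conn.subset_or {C S T : Finset (Fin n)} (hC : Conn m C) (h : Cop m S T)
    (hs : C ⊆ S ∪ T) : C ⊆ S ∨ C ⊆ T := by
  by_cases he : (C ∩ S).Nonempty
  · left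
    have := hC.2 (C ∩ S) Finset.inter_subset_left he (h.mono Finset.inter_subset_right ?_)
    · rw [← this]; exact Finset.inter_subset_right
    · intro x hx
      simp only [Finset.mem_sdiff, Finset.mem_inter] at hx
      have := Finset.mem_union.1 (hs hx.1)
      tauto
  · right
    intro x hx
    refine (Finset.mem_union.1 (hs hx)).resolve_left fun h => he ⟨x, ?_⟩
    exact Finset.mem_inter.2 ⟨hx, h⟩

omit hm in
theorem Conn.eq_of_cop {C D : Finset (Fin n)} (hD : Conn m D) (hC : C ⊆ D) (hne : C.Nonempty)
    (h : Cop m C (D \ C)) : C = D := hD.2 C hC hne h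

omit hm in
theorem exists_component {S : Finset (Fin n)} {y : Fin n} (hy : y ∈ S) :
    ∃ C ⊆ S, y ∈ C ∧ Conn m C ∧ Cop m C (S \ C) := by
  obtain ⟨C, hC, hmin⟩ := Finset.exists_min_image
    (S.powerset.filter fun C => y ∈ C ∧ Cop m C (S \ C)) Finset.card
    ⟨S, by simp [hy, Cop]; tauto⟩
  simp only [Finset.mem_filter, Finset.mem_powerset] at hC hmin
  refine ⟨C, hC.1, hC.2.1, ⟨⟨y, hC.2.1⟩, fun A hA hne hcop => ?_⟩, hC.2.2⟩
  by_contra hAC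
  by_cases hyA : y ∈ A
  · have h1 := hmin A ⟨hA.trans hC.1, hyA, ?_⟩
    · exact absurd (Finset.card_lt_card (hA.ssubset_of_ne hAC)) (by omega)
    · refine (hcop.union_right (hC.2.2.mono hA le_rfl)).mono le_rfl fun x hx => ?_
      simp only [Finset.mem_union, Finset.mem_sdiff] at hx ⊢
      tauto
  · have h1 := hmin (C \ A) ⟨Finset.sdiff_subset.trans hC.1, Finset.mem_sdiff.2 ⟨hC.2.1, hyA⟩, ?_⟩
    · obtain ⟨z, hz⟩ := hne
      have : C \ A ⊂ C := Finset.sdiff_ssubset hA ⟨z, hz⟩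
      exact absurd (Finset.card_lt_card this) (by omega)
    · refine (hcop.symm.union_right (hC.2.2.mono Finset.sdiff_subset le_rfl)).mono le_rfl
        fun x hx => ?_
      simp only [Finset.mem_union, Finset.mem_sdiff] at hx ⊢
      tauto

omit hm in
theorem PrimeB.sup_le {p : Blk t n} (h : PrimeB m p) : p.2.sup m ≤ p.1 := by
  rcases h with ⟨i, rfl⟩ | ⟨-, h2⟩
  · simp
  · exact h2.ge

omit hm in
theorem fac_component {S C : Finset (Fin n)} {β : Mon (Fin t)} (hβ : S.sup m ≤ β) (hC : C ⊆ S)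
    (h1 : Conn m C) (h2 : Cop m C (S \ C)) : Fac m (β, S) (C.sup m, C) := by
  refine ⟨Or.inr ⟨h1, rfl⟩, hC, h2, ?_⟩
  change C.sup m + (S \ C).sup m ≤ β
  rw [← h2.sup_union, Finset.union_sdiff_of_subset hC]
  exact hβ

omit hm in
theorem exists_fac {a : Blk t n} (ha : BlkV m a) : ∃ p, Fac m a p := by
  obtain ⟨β, S⟩ := a
  rcases S.eq_empty_or_nonempty with rfl | ⟨y, hy⟩
  · obtain ⟨i, hi⟩ := exists_ne_zero ha.1
    refine ⟨(Pi.single i 1, ∅), Or.inl ⟨i, rfl⟩, le_rfl, by simp [Cop], fun j => ?_⟩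
    by_cases h : j = i
    · subst h
      simp at hi ⊢
      omega
    · simp [h]
  · obtain ⟨C, hC, -, h1, h2⟩ := exists_component (m := m) hy
    exact ⟨_, fac_component ha.sup_le hC h1 h2⟩

omit hm in
/-- A product of valid blocks is never prime. -/
theorem not_primeB_mul {a b : Blk t n} (ha : BlkV m a) (hb : BlkV m b) :
    ¬ PrimeB m (a.1 + b.1, a.2 ∪ b.2) := by
  rintro (⟨i, h⟩ | ⟨h1, h2⟩)
  · have h := (Prod.mk.inj h).1
    have h' := congrArg mdeg h
    rw [mdeg_add, mdeg_single] at h'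
    obtain ⟨j, hj⟩ := exists_ne_zero ha.1
    obtain ⟨l, hl⟩ := exists_ne_zero hb.1
    have hj' : a.1 j ≤ mdeg a.1 := Finset.single_le_sum (fun _ _ => Nat.zero_le _) (Finset.mem_univ j)
    have hl' : b.1 l ≤ mdeg b.1 := Finset.single_le_sum (fun _ _ => Nat.zero_le _) (Finset.mem_univ l)
    omega
  · change Conn m (a.2 ∪ b.2) at h1
    change a.1 + b.1 = (a.2 ∪ b.2).sup m at h2
    have hle := sup_union_le (m := m) a.2 b.2
    have ha' := ha.sup_le
    have hb' := hb.sup_le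
    have e1 : a.1 = a.2.sup m := by
      ext i
      have := congrFun h2 i; have := hle i; have := ha' i; have := hb' i
      simp only [Pi.add_apply] at *
      omega
    have e2 : b.1 = b.2.sup m := by
      ext i
      have := congrFun h2 i; have := hle i; have := ha' i; have := hb' i
      simp only [Pi.add_apply] at *
      omega
    have hc : Cop m a.2 b.2 := cop_of_sup_union (by rw [← h2, e1, e2])
    have hane : a.2.Nonempty := by
      rw [Finset.nonempty_iff_ne_empty]
      intro h; apply ha.1; rw [e1, h]; rfl
    have hbne : b.2.Nonempty := by
      rw [Finset.nonempty_iff_ne_empty]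
      intro h; apply hb.1; rw [e2, h]; rfl
    have e := h1.2 a.2 Finset.subset_union_left hane (hc.mono le_rfl fun x hx => by
      simp only [Finset.mem_union, Finset.mem_sdiff] at hx; tauto)
    obtain ⟨y, hy⟩ := hbne
    have hya : y ∈ a.2 := e ▸ Finset.mem_union_right _ hy
    have : m y ≠ 0 := by
      intro h0
      have hbe := h1.2 {y} (by simpa using Or.inl hya) (by simp) (by
        intro x hx z hz hn
        rw [Finset.mem_singleton.1 hx, h0] at hn
        obtain ⟨i, h, -⟩ := hn
        exact h rfl)
      apply ha.1
      rw [e1, e, ← hbe, Finset.sup_singleton, h0]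
    obtain ⟨i, hi⟩ := exists_ne_zero this
    exact hc y hya y hy ⟨i, hi, hi⟩

omit hm in
theorem PrimeB.conn_of_two_le {p : Blk t n} (h : PrimeB m p) (h2 : 2 ≤ mdeg p.1) :
    Conn m p.2 ∧ p.1 = p.2.sup m := by
  rcases h with ⟨i, rfl⟩ | h
  · rw [mdeg_single] at h2; omega
  · exact h

/-- A prime factor is determined by its label. -/
theorem Fac.eq_of_label {a p q : Blk t n} (hp : Fac m a p) (hq : Fac m a q) (h : p.1 = q.1) :
    p = q := by
  obtain ⟨p1, p2⟩ := p
  obtain ⟨q1, q2⟩ := q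
  obtain rfl : p1 = q1 := h
  congr 1
  rcases hp.1 with ⟨i, hi⟩ | ⟨hc, he⟩
  · rcases hq.1 with ⟨j, hj⟩ | ⟨hc', he'⟩
    · rw [(Prod.mk.inj hi).2, (Prod.mk.inj hj).2]
    · have := two_le_mdeg_sup hm hc'.1
      rw [← he', (Prod.mk.inj hi).1, mdeg_single] at this
      omega
  · rcases hq.1 with ⟨j, hj⟩ | ⟨hc', he'⟩
    · have := two_le_mdeg_sup hm hc.1
      rw [← he, (Prod.mk.inj hj).1, mdeg_single] at this
      omega
    · dsimp only at hc he hc' he'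
      have h1 := hc.subset_or hq.2.2.1 (by
        rw [Finset.union_sdiff_of_subset hq.2.1]; exact hp.2.1)
      rcases h1 with h1 | h1
      · exact hc'.eq_of_cop h1 hc.1 (hp.2.2.1.mono le_rfl (Finset.sdiff_subset_sdiff hq.2.1 le_rfl))
      · exfalso
        have := (hq.2.2.1.mono le_rfl h1).not_ncf
        dsimp only at this
        rw [← he, ← he'] at this
        have h2 := (hp.1.blkV hm).1
        obtain ⟨i, hi⟩ := exists_ne_zero h2
        exact this ⟨i, hi, hi⟩

omit hm in
theorem fac_mul_self {p b : Blk t n} (hp : PrimeB m p) (hb : BlkV m b) (h : Cop m p.2 b.2) :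
    Fac m (p.1 + b.1, p.2 ∪ b.2) p := by
  have hs : (p.2 ∪ b.2) \ p.2 ⊆ b.2 := fun x hx => by
    simp only [Finset.mem_union, Finset.mem_sdiff] at hx; tauto
  refine ⟨hp, Finset.subset_union_left, h.mono le_rfl hs, ?_⟩
  exact add_le_add_right ((Finset.sup_mono hs).trans hb.sup_le) _

omit hm in
theorem Fac.mul_left {p b q : Blk t n} (hp : PrimeB m p) (h : Cop m p.2 b.2) (hq : Fac m b q) :
    Fac m (p.1 + b.1, p.2 ∪ b.2) q := by
  have hs : (p.2 ∪ b.2) \ q.2 ⊆ p.2 ∪ (b.2 \ q.2) := fun x hx => by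
    simp only [Finset.mem_union, Finset.mem_sdiff] at hx ⊢; tauto
  refine ⟨hq.1, hq.2.1.trans Finset.subset_union_right,
    ((h.symm.mono hq.2.1 le_rfl).union_right hq.2.2.1).mono le_rfl hs, ?_⟩
  have h1 := (Finset.sup_mono hs).trans (sup_union_le (m := m) _ _)
  have h2 := hp.sup_le
  have h3 := hq.2.2.2
  intro i
  have := h1 i; have := h2 i; have := h3 i
  simp only [Pi.add_apply] at *
  omega

omit hm in
theorem Fac.of_mul {p b q : Blk t n} (hp : PrimeB m p) (hb : BlkV m b) (h : Cop m p.2 b.2)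
    (hq : Fac m (p.1 + b.1, p.2 ∪ b.2) q) : q = p ∨ Fac m b q := by
  obtain ⟨hq1, hq2, hq3, hq4⟩ := hq
  dsimp only at hq2 hq3 hq4
  rcases hq1 with ⟨i, rfl⟩ | ⟨hc, he⟩
  · simp only [Finset.sdiff_empty] at hq4
    rcases hp with ⟨j, rfl⟩ | ⟨hc, he⟩
    · by_cases hij : i = j
      · left; rw [hij]
      · right
        refine ⟨Or.inl ⟨i, rfl⟩, by simp, by simp [Cop], fun l => ?_⟩
        have h1 := hq4 l
        have h2 := hb.sup_le l
        simp only [Finset.empty_union, Finset.sdiff_empty, Pi.add_apply] at *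
        by_cases hl : l = j
        · subst hl
          rw [Pi.single_eq_of_ne (by tauto)]
          omega
        · rw [Pi.single_eq_of_ne hl] at h1
          omega
    · right
      refine ⟨Or.inl ⟨i, rfl⟩, by simp, by simp [Cop], fun l => ?_⟩
      have h1 := hq4 l
      rw [h.sup_union, he] at h1
      simp only [Finset.sdiff_empty, Pi.add_apply] at *
      omega
  · rcases hc.subset_or h hq2 with hs | hs
    · left
      rcases hp with ⟨j, rfl⟩ | ⟨hc', he'⟩
      · obtain ⟨x, hx⟩ := hc.1
        exact absurd (hs hx) (by simp)
      · have : q.2 = p.2 := hc'.eq_of_cop hs hc.1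
          (hq3.mono le_rfl (Finset.sdiff_subset_sdiff Finset.subset_union_left le_rfl))
        exact Prod.ext (by rw [he, he', this]) this
    · right
      have := fac_component hb.sup_le hs hc
        (hq3.mono le_rfl (Finset.sdiff_subset_sdiff Finset.subset_union_right le_rfl))
      rwa [← he] at this

omit hm in
theorem Fac.sdiff {a p : Blk t n} (h : Fac m a p) :
    a = (p.1 + (a.1 - p.1), p.2 ∪ (a.2 \ p.2)) := by
  refine Prod.ext ?_ (Finset.union_sdiff_of_subset h.2.1).symm
  exact (add_tsub_cancel_of_le (le_self_add.trans h.2.2.2)).symm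

theorem Fac.sdiff_valid {a p : Blk t n} (h : Fac m a p) (hne : a ≠ p) :
    BlkV m (a.1 - p.1, a.2 \ p.2) := by
  have h1 := h.2.2.2
  have h2 : (a.2 \ p.2).sup m ≤ a.1 - p.1 := fun i => by
    have := h1 i
    simp only [Pi.add_apply, Pi.sub_apply] at *
    omega
  refine ⟨fun h0 => hne ?_, fun s hs => (Finset.le_sup hs).trans h2⟩
  dsimp only at h0
  rw [h0] at h2
  have he : a.2 \ p.2 = ∅ := by
    rw [Finset.eq_empty_iff_forall_notMem]
    intro s hs
    exact gen_ne_zero hm s (le_antisymm ((Finset.le_sup hs).trans h2) (fun _ => Nat.zero_le _))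
  have := h.sdiff
  rw [he] at this
  rw [this, h0]
  simp

/-- Removing a generator from a valid block without leaving the prime blocks. -/
theorem PrimeB.of_erase {β : Mon (Fin t)} {S : Finset (Fin n)} {s : Fin n} (hs : s ∈ S)
    (hv : BlkV m (β, S)) (h : PrimeB m (β, S.erase s)) : PrimeB m (β, S) := by
  have hsβ : m s ≤ β := hv.2 s hs
  rcases h with ⟨i, hi⟩ | ⟨hc, he⟩
  · exfalso
    rw [(Prod.mk.inj hi).1] at hsβ
    have := mdeg_mono hsβ
    rw [mdeg_single] at this
    have := hm s
    omega
  · dsimp only at hc he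
    have key : ¬ Cop m {s} (S.erase s) := by
      intro hcop
      have h1 := hcop.not_ncf
      rw [Finset.sup_singleton, ← he] at h1
      obtain ⟨i, hi⟩ := exists_ne_zero (gen_ne_zero hm s)
      have h2 : m s i ≤ β i := hsβ i
      exact h1 ⟨i, hi, by omega⟩
    refine Or.inr ⟨⟨⟨s, hs⟩, fun A hA hne hcop => ?_⟩, ?_⟩
    · dsimp only at hA hcop ⊢
      by_cases hAe : (A.erase s).Nonempty
      · have e := hc.2 (A.erase s) (Finset.erase_subset_erase s hA) hAe
          (hcop.mono (Finset.erase_subset _ _) fun x hx => by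
            simp only [Finset.mem_sdiff, Finset.mem_erase] at hx ⊢; tauto)
        by_contra hAS
        have hsA : s ∉ A := fun h => hAS (by
          rw [← Finset.insert_erase h, e, Finset.insert_erase hs])
        rw [Finset.erase_eq_of_notMem hsA] at e
        refine key (hcop.symm.mono ?_ e.ge)
        simpa using ⟨hs, hsA⟩
      · rw [Finset.not_nonempty_iff_eq_empty, Finset.erase_eq_empty_iff] at hAe
        rcases hAe with rfl | rfl
        · simp at hne
        · exact absurd (by rwa [Finset.sdiff_singleton_eq_erase] at hcop) key
    · refine le_antisymm ?_ hv.sup_le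
      change β ≤ _
      rw [he]
      exact Finset.sup_mono (Finset.erase_subset _ _)

end Blocks

section NormalWords

variable {t n : ℕ}

/-- Two labels conflict if they have a common factor and neither is a variable. -/
def Conf (h l : Mon (Fin t)) : Prop := NCF h l ∧ 2 ≤ mdeg h ∧ 2 ≤ mdeg l

/-- Labels are ordered by degree first. -/
def lk (l : Mon (Fin t)) : ℕ ×ₗ Lex (Fin t → ℕ) := toLex (mdeg l, toLex l)

theorem lk_injective : Function.Injective (lk : Mon (Fin t) → _) := fun a b h => by
  have := congrArg (fun x => ofLex (ofLex x).2) h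
  exact this

theorem lk_lt_of_mdeg_lt {a b : Mon (Fin t)} (h : mdeg a < mdeg b) : lk a < lk b :=
  Prod.Lex.toLex_lt_toLex.2 (Or.inl h)

/-- The labels allowed after `l`, if the labels in `A` were allowed in place of `l`. -/
def nextL (A : Set (Mon (Fin t))) (l : Mon (Fin t)) : Set (Mon (Fin t)) :=
  {h | Conf h l ∨ (h ∈ A ∧ lk h < lk l)}

/-- Normal words of labels. -/
def NormalL : Set (Mon (Fin t)) → List (Mon (Fin t)) → Prop
  | _, [] => True
  | A, l :: w => l ∈ A ∧ NormalL (nextL A l) w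

/-- The matching which multiplies the least possible prime factor onto the next block. -/
inductive NPair (m : Fin n → Mon (Fin t)) : Set (Mon (Fin t)) → List (Blk t n) →
    List (Blk t n) → List (WithTop (ℕ ×ₗ Lex (Fin t → ℕ))) → Prop
  | here (A : Set (Mon (Fin t))) (p b : Blk t n) (l : List (Blk t n)) (hp : PrimeB m p)
      (hA : p.1 ∈ A) (hb : BlkV m b) (hn : ∀ q, Fac m b q → q.1 ∉ nextL A p.1) :
      NPair m A (p :: b :: l) ((p.1 + b.1, p.2 ∪ b.2) :: l) [(lk p.1 : WithTop _), ⊤]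
  | there (A : Set (Mon (Fin t))) (p : Blk t n) (u d : List (Blk t n))
      (w : List (WithTop (ℕ ×ₗ Lex (Fin t → ℕ)))) (hp : PrimeB m p)
      (hA : p.1 ∈ A) (h : NPair m (nextL A p.1) u d w) :
      NPair m A (p :: u) (p :: d) ((lk p.1 : WithTop _) :: w)

variable {m : Fin n → Mon (Fin t)}

/-- The head of `l` has a prime factor with label in `A`. -/
def HeadIn (m : Fin n → Mon (Fin t)) (A : Set (Mon (Fin t))) (l : List (Blk t n)) : Prop :=
  ∃ a l', l = a :: l' ∧ ∃ q, Fac m a q ∧ q.1 ∈ A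

theorem PrimeB.fac_self {p : Blk t n} (h : PrimeB m p) : Fac m p p :=
  ⟨h, le_rfl, by simp [Cop], by rw [Finset.sdiff_self]; exact (add_zero p.1).le⟩

theorem NPair.headIn_left {A : Set (Mon (Fin t))} {u d : List (Blk t n)} {w}
    (h : NPair m A u d w) : HeadIn m A u := by
  cases h with
  | here _ p b l hp hA => exact ⟨p, _, rfl, p, hp.fac_self, hA⟩
  | there _ p u d w hp hA => exact ⟨p, _, rfl, p, hp.fac_self, hA⟩

variable (hm : ∀ s, 2 ≤ mdeg (m s))
include hm

/-- A prime block is coprime to every valid block without conflicting prime factors. -/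
theorem cop_of_not_conf {p b : Blk t n} (hp : PrimeB m p) (hb : BlkV m b)
    (hn : ∀ q, Fac m b q → ¬ Conf q.1 p.1) : Cop m p.2 b.2 := by
  intro x hx y hy hxy
  obtain ⟨C, hC, hyC, h1, h2⟩ := exists_component (m := m) hy
  refine hn _ (fac_component hb.sup_le hC h1 h2)
    ⟨ncf_mono (Finset.le_sup hyC) ((hp.blkV hm).2 x hx) (ncf_comm.1 hxy), ?_, ?_⟩
  · exact two_le_mdeg_sup hm h1.1
  · exact (hm x).trans (mdeg_mono ((hp.blkV hm).2 x hx))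

theorem cop_of_not_next {A : Set (Mon (Fin t))} {p b : Blk t n} (hp : PrimeB m p) (hb : BlkV m b)
    (hn : ∀ q, Fac m b q → q.1 ∉ nextL A p.1) : Cop m p.2 b.2 :=
  cop_of_not_conf hm hp hb fun q hq hc => hn q hq (Or.inl hc)

theorem NPair.headIn_right {A : Set (Mon (Fin t))} {u d : List (Blk t n)} {w}
    (h : NPair m A u d w) : HeadIn m A d := by
  cases h with
  | here _ p b l hp hA hb hn =>
    exact ⟨_, _, rfl, p, fac_mul_self hp hb (cop_of_not_next hm hp hb hn), hA⟩
  | there _ p u d w hp hA => exact ⟨p, _, rfl, p, hp.fac_self, hA⟩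

theorem NPair.not_down {A : Set (Mon (Fin t))} {x d u : List (Blk t n)} {w w'}
    (h : NPair m A x d w) (h' : NPair m A u x w') : False := by
  induction h generalizing u w' with
  | here A p b l hp hA hb hn =>
    generalize hx : p :: b :: l = x at h'
    cases h' with
    | here _ p' b' l' hp' hA' hb' hn' =>
      obtain ⟨rfl, -⟩ := List.cons.inj hx
      exact not_primeB_mul (hp'.blkV hm) hb' hp
    | there _ p' v' e' y' hp' hA' h' =>
      obtain ⟨rfl, rfl⟩ := List.cons.inj hx
      obtain ⟨a, l', h1, q, hq, hqA⟩ := h'.headIn_right hm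
      obtain ⟨rfl, rfl⟩ := List.cons.inj h1
      exact hn q hq hqA
  | there A p v e y hp hA h ih =>
    generalize hx : p :: v = x at h'
    cases h' with
    | here _ p' b' l' hp' hA' hb' hn' =>
      obtain ⟨rfl, -⟩ := List.cons.inj hx
      exact not_primeB_mul (hp'.blkV hm) hb' hp
    | there _ p' v' e' y' hp' hA' h' =>
      obtain ⟨rfl, rfl⟩ := List.cons.inj hx
      exact ih h'

/-- The label of the factor split off by the matching is least possible. -/
theorem label_le_of_fac_mul {A : Set (Mon (Fin t))} {p b q : Blk t n} (hp : PrimeB m p)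
    (hb : BlkV m b) (hn : ∀ q, Fac m b q → q.1 ∉ nextL A p.1)
    (hq : Fac m (p.1 + b.1, p.2 ∪ b.2) q) (hqA : q.1 ∈ A) : lk p.1 ≤ lk q.1 := by
  rcases hq.of_mul hp hb (cop_of_not_next hm hp hb hn) with rfl | h
  · exact le_rfl
  · exact not_lt.1 fun hlt => hn q h (Or.inr ⟨hqA, hlt⟩)

theorem NPair.inj {A : Set (Mon (Fin t))} {u u' d : List (Blk t n)} {w w'}
    (h : NPair m A u d w) (h' : NPair m A u' d w') : u = u' ∧ w = w' := by
  induction h generalizing u' w' with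
  | here A p b l hp hA hb hn =>
    generalize hx : ((p.1 + b.1, p.2 ∪ b.2) :: l : List (Blk t n)) = x at h'
    cases h' with
    | here _ p' b' l' hp' hA' hb' hn' =>
      obtain ⟨hx2, rfl⟩ := List.cons.inj hx
      have hc := cop_of_not_next hm hp hb hn
      have hc' := cop_of_not_next hm hp' hb' hn'
      have f1 := fac_mul_self hp hb hc
      have f2 := fac_mul_self hp' hb' hc'
      have e : p = p' := by
        rw [← hx2] at f2
        refine f1.eq_of_label hm f2 (lk_injective (le_antisymm ?_ ?_))
        · exact label_le_of_fac_mul hm hp hb hn f2 hA'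
        · rw [hx2] at f1
          exact label_le_of_fac_mul hm hp' hb' hn' f1 hA
      subst e
      obtain ⟨h1, h2⟩ := Prod.mk.inj hx2
      have e2 : b = b' := by
        refine Prod.ext (add_left_cancel h1) ?_
        have d1 := hc.disjoint hm
        have d2 := hc'.disjoint hm
        rw [← Finset.union_sdiff_cancel_left d1, h2, Finset.union_sdiff_cancel_left d2]
      rw [e2]
      exact ⟨rfl, rfl⟩
    | there _ p' u d w hp' hA' h' =>
      obtain ⟨rfl, -⟩ := List.cons.inj hx
      exact absurd hp' (not_primeB_mul (hp.blkV hm) hb)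
  | there A p u d w hp hA h ih =>
    generalize hx : p :: d = x at h'
    cases h' with
    | here _ p' b' l' hp' hA' hb' hn' =>
      obtain ⟨rfl, -⟩ := List.cons.inj hx
      exact absurd hp (not_primeB_mul (hp'.blkV hm) hb')
    | there _ p' u d w hp' hA' h' =>
      obtain ⟨rfl, rfl⟩ := List.cons.inj hx
      obtain ⟨rfl, rfl⟩ := ih h'
      exact ⟨rfl, rfl⟩

theorem NPair.ne_zero {k : Type*} [Field k] {A : Set (Mon (Fin t))} {u d : List (Blk t n)} {w}
    (h : NPair m A u d w) (hu : ∀ a ∈ u, BlkV m a) : btAux k u d ≠ 0 := by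
  induction h with
  | here A p b l hp hA hb hn =>
    exact btAux_mul p b ((cop_of_not_next hm hp hb hn).disjoint hm) hb.1 l
  | there A p u d w hp hA h ih =>
    rw [List.forall_mem_cons] at hu
    exact btAux_tail p u d (fun b hb => (hu.2 b hb).1) (ih hu.2)

omit hm in
theorem NPair.not_normal {A : Set (Mon (Fin t))} {u d : List (Blk t n)} {w}
    (h : NPair m A u d w) (hp : ∀ a ∈ u, PrimeB m a) : ¬ NormalL A (u.map Prod.fst) := by
  induction h with
  | here A p b l hp' hA hb hn =>
    rintro ⟨-, h, -⟩
    exact hn b (hp b (by simp)).fac_self h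
  | there A p u d w hp' hA h ih =>
    rintro ⟨-, h⟩
    rw [List.forall_mem_cons] at hp
    exact ih hp.2 h

theorem exists_npair {l : List (Blk t n)} (hl : ∀ a ∈ l, BlkV m a) (A : Set (Mon (Fin t)))
    (hA : l = [] ∨ HeadIn m A l) :
    ((∀ a ∈ l, PrimeB m a) ∧ NormalL A (l.map Prod.fst)) ∨
      (∃ u w, (∀ a ∈ u, BlkV m a) ∧ NPair m A u l w) ∨ ∃ d w, NPair m A l d w := by
  induction l generalizing A with
  | nil => left; simp [NormalL]
  | cons a l ih =>
    rw [List.forall_mem_cons] at hl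
    obtain ⟨a', l', he, q0, hq0, hqA0⟩ := hA.resolve_left (by simp)
    obtain ⟨rfl, rfl⟩ := List.cons.inj he
    have hfin : {q : Blk t n | Fac m a q ∧ q.1 ∈ A}.Finite := by
      refine ((Set.finite_Iic a.1).prod (Set.finite_univ (α := Finset (Fin n)))).subset ?_
      intro q hq
      exact ⟨le_self_add.trans hq.1.2.2.2, trivial⟩
    obtain ⟨p, ⟨hpa, hpA⟩, hmin⟩ := Set.exists_min_image _ (fun q => lk q.1) hfin ⟨q0, hq0, hqA0⟩
    by_cases hap : a = p
    · subst hap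
      by_cases hl' : l = [] ∨ HeadIn m (nextL A a.1) l
      · rcases ih hl.2 _ hl' with ⟨h1, h2⟩ | ⟨u, w, h1, h2⟩ | ⟨d, w, h⟩
        · left
          exact ⟨by rw [List.forall_mem_cons]; exact ⟨hpa.1, h1⟩, hpA, h2⟩
        · right; left
          exact ⟨a :: u, _, by rw [List.forall_mem_cons]; exact ⟨hl.1, h1⟩,
            NPair.there A a u l w hpa.1 hpA h2⟩
        · right; right
          exact ⟨_, _, NPair.there A a l d w hpa.1 hpA h⟩
      · push Not at hl'
        obtain ⟨b, l', rfl⟩ := List.exists_cons_of_ne_nil hl'.1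
        right; right
        refine ⟨_, _, NPair.here A a b l' hpa.1 hpA (hl.2 b (by simp)) fun q hq hqA => hl'.2 ?_⟩
        exact ⟨b, l', rfl, q, hq, hqA⟩
    · right; left
      have hv := hpa.sdiff_valid hm hap
      have hcop : Cop m p.2 (a.2 \ p.2) := hpa.2.2.1
      have hn : ∀ q, Fac m (a.1 - p.1, a.2 \ p.2) q → q.1 ∉ nextL A p.1 := by
        rintro q hq (⟨h1, h2, h3⟩ | ⟨hqA, hlt⟩)
        · have e1 := (hq.1.conn_of_two_le h2).2
          have e2 := (hpa.1.conn_of_two_le h3).2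
          rw [e1, e2] at h1
          exact (hcop.mono le_rfl hq.2.1).not_ncf (ncf_comm.1 h1)
        · have h := hq.mul_left hpa.1 hcop
          dsimp only at h
          rw [← hpa.sdiff] at h
          exact absurd (hmin q ⟨h, hqA⟩) (not_le.2 hlt)
      refine ⟨p :: (a.1 - p.1, a.2 \ p.2) :: l, [(lk p.1 : WithTop _), ⊤], ?_, ?_⟩
      · simp only [List.forall_mem_cons]
        exact ⟨hpa.1.blkV hm, hv, hl.2⟩
      · have := NPair.here A p _ l hpa.1 hpA hv hn
        dsimp only at this
        rwa [← hpa.sdiff] at this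

/-- The weight by which the bar differential is filtered. -/
def wt (m : Fin n → Mon (Fin t)) (l : List (Blk t n)) : ℕ :=
  (l.map fun a => a.2.card + mdeg (a.2.sup m)).sum

omit hm in
theorem BStep.wt_le {l d : List (Blk t n)} (h : BStep l d) : wt m d ≤ wt m l := by
  induction h with
  | del a s l hs =>
    have h1 := Finset.card_erase_add_one hs
    have h2 := mdeg_mono (Finset.sup_mono (f := m) (Finset.erase_subset s a.2))
    simp only [wt, List.map_cons, List.sum_cons]
    omega
  | mul a b l hd =>
    have h2 := mdeg_mono (sup_union_le (m := m) a.2 b.2)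
    rw [mdeg_add] at h2
    simp only [wt, List.map_cons, List.sum_cons, Finset.card_union_of_disjoint hd]
    omega
  | cons a l l' _ ih => simpa [wt] using ih

omit hm in
theorem cop_of_wt_mul {a b : Blk t n} {l : List (Blk t n)} (hd : Disjoint a.2 b.2)
    (h : wt m (((a.1 + b.1, a.2 ∪ b.2) : Blk t n) :: l) = wt m (a :: b :: l)) :
    Cop m a.2 b.2 := by
  refine cop_of_not_ncf ?_
  rintro ⟨i, h1, h2⟩
  have hlt : mdeg ((a.2 ∪ b.2).sup m) < mdeg (a.2.sup m + b.2.sup m) := by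
    refine Finset.sum_lt_sum (fun j _ => sup_union_le (m := m) a.2 b.2 j) ⟨i, Finset.mem_univ _, ?_⟩
    rw [sup_union_apply, Pi.add_apply]
    omega
  rw [mdeg_add] at hlt
  simp only [wt, List.map_cons, List.sum_cons, Finset.card_union_of_disjoint hd] at h
  omega

theorem NPair.triangular {A : Set (Mon (Fin t))} {u d u' d' : List (Blk t n)} {w w'}
    (h : NPair m A u d w) (hu : ∀ a ∈ u, BlkV m a) (hs : BStep u d') (hne : d' ≠ d)
    (hwt : wt m d' = wt m u) (h' : NPair m A u' d' w') : w' < w := by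
  induction h generalizing u' d' w' with
  | here A p b l hp hA hb hn =>
    have hcons : ∀ x, d' = p :: x → w' < [(lk p.1 : WithTop _), ⊤] := by
      rintro x rfl
      generalize hx : p :: x = y at h'
      cases h' with
      | here _ p' b' l' hp' hA' hb' hn' =>
        obtain ⟨rfl, -⟩ := List.cons.inj hx
        exact absurd hp (not_primeB_mul (hp'.blkV hm) hb')
      | there _ p' u d w hp' hA' h' =>
        obtain ⟨rfl, rfl⟩ := List.cons.inj hx
        rw [List.cons_lt_cons_iff]
        refine Or.inr ⟨rfl, ?_⟩
        cases h' with
        | here => exact List.cons_lt_cons_iff.2 (Or.inl (WithTop.coe_lt_top _))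
        | there => exact List.cons_lt_cons_iff.2 (Or.inl (WithTop.coe_lt_top _))
    cases hs with
    | del _ s _ hs =>
      exfalso
      have h1 := Finset.card_erase_add_one hs
      have h2 := mdeg_mono (Finset.sup_mono (f := m) (Finset.erase_subset s p.2))
      simp only [wt, List.map_cons, List.sum_cons] at hwt
      omega
    | mul _ _ _ _ => exact absurd rfl hne
    | cons _ _ x _ => exact hcons x rfl
  | there A p u d w hp hA h ih =>
    rw [List.forall_mem_cons] at hu
    cases hs with
    | del _ s _ hs =>
      exfalso
      have h1 := Finset.card_erase_add_one hs
      have h2 := mdeg_mono (Finset.sup_mono (f := m) (Finset.erase_subset s p.2))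
      simp only [wt, List.map_cons, List.sum_cons] at hwt
      omega
    | mul _ b l hd =>
      obtain ⟨b', l', he, q, hq, hqA⟩ := h.headIn_left
      obtain ⟨rfl, rfl⟩ := List.cons.inj he
      have hbv : BlkV m b := hu.2 b (by simp)
      have hcop := cop_of_wt_mul hd hwt
      have hqlt : q.1 ∈ A ∧ lk q.1 < lk p.1 := by
        rcases hqA with ⟨h1, h2, h3⟩ | h
        · exfalso
          rw [(hq.1.conn_of_two_le h2).2, (hp.conn_of_two_le h3).2] at h1
          exact (hcop.mono le_rfl hq.2.1).not_ncf (ncf_comm.1 h1)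
        · exact h
      have hq' := hq.mul_left hp hcop
      generalize hx : ((p.1 + b.1, p.2 ∪ b.2) :: l : List (Blk t n)) = y at h'
      cases h' with
      | here _ p' b' l' hp' hA' hb' hn' =>
        obtain ⟨hx, -⟩ := List.cons.inj hx
        rw [hx] at hq'
        have := label_le_of_fac_mul hm hp' hb' hn' hq' hqlt.1
        exact List.cons_lt_cons_iff.2 (Or.inl (WithTop.coe_lt_coe.2 (this.trans_lt hqlt.2)))
      | there _ p' u d w hp' hA' h' =>
        obtain ⟨rfl, -⟩ := List.cons.inj hx
        exact absurd hp' (not_primeB_mul (hp.blkV hm) hbv)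
    | cons _ _ x hx =>
      generalize hy : p :: x = y at h'
      cases h' with
      | here _ p' b' l' hp' hA' hb' hn' =>
        obtain ⟨rfl, -⟩ := List.cons.inj hy
        exact absurd hp (not_primeB_mul (hp'.blkV hm) hb')
      | there _ p' u' d' w' hp' hA' h' =>
        obtain ⟨rfl, rfl⟩ := List.cons.inj hy
        refine List.cons_lt_cons_iff.2 (Or.inr ⟨rfl, ih hu.2 hx (fun h => hne (by rw [h])) ?_ h'⟩)
        simpa [wt] using hwt

end NormalWords

section Words

variable {k : Type*} [Field k] {Γ : Type*} (sz : Γ → ℕ) (δ : Γ → (Γ →₀ k))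

/-- The differential of the bar-type complex of words, on basis elements. -/
def wordAux : List Γ → (List Γ →₀ k)
  | [] => 0
  | a :: l => -(δ a).mapDomain (fun c => c :: l) -
      (-1 : k) ^ sz a • (wordAux l).mapDomain (List.cons a)

/-- The differential of the complex of words. -/
def wordD : (List Γ →₀ k) →ₗ[k] (List Γ →₀ k) := Finsupp.linearCombination k (wordAux sz δ)

theorem wordD_single (l : List Γ) : wordD sz δ (Finsupp.single l 1) = wordAux sz δ l := by
  rw [wordD, Finsupp.linearCombination_single, one_smul]

theorem cons_left_injective (l : List Γ) : Function.Injective fun c : Γ => c :: l :=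
  fun _ _ h => (List.cons.inj h).1

theorem wordAux_nil_right (l : List Γ) : wordAux sz δ l [] = 0 := by
  cases l with
  | nil => rfl
  | cons a l =>
    rw [wordAux, Finsupp.sub_apply, Finsupp.neg_apply, Finsupp.smul_apply,
      Finsupp.mapDomain_of_notMem_range, Finsupp.mapDomain_of_notMem_range] <;> simp

theorem mapDomain_cons_left_apply (x : Γ →₀ k) (c : Γ) (l l' : List Γ) [Decidable (l = l')] :
    x.mapDomain (fun c => c :: l) (c :: l') = if l = l' then x c else 0 := by
  split_ifs with h
  · subst h
    exact Finsupp.mapDomain_apply (cons_left_injective l) x c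
  · refine Finsupp.mapDomain_of_notMem_range _ _ ?_
    rintro ⟨d, hd⟩
    exact h (List.cons.inj hd).2

theorem mapDomain_cons_apply (x : List Γ →₀ k) (a c : Γ) (l' : List Γ) [Decidable (a = c)] :
    x.mapDomain (List.cons a) (c :: l') = if a = c then x l' else 0 := by
  split_ifs with h
  · subst h
    exact Finsupp.mapDomain_apply List.cons_injective x l'
  · refine Finsupp.mapDomain_of_notMem_range _ _ ?_
    rintro ⟨d, hd⟩
    exact h (List.cons.inj hd).1

theorem wordAux_cons_cons (a c : Γ) (l l' : List Γ) [Decidable (l = l')] [Decidable (a = c)] :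
    wordAux sz δ (a :: l) (c :: l') =
      -(if l = l' then δ a c else 0) -
        (-1 : k) ^ sz a • (if a = c then wordAux sz δ l l' else 0) := by
  rw [wordAux, Finsupp.sub_apply, Finsupp.neg_apply, Finsupp.smul_apply,
    mapDomain_cons_left_apply, mapDomain_cons_apply]

end Words

section Primes

variable {k : Type*} [Field k] {t n : ℕ}

/-- The type of prime blocks. -/
abbrev PB (m : Fin n → Mon (Fin t)) := {p : Blk t n // PrimeB m p}

variable {m : Fin n → Mon (Fin t)}

/-- The label of a prime block. -/
def pbLab (p : PB m) : Mon (Fin t) := p.1.1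

/-- The size of a prime block. -/
def pbSz (p : PB m) : ℕ := p.1.2.card

/-- The Taylor differential restricted to prime blocks. -/
def pbδ (k : Type*) [Field k] (p : PB m) : PB m →₀ k :=
  (blkD k p.1).comapDomain Subtype.val Subtype.val_injective.injOn

/-- Words of prime blocks as words of blocks. -/
def pbWord (l : List (PB m)) : List (Blk t n) := l.map Subtype.val

theorem pbWord_injective : Function.Injective (pbWord : List (PB m) → List (Blk t n)) :=
  List.map_injective_iff.2 Subtype.val_injective

theorem blkD_ne_zero {a c : Blk t n} (h : blkD k a c ≠ 0) : ∃ s ∈ a.2, c = (a.1, a.2.erase s) := by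
  rw [blkD, Finsupp.finsetSum_apply] at h
  obtain ⟨s, hs, h⟩ := Finset.exists_ne_zero_of_sum_ne_zero h
  refine ⟨s, hs, ?_⟩
  by_contra hc
  rw [Finsupp.smul_apply, Finsupp.single_apply, if_neg (Ne.symm hc), smul_zero] at h
  exact h rfl

variable (hm : ∀ s, 2 ≤ mdeg (m s))
include hm

theorem btAux_pbWord (y z : List (PB m)) :
    btAux k (pbWord y) (pbWord z) = wordAux pbSz (pbδ k) y z := by
  induction y generalizing z with
  | nil => rfl
  | cons a l ih =>
    cases z with
    | nil =>
      rw [wordAux_nil_right]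
      by_contra h
      have := bstep_of_ne_zero h
      generalize hy : pbWord (a :: l) = y at this
      generalize hz : pbWord ([] : List (PB m)) = z at this
      cases this <;> simp [pbWord] at hz
    | cons c l' =>
      rw [wordAux_cons_cons, ← ih]
      change btAux k (a.1 :: pbWord l) (c.1 :: pbWord l') = _
      have h3 : headMulAux k a.1 (pbWord l) (c.1 :: pbWord l') = 0 := by
        by_contra h
        obtain ⟨b, x, h1, hd, hx⟩ := headMulAux_ne_zero h
        have hb : PrimeB m b := by
          have : b ∈ pbWord l := by rw [h1]; simp
          obtain ⟨b', -, rfl⟩ := List.mem_map.1 this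
          exact b'.2
        refine not_primeB_mul (a.2.blkV hm) (hb.blkV hm) ?_
        rw [← (List.cons.inj hx).1]
        exact c.2
      have h1 : (∑ s ∈ a.1.2, eps k a.1.2 s •
          (Finsupp.single ((a.1.1, a.1.2.erase s) :: pbWord l) 1 : List (Blk t n) →₀ k)) =
          (blkD k a.1).mapDomain (fun c => c :: pbWord l) := by
        rw [blkD, Finsupp.mapDomain_finsetSum]
        refine Finset.sum_congr rfl fun s _ => ?_
        rw [Finsupp.mapDomain_smul, Finsupp.mapDomain_single]
      rw [btAux_cons, h1, Finsupp.sub_apply, Finsupp.neg_apply, Finsupp.add_apply,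
        Finsupp.smul_apply, Finsupp.smul_apply, h3, smul_zero, add_zero,
        mapDomain_cons_left_apply, mapDomain_cons_apply]
      have e1 : pbWord l = pbWord l' ↔ l = l' := pbWord_injective.eq_iff
      have e2 : a.1 = c.1 ↔ a = c := Subtype.val_injective.eq_iff
      simp only [e1, e2]
      rfl

omit hm in
theorem wordAux_lab {y z : List (PB m)} (h : wordAux pbSz (pbδ k) y z ≠ 0) :
    z.map pbLab = y.map pbLab := by
  induction y generalizing z with
  | nil => exact absurd rfl h
  | cons a l ih =>
    cases z with
    | nil => exact absurd (wordAux_nil_right _ _ _) h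
    | cons c l' =>
      rw [wordAux_cons_cons] at h
      by_cases h1 : l = l' ∧ pbδ k a c ≠ 0
      · obtain ⟨rfl, h1⟩ := h1
        obtain ⟨s, -, hs⟩ := blkD_ne_zero (show blkD k a.1 c.1 ≠ 0 from h1)
        have : pbLab c = pbLab a := by unfold pbLab; rw [hs]
        simp [this]
      · have h2 : (if l = l' then pbδ k a c else 0) = 0 := by
          split_ifs with h
          · by_contra hc; exact h1 ⟨h, hc⟩
          · rfl
        rw [h2] at h
        by_cases h3 : a = c
        · subst h3
          rw [List.map_cons, List.map_cons, ih]
          intro h0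
          simp [h0] at h
        · simp [h3] at h

theorem BStep.of_pbWord {x : List (Blk t n)} {z : List (PB m)} (hx : ∀ a ∈ x, BlkV m a)
    (h : BStep x (pbWord z)) : ∃ y : List (PB m), x = pbWord y ∧ y.map pbLab = z.map pbLab := by
  generalize hz : pbWord z = d at h
  induction h generalizing z with
  | del a s l hs =>
    cases z with
    | nil => cases hz
    | cons c z =>
      obtain ⟨h1, rfl⟩ := List.cons.inj hz
      have hp := PrimeB.of_erase hm hs (hx a (by simp)) (h1 ▸ c.2)
      refine ⟨⟨a, hp⟩ :: z, rfl, ?_⟩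
      have : pbLab c = a.1 := by unfold pbLab; rw [h1]
      rw [List.map_cons, List.map_cons, this]
      rfl
  | mul a b l hd =>
    cases z with
    | nil => cases hz
    | cons c z =>
      obtain ⟨h1, -⟩ := List.cons.inj hz
      exact absurd (h1 ▸ c.2) (not_primeB_mul (hx a (by simp)) (hx b (by simp)))
  | cons a l l' h ih =>
    cases z with
    | nil => cases hz
    | cons c z =>
      obtain ⟨rfl, h1⟩ := List.cons.inj hz
      rw [List.forall_mem_cons] at hx
      obtain ⟨y, rfl, hy⟩ := ih hx.2 h1
      refine ⟨c :: y, rfl, ?_⟩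
      rw [List.map_cons, List.map_cons, hy]

omit hm in
theorem pbWord_map_fst (y : List (PB m)) : (pbWord y).map Prod.fst = y.map pbLab := by
  rw [pbWord, List.map_map]; rfl

theorem pbWord_mem_btPiece (y : List (PB m)) (α : Mon (Fin t)) (j : ℕ) :
    pbWord y ∈ btPiece m α j ↔ (y.map pbLab).sum = α ∧
      (y.map fun a => pbSz a + 1).sum + 1 = j := by
  have h1 : ((pbWord y).map fun a => a.2.card + 1) = y.map fun a => pbSz a + 1 := by
    rw [pbWord, List.map_map]; rfl
  rw [btPiece, Set.mem_ofPred_eq, pbWord_map_fst, h1, and_iff_right]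
  intro a ha
  obtain ⟨b, -, rfl⟩ := List.mem_map.1 ha
  exact b.2.blkV hm

/-- The multigraded piece of the complex of normal words over letters with labels and sizes. -/
def wordPiece {Γ : Type*} (lab : Γ → Mon (Fin t)) (sz : Γ → ℕ) (α : Mon (Fin t)) (i : ℕ) :
    Set (List Γ) :=
  {y | NormalL Set.univ (y.map lab) ∧ (y.map lab).sum = α ∧ (y.map fun a => sz a + 1).sum = i}

theorem hdim_btD_eq_hdim_wordD (i : ℕ) (α : Mon (Fin t)) :
    hdim (btD k) (Finsupp.supported k k (btPiece m α (i + 1)))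
      (Finsupp.supported k k (btPiece m α (i + 2))) =
    hdim (wordD pbSz (pbδ k)) (Finsupp.supported k k (wordPiece (pbLab (m := m)) pbSz α i))
      (Finsupp.supported k k (wordPiece (pbLab (m := m)) pbSz α (i + 1))) := by
  set Good : Set (List (PB m)) := {y | NormalL Set.univ (y.map pbLab)} with hGood
  have hgp : ∀ (x : List (Blk t n)), ((∀ a ∈ x, PrimeB m a) ∧ NormalL Set.univ (x.map Prod.fst)) ↔
      x ∈ pbWord '' Good := by
    intro x
    constructor
    · rintro ⟨h1, h2⟩
      lift x to List (PB m) using h1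
      refine ⟨x, ?_, rfl⟩
      rw [hGood, Set.mem_ofPred_eq, ← pbWord_map_fst]
      exact h2
    · rintro ⟨y, hy, rfl⟩
      refine ⟨fun a ha => ?_, by rw [pbWord_map_fst]; exact hy⟩
      obtain ⟨b, -, rfl⟩ := List.mem_map.1 ha
      exact b.2
  have hf : ∀ j, ∀ x ∈ btPiece m α j,
      pullGood pbWord pbWord_injective Good (btD k (Finsupp.single x 1)) =
        wordD pbSz (pbδ k) (pullGood pbWord pbWord_injective Good (Finsupp.single x 1)) := by
    intro j x hx
    rw [btD_single]
    by_cases hg : x ∈ pbWord '' Good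
    · obtain ⟨y, hy, rfl⟩ := hg
      have : pullGood pbWord pbWord_injective Good
          (Finsupp.single (pbWord y : List (Blk t n)) (1 : k)) = Finsupp.single y 1 := by
        ext z
        rw [pullGood_apply, Finsupp.single_apply, Finsupp.single_apply]
        by_cases hz : y = z
        · subst hz; simp [hy]
        · simp [hz, pbWord_injective.ne hz]
      rw [this, wordD_single]
      ext z
      rw [pullGood_apply, btAux_pbWord hm]
      split_ifs with hz
      · rfl
      · by_contra hc
        apply hz
        rw [hGood, Set.mem_ofPred_eq, wordAux_lab (Ne.symm hc)]
        exact hy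
    · have h1 : pullGood pbWord pbWord_injective Good (Finsupp.single x (1 : k)) = 0 := by
        ext z
        rw [pullGood_apply, Finsupp.single_apply]
        by_cases hz : z ∈ Good
        · rw [if_pos hz, if_neg fun h => hg ⟨z, hz, h.symm⟩]; rfl
        · rw [if_neg hz]; rfl
      rw [h1, map_zero]
      ext z
      rw [pullGood_apply]
      split_ifs with hz
      · by_contra hc
        obtain ⟨y, rfl, hy⟩ := (bstep_of_ne_zero hc).of_pbWord hm hx.1
        refine hg ⟨y, ?_, rfl⟩
        rw [hGood, Set.mem_ofPred_eq, hy]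
        exact hz
      · rfl
  have hhead : ∀ x : List (Blk t n), (∀ a ∈ x, BlkV m a) → x = [] ∨ HeadIn m Set.univ x := by
    intro x hx
    cases x with
    | nil => exact Or.inl rfl
    | cons a l =>
      obtain ⟨p, hp⟩ := exists_fac (hx a (by simp))
      exact Or.inr ⟨a, l, rfl, p, hp, trivial⟩
  let R : List (Blk t n) → List (Blk t n) → Prop := fun u d =>
    (∀ a ∈ u, BlkV m a) ∧ ∃ w, NPair m Set.univ u d w
  let key : List (Blk t n) → ℕ ×ₗ List (WithTop (ℕ ×ₗ Lex (Fin t → ℕ))) := fun d =>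
    toLex (wt m d, if h : ∃ u w, NPair m Set.univ u d w then h.choose_spec.choose else [])
  have hkey : ∀ u d w, NPair m Set.univ u d w → key d = toLex (wt m d, w) := by
    intro u d w h
    have h' : ∃ u w, NPair m Set.univ u d w := ⟨u, w, h⟩
    change toLex (wt m d, dite _ _ _) = _
    rw [dif_pos h', (h'.choose_spec.choose_spec.inj hm h).2]
  have hstep : ∀ u d, R u d → BStep u d := fun u d ⟨hu, w, h⟩ =>
    bstep_of_ne_zero (h.ne_zero (k := k) hm hu)
  have hwt : ∀ u d w, NPair m Set.univ u d w → (∀ a ∈ u, BlkV m a) → wt m d = wt m u := by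
    intro u d w h hu
    generalize (Set.univ : Set (Mon (Fin t))) = A at h
    induction h with
    | here A p b l hp hA hb hn =>
      have hc := cop_of_not_next hm hp hb hn
      simp only [wt, List.map_cons, List.sum_cons, Finset.card_union_of_disjoint (hc.disjoint hm),
        hc.sup_union, mdeg_add]
      omega
    | there A p u d w hp hA h ih =>
      rw [List.forall_mem_cons] at hu
      simpa [wt] using ih hu.2
  have hmain := hdim_eq_of_matching (btD k) (wordD pbSz (pbδ k)) pbWord pbWord_injective
    Good (btPiece m α) (btPiece_finite m α) R key btD_btD
    (fun j x hx => btD_mem_piece m α j x hx) hf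
    (fun j x hx hn => by
      rcases exists_npair hm hx.1 Set.univ (hhead x hx.1) with h | ⟨u, w, hu, h⟩ | ⟨d, w, h⟩
      · exact absurd ((hgp x).1 h) hn
      · refine Or.inl ⟨u, fun hg => ?_, ⟨hu, ?_, ?_⟩, hu, w, h⟩
        · have := (hgp u).2 hg
          exact h.not_normal this.1 this.2
        · rw [← hx.2.1]
          exact (hstep u x ⟨hu, w, h⟩).sum_eq.symm
        · rw [← (hstep u x ⟨hu, w, h⟩).deg_eq, hx.2.2]
      · exact Or.inr ⟨d, hx.1, w, h⟩)
    (fun x d u ⟨_, w, h⟩ ⟨_, w', h'⟩ => h.not_down hm h')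
    (fun u u' d ⟨_, w, h⟩ ⟨_, w', h'⟩ => (h.inj hm h').1)
    (fun u d ⟨hu, w, h⟩ => by rw [btD_single]; exact h.ne_zero hm hu)
    (fun u d u' d' ⟨hu, w, h⟩ ⟨hu', w', h'⟩ hne hd => by
      rw [btD_single] at hne
      have hs := bstep_of_ne_zero hne
      rw [hkey _ _ _ h, hkey _ _ _ h', Prod.Lex.toLex_lt_toLex, hwt _ _ _ h hu]
      rcases hs.wt_le (m := m).lt_or_eq with h1 | h1
      · exact Or.inl h1
      · exact Or.inr ⟨h1, h.triangular hm hu hs hd h1 h'⟩) i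
  rw [hmain]
  have e : ∀ j, {a | a ∈ Good ∧ pbWord a ∈ btPiece m α (j + 1)} =
      wordPiece (pbLab (m := m)) pbSz α j := by
    intro j
    ext y
    rw [Set.mem_ofPred_eq, pbWord_mem_btPiece hm, wordPiece, Set.mem_ofPred_eq]
    simp
  rw [e i, e (i + 1)]

end Primes

section WordMaps

variable {k : Type*} [Field k] {Γ Γ' G : Type*}

/-- The linear extension of prepending a letter to a word. -/
def wcons : (Γ →₀ k) →ₗ[k] (List Γ →₀ k) →ₗ[k] (List Γ →₀ k) :=
  Finsupp.linearCombination k fun a => Finsupp.lmapDomain k k (List.cons a)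

theorem wcons_single (a : Γ) (x : List Γ →₀ k) :
    wcons (Finsupp.single a 1) x = x.mapDomain (List.cons a) := by
  rw [wcons, Finsupp.linearCombination_single, one_smul]
  rfl

theorem wcons_single_single (a : Γ) (l : List Γ) :
    wcons (Finsupp.single a (1 : k)) (Finsupp.single l 1) = Finsupp.single (a :: l) 1 := by
  rw [wcons_single, Finsupp.mapDomain_single]

theorem wcons_single_right (v : Γ →₀ k) (l : List Γ) :
    wcons v (Finsupp.single l 1) = v.mapDomain fun c => c :: l := by
  induction v using finsupp_lin_induction with
  | zero => rw [map_zero, Finsupp.mapDomain_zero, LinearMap.zero_apply]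
  | add x y hx hy => rw [map_add, LinearMap.add_apply, hx, hy, Finsupp.mapDomain_add]
  | smul c x hx => rw [map_smul, LinearMap.smul_apply, hx, Finsupp.mapDomain_smul]
  | single a => rw [wcons_single_single, Finsupp.mapDomain_single]

theorem wcons_ne_zero {v : Γ →₀ k} {x : List Γ →₀ k} {z : List Γ} (h : wcons v x z ≠ 0) :
    ∃ c l, z = c :: l ∧ v c ≠ 0 ∧ x l ≠ 0 := by
  have key : wcons v x = v.sum fun a r => r • x.mapDomain (List.cons a) := by
    rw [wcons, Finsupp.linearCombination_apply, Finsupp.sum, LinearMap.sum_apply]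
    rfl
  rw [key, Finsupp.sum, Finsupp.finsetSum_apply] at h
  obtain ⟨a, ha, h⟩ := Finset.exists_ne_zero_of_sum_ne_zero h
  rw [Finsupp.smul_apply] at h
  have hx : x.mapDomain (List.cons a) z ≠ 0 := fun h0 => h (by rw [h0, smul_zero])
  cases z with
  | nil => exact absurd (Finsupp.mapDomain_of_notMem_range _ _ (by simp)) hx
  | cons c l =>
    rw [mapDomain_cons_apply] at hx
    by_cases hc : a = c
    · subst hc
      rw [if_pos rfl] at hx
      exact ⟨a, l, rfl, Finsupp.mem_support_iff.1 ha, hx⟩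
    · simp [hc] at hx

/-- The map on words induced by a linear map on letters, on basis elements. -/
def wmapAux (φ : (Γ' →₀ k) →ₗ[k] (Γ →₀ k)) : List Γ' → (List Γ →₀ k)
  | [] => Finsupp.single [] 1
  | a :: l => wcons (φ (Finsupp.single a 1)) (wmapAux φ l)

/-- The map on words induced by a linear map on letters. -/
def wmap (φ : (Γ' →₀ k) →ₗ[k] (Γ →₀ k)) : (List Γ' →₀ k) →ₗ[k] (List Γ →₀ k) :=
  Finsupp.linearCombination k (wmapAux φ)

theorem wmap_single (φ : (Γ' →₀ k) →ₗ[k] (Γ →₀ k)) (l : List Γ') :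
    wmap φ (Finsupp.single l 1) = wmapAux φ l := by
  rw [wmap, Finsupp.linearCombination_single, one_smul]

theorem wmap_wcons (φ : (Γ' →₀ k) →ₗ[k] (Γ →₀ k)) (v : Γ' →₀ k) (x : List Γ' →₀ k) :
    wmap φ (wcons v x) = wcons (φ v) (wmap φ x) := by
  induction v using finsupp_lin_induction with
  | zero => simp only [map_zero, LinearMap.zero_apply]
  | add x₁ x₂ h₁ h₂ => simp only [map_add, LinearMap.add_apply, h₁, h₂]
  | smul c x₁ h₁ => simp only [map_smul, LinearMap.smul_apply, h₁]
  | single a =>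
    induction x using finsupp_lin_induction with
    | zero => simp only [map_zero]
    | add x₁ x₂ h₁ h₂ => simp only [map_add, h₁, h₂]
    | smul c x₁ h₁ => simp only [map_smul, h₁]
    | single l => rw [wcons_single_single, wmap_single, wmap_single, wmapAux]

theorem wmap_wmap (φ : (Γ' →₀ k) →ₗ[k] (Γ →₀ k)) (ψ : (Γ →₀ k) →ₗ[k] (Γ' →₀ k))
    (h : ∀ x, ψ (φ x) = x) (x : List Γ' →₀ k) : wmap ψ (wmap φ x) = x := by
  induction x using finsupp_lin_induction with
  | zero => simp only [map_zero]
  | add x₁ x₂ h₁ h₂ => simp only [map_add, h₁, h₂]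
  | smul c x₁ h₁ => simp only [map_smul, h₁]
  | single l =>
    induction l with
    | nil => rw [wmap_single, wmapAux, wmap_single, wmapAux]
    | cons a l ih =>
      rw [wmap_single] at ih ⊢
      rw [wmapAux, wmap_wcons, ih, h, wcons_single_single]

/-- Homogeneous linear maps, with respect to gradings of the bases. -/
def Homog (gr' : Γ' → G) (gr : Γ → G) (φ : (Γ' →₀ k) →ₗ[k] (Γ →₀ k)) : Prop :=
  ∀ a c, φ (Finsupp.single a 1) c ≠ 0 → gr c = gr' a

theorem filter_single_one (p : Γ → Prop) [DecidablePred p] (a : Γ) :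
    (Finsupp.single a (1 : k)).filter p = if p a then Finsupp.single a 1 else 0 := by
  split_ifs with h
  · exact Finsupp.filter_single_of_pos _ h
  · exact Finsupp.filter_single_of_neg _ h

theorem Homog.map_filter {gr' : Γ' → G} {gr : Γ → G} {φ : (Γ' →₀ k) →ₗ[k] (Γ →₀ k)}
    (h : Homog gr' gr φ) (g : G) [∀ a, Decidable (gr' a = g)] [∀ c, Decidable (gr c = g)]
    (x : Γ' →₀ k) :
    φ (x.filter fun a => gr' a = g) = (φ x).filter fun c => gr c = g := by
  induction x using finsupp_lin_induction with
  | zero => simp only [Finsupp.filter_zero, map_zero]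
  | add x₁ x₂ h₁ h₂ => rw [Finsupp.filter_add, map_add, map_add, Finsupp.filter_add, h₁, h₂]
  | smul c x₁ h₁ => rw [Finsupp.filter_smul, map_smul, map_smul, Finsupp.filter_smul, h₁]
  | single a =>
    rw [filter_single_one]
    ext c
    rw [Finsupp.filter_apply]
    by_cases hc : φ (Finsupp.single a 1) c = 0
    · rw [hc]
      split_ifs <;> simp [hc]
    · by_cases hg : gr' a = g
      · rw [if_pos hg, if_pos ((h a c hc).trans hg)]
      · rw [if_neg hg, if_neg fun h0 => hg ((h a c hc).symm.trans h0), map_zero]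
        rfl

theorem Homog.symm {gr' : Γ' → G} {gr : Γ → G} {φ : (Γ' →₀ k) ≃ₗ[k] (Γ →₀ k)}
    (h : Homog gr' gr φ.toLinearMap) : Homog gr gr' φ.symm.toLinearMap := by
  intro c a ha
  have h1 := h.map_filter (gr c) (φ.symm (Finsupp.single c 1))
  change φ _ = Finsupp.filter _ (φ _) at h1
  rw [φ.apply_symm_apply, filter_single_one, if_pos rfl] at h1
  have h2 : (φ.symm (Finsupp.single c 1)).filter (fun a => gr' a = gr c) =
      φ.symm (Finsupp.single c 1) := φ.injective (by rw [h1, φ.apply_symm_apply])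
  change φ.symm (Finsupp.single c 1) a ≠ 0 at ha
  by_contra hne
  rw [← h2, Finsupp.filter_apply, if_neg hne] at ha
  exact ha rfl

theorem Homog.wmap {gr' : Γ' → G} {gr : Γ → G} {φ : (Γ' →₀ k) →ₗ[k] (Γ →₀ k)}
    (h : Homog gr' gr φ) : Homog (List.map gr') (List.map gr) (wmap φ) := by
  intro l z
  rw [wmap_single]
  induction l generalizing z with
  | nil =>
    intro hz
    rw [wmapAux, Finsupp.single_apply] at hz
    split_ifs at hz with h0
    · rw [← h0]; rfl
    · exact absurd rfl hz
  | cons a l ih =>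
    intro hz
    rw [wmapAux] at hz
    obtain ⟨c, w, rfl, hc, hw⟩ := wcons_ne_zero hz
    rw [List.map_cons, List.map_cons, h a c hc, ih w hw]

theorem Homog.map_supported {gr' : Γ' → G} {gr : Γ → G} {φ : (Γ' →₀ k) →ₗ[k] (Γ →₀ k)}
    (h : Homog gr' gr φ) (P : Set G) {x : Γ' →₀ k}
    (hx : x ∈ Finsupp.supported k k (gr' ⁻¹' P)) : φ x ∈ Finsupp.supported k k (gr ⁻¹' P) := by
  rw [Finsupp.supported_eq_span_single] at hx
  induction hx using Submodule.span_induction with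
  | mem x hx =>
    obtain ⟨a, ha, rfl⟩ := hx
    intro c hc
    change gr c ∈ P
    rw [h a c (Finsupp.mem_support_iff.1 hc)]
    exact ha
  | zero => simp
  | add x y _ _ hx hy => rw [map_add]; exact Submodule.add_mem _ hx hy
  | smul a x _ hx => rw [map_smul]; exact Submodule.smul_mem _ _ hx

/-- The linear extension of a differential on letters. -/
def linδ (δ : Γ → (Γ →₀ k)) : (Γ →₀ k) →ₗ[k] (Γ →₀ k) := Finsupp.linearCombination k δ

theorem linδ_single (δ : Γ → (Γ →₀ k)) (a : Γ) : linδ δ (Finsupp.single a 1) = δ a := by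
  rw [linδ, Finsupp.linearCombination_single, one_smul]

/-- The sign operator of a grading of the letters. -/
def signOp (k : Type*) [Field k] (sz : Γ → ℕ) : (Γ →₀ k) →ₗ[k] (Γ →₀ k) :=
  Finsupp.linearCombination k fun a => (-1 : k) ^ sz a • Finsupp.single a 1

theorem signOp_single (sz : Γ → ℕ) (a : Γ) :
    signOp k sz (Finsupp.single a 1) = (-1 : k) ^ sz a • Finsupp.single a 1 := by
  rw [signOp, Finsupp.linearCombination_single, one_smul]

theorem signOp_apply (sz : Γ → ℕ) (x : Γ →₀ k) (a : Γ) :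
    signOp k sz x a = (-1 : k) ^ sz a * x a := by
  induction x using finsupp_lin_induction with
  | zero => simp
  | add x₁ x₂ h₁ h₂ => rw [map_add, Finsupp.add_apply, h₁, h₂, Finsupp.add_apply, mul_add]
  | smul c x₁ h₁ =>
    rw [map_smul, Finsupp.smul_apply, h₁, Finsupp.smul_apply, smul_eq_mul, smul_eq_mul]; ring
  | single b =>
    rw [signOp_single, Finsupp.smul_apply, smul_eq_mul]
    by_cases h : b = a
    · subst h; rfl
    · simp [h]

theorem wordD_wcons (sz : Γ → ℕ) (δ : Γ → (Γ →₀ k)) (v : Γ →₀ k) (x : List Γ →₀ k) :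
    wordD sz δ (wcons v x) =
      -wcons (linδ δ v) x - wcons (signOp k sz v) (wordD sz δ x) := by
  induction v using finsupp_lin_induction with
  | zero => simp only [map_zero, LinearMap.zero_apply, neg_zero, sub_zero]
  | add x₁ x₂ h₁ h₂ => simp only [map_add, LinearMap.add_apply, h₁, h₂] <;> abel
  | smul c x₁ h₁ => simp only [map_smul, LinearMap.smul_apply, h₁, smul_sub, smul_neg]
  | single a =>
    induction x using finsupp_lin_induction with
    | zero => simp only [map_zero, neg_zero, sub_zero]
    | add x₁ x₂ h₁ h₂ => simp only [map_add, h₁, h₂] <;> abel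
    | smul c x₁ h₁ => simp only [map_smul, h₁, smul_sub, smul_neg]
    | single l =>
      rw [wcons_single_single, wordD_single, wordAux, wordD_single, linδ_single, signOp_single,
        wcons_single_right, map_smul, LinearMap.smul_apply, wcons_single]

theorem wordD_nil (sz : Γ → ℕ) (δ : Γ → (Γ →₀ k)) :
    wordD sz δ (Finsupp.single [] 1) = 0 := by
  rw [wordD_single]; rfl

theorem signOp_linδ (sz : Γ → ℕ) (δ : Γ → (Γ →₀ k)) (h : ∀ a c, δ a c ≠ 0 → sz c + 1 = sz a)
    (x : Γ →₀ k) : signOp k sz (linδ δ x) = -linδ δ (signOp k sz x) := by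
  induction x using finsupp_lin_induction with
  | zero => simp only [map_zero, neg_zero]
  | add x₁ x₂ h₁ h₂ => simp only [map_add, h₁, h₂, neg_add]
  | smul c x₁ h₁ => simp only [map_smul, h₁, smul_neg]
  | single a =>
    rw [signOp_single, map_smul, linδ_single]
    ext c
    rw [signOp_apply, Finsupp.neg_apply, Finsupp.smul_apply, smul_eq_mul]
    by_cases hc : δ a c = 0
    · simp [hc]
    · rw [← h a c hc, pow_succ]; ring

theorem wordD_wordD (sz : Γ → ℕ) (δ : Γ → (Γ →₀ k)) (h : ∀ a c, δ a c ≠ 0 → sz c + 1 = sz a)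
    (hδ : ∀ a, linδ δ (δ a) = 0) (x : List Γ →₀ k) : wordD sz δ (wordD sz δ x) = 0 := by
  have hδ' : ∀ v, linδ δ (linδ δ v) = 0 := by
    intro v
    induction v using finsupp_lin_induction with
    | zero => simp only [map_zero]
    | add x₁ x₂ h₁ h₂ => simp only [map_add, h₁, h₂, add_zero]
    | smul c x₁ h₁ => simp only [map_smul, h₁, smul_zero]
    | single a => rw [linδ_single, hδ]
  induction x using finsupp_lin_induction with
  | zero => simp only [map_zero]
  | add x₁ x₂ h₁ h₂ => simp only [map_add, h₁, h₂, add_zero]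
  | smul c x₁ h₁ => simp only [map_smul, h₁, smul_zero]
  | single l =>
    induction l with
    | nil => rw [wordD_nil, map_zero]
    | cons a l ih =>
      rw [← wcons_single_single, wordD_wcons, map_sub, map_neg, wordD_wcons, wordD_wcons, ih,
        hδ', signOp_linδ sz δ h]
      simp

theorem wmap_wordD {sz' : Γ' → ℕ} {sz : Γ → ℕ} {δ' : Γ' → (Γ' →₀ k)} {δ : Γ → (Γ →₀ k)}
    {φ : (Γ' →₀ k) →ₗ[k] (Γ →₀ k)} (h1 : ∀ a, φ (δ' a) = linδ δ (φ (Finsupp.single a 1)))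
    (h2 : Homog sz' sz φ) (x : List Γ' →₀ k) :
    wmap φ (wordD sz' δ' x) = wordD sz δ (wmap φ x) := by
  have h3 : ∀ a, φ (signOp k sz' (Finsupp.single a 1)) =
      signOp k sz (φ (Finsupp.single a 1)) := by
    intro a
    rw [signOp_single, map_smul]
    ext c
    rw [signOp_apply, Finsupp.smul_apply, smul_eq_mul]
    by_cases hc : φ (Finsupp.single a 1) c = 0
    · rw [hc, mul_zero, mul_zero]
    · rw [h2 a c hc]
  induction x using finsupp_lin_induction with
  | zero => simp only [map_zero]
  | add x₁ x₂ h₁ h₂ => simp only [map_add, h₁, h₂]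
  | smul c x₁ h₁ => simp only [map_smul, h₁]
  | single l =>
    induction l with
    | nil => rw [wordD_nil, map_zero, wmap_single, wmapAux, wordD_nil]
    | cons a l ih =>
      rw [← wcons_single_single, wordD_wcons, wmap_wcons, wordD_wcons, map_sub, map_neg,
        wmap_wcons, wmap_wcons, ih, linδ_single, h1, h3]

theorem wordD_homog {sz : Γ → ℕ} {δ : Γ → (Γ →₀ k)} {lab : Γ → G}
    (h : ∀ a c, δ a c ≠ 0 → lab c = lab a ∧ sz c + 1 = sz a) {y z : List Γ}
    (hyz : wordAux sz δ y z ≠ 0) : z.map lab = y.map lab ∧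
      (z.map fun a => sz a + 1).sum + 1 = (y.map fun a => sz a + 1).sum := by
  induction y generalizing z with
  | nil => exact absurd rfl hyz
  | cons a l ih =>
    cases z with
    | nil => exact absurd (wordAux_nil_right _ _ _) hyz
    | cons c l' =>
      rw [wordAux_cons_cons] at hyz
      simp only [List.map_cons, List.sum_cons]
      by_cases h1 : l = l' ∧ δ a c ≠ 0
      · obtain ⟨rfl, h1⟩ := h1
        obtain ⟨h2, h3⟩ := h a c h1
        rw [h2, ← h3]
        exact ⟨rfl, by ring⟩
      · have h2 : (if l = l' then δ a c else 0) = 0 := by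
          split_ifs with h
          · by_contra hc; exact h1 ⟨h, hc⟩
          · rfl
        rw [h2] at hyz
        by_cases h3 : a = c
        · subst h3
          obtain ⟨h4, h5⟩ := ih (z := l') fun h0 => hyz (by simp [h0])
          rw [h4, ← h5]
          exact ⟨rfl, by ring⟩
        · simp [h3] at hyz

end WordMaps

section WordHomology

variable {k : Type*} [Field k] {t : ℕ} {Γ Γ' : Type*}

/-- The pieces of the complex of normal words, shifted by one. -/
def wordPieceS (lab : Γ → Mon (Fin t)) (sz : Γ → ℕ) (α : Mon (Fin t)) (j : ℕ) : Set (List Γ) :=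
  {y | NormalL Set.univ (y.map lab) ∧ (y.map lab).sum = α ∧
    (y.map fun a => sz a + 1).sum + 1 = j}

theorem wordPieceS_succ (lab : Γ → Mon (Fin t)) (sz : Γ → ℕ) (α : Mon (Fin t)) (j : ℕ) :
    wordPieceS lab sz α (j + 1) = wordPiece lab sz α j := by
  ext y
  simp [wordPieceS, wordPiece]

theorem wordPieceS_finite [Finite Γ] (lab : Γ → Mon (Fin t)) (sz : Γ → ℕ) (α : Mon (Fin t))
    (j : ℕ) : (wordPieceS lab sz α j).Finite := by
  refine (finite_lists (Set.toFinite (Set.univ : Set Γ)) j).subset ?_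
  rintro y ⟨-, -, h⟩
  refine ⟨fun _ _ => trivial, ?_⟩
  have h2 : (y.map fun a => sz a + 1).length • 1 ≤ (y.map fun a => sz a + 1).sum := by
    refine List.card_nsmul_le_sum _ _ ?_
    intro x hx
    obtain ⟨a, -, rfl⟩ := List.mem_map.1 hx
    omega
  rw [List.length_map, smul_eq_mul, mul_one] at h2
  omega

theorem wordPiece_eq_preimage (lab : Γ → Mon (Fin t)) (sz : Γ → ℕ) (α : Mon (Fin t)) (i : ℕ) :
    wordPiece lab sz α i = List.map (fun a => (lab a, sz a)) ⁻¹'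
      {z | NormalL Set.univ (z.map Prod.fst) ∧ (z.map Prod.fst).sum = α ∧
        (z.map fun a => a.2 + 1).sum = i} := by
  ext y
  simp [wordPiece, Function.comp_def]

theorem wordD_mem_wordPieceS {lab : Γ → Mon (Fin t)} {sz : Γ → ℕ} {δ : Γ → (Γ →₀ k)}
    (h : ∀ a c, δ a c ≠ 0 → lab c = lab a ∧ sz c + 1 = sz a) (α : Mon (Fin t)) (j : ℕ)
    (y : List Γ) (hy : y ∈ wordPieceS lab sz α (j + 1)) :
    wordD sz δ (Finsupp.single y 1) ∈ Finsupp.supported k k (wordPieceS lab sz α j) := by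
  intro z hz
  rw [wordD_single, Finset.mem_coe, Finsupp.mem_support_iff] at hz
  obtain ⟨h1, h2⟩ := wordD_homog h hz
  obtain ⟨h3, h4, h5⟩ := hy
  exact ⟨by rwa [h1], by rwa [h1], by omega⟩

theorem hdim_wordD_congr {lab : Γ → Mon (Fin t)} {sz : Γ → ℕ} {δ : Γ → (Γ →₀ k)}
    {lab' : Γ' → Mon (Fin t)} {sz' : Γ' → ℕ} {δ' : Γ' → (Γ' →₀ k)}
    (h' : ∀ a c, δ' a c ≠ 0 → lab' c = lab' a ∧ sz' c + 1 = sz' a)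
    (hδ' : ∀ a, linδ δ' (δ' a) = 0) (φ : (Γ' →₀ k) ≃ₗ[k] (Γ →₀ k))
    (h1 : ∀ a, φ (δ' a) = linδ δ (φ (Finsupp.single a 1)))
    (h2 : Homog (fun a => (lab' a, sz' a)) (fun a => (lab a, sz a)) φ.toLinearMap)
    (α : Mon (Fin t)) (i : ℕ) :
    hdim (wordD sz' δ') (Finsupp.supported k k (wordPiece lab' sz' α i))
      (Finsupp.supported k k (wordPiece lab' sz' α (i + 1))) =
    hdim (wordD sz δ) (Finsupp.supported k k (wordPiece lab sz α i))
      (Finsupp.supported k k (wordPiece lab sz α (i + 1))) := by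
  have hsymm : ∀ x, wmap φ.symm.toLinearMap (wmap φ.toLinearMap x) = x :=
    wmap_wmap _ _ φ.symm_apply_apply
  have hsymm' : ∀ x, wmap φ.toLinearMap (wmap φ.symm.toLinearMap x) = x :=
    wmap_wmap _ _ φ.apply_symm_apply
  have hinj : ∀ x, wmap φ.toLinearMap x = 0 → x = 0 := by
    intro x hx
    rw [← hsymm x, hx, map_zero]
  have hmap : ∀ i, (Finsupp.supported k k (wordPiece lab' sz' α i)).map (wmap φ.toLinearMap) =
      Finsupp.supported k k (wordPiece lab sz α i) := by
    intro i
    rw [wordPiece_eq_preimage, wordPiece_eq_preimage]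
    apply le_antisymm
    · rintro _ ⟨x, hx, rfl⟩
      exact h2.wmap.map_supported _ hx
    · intro x hx
      exact ⟨_, h2.symm.wmap.map_supported _ hx, hsymm' x⟩
  have hcomm := wmap_wordD (φ := φ.toLinearMap) (sz' := sz') (sz := sz) h1
    (fun a c h => congrArg Prod.snd (h2 a c h))
  have hDD := wordD_wordD sz' δ' (fun a c h => (h' a c h).2) hδ'
  have hG : ∀ x ∈ Finsupp.supported k k (wordPiece lab' sz' α (i + 1)),
      wordD sz' δ' x ∈ Finsupp.supported k k (wordPiece lab' sz' α i) := by
    intro x hx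
    rw [Finsupp.supported_eq_span_single] at hx
    induction hx using Submodule.span_induction with
    | mem x h =>
      obtain ⟨u, hu, rfl⟩ := h
      rw [← wordPieceS_succ] at hu ⊢
      exact wordD_mem_wordPieceS h' α _ u hu
    | zero => simp
    | add x y _ _ hx hy => rw [map_add]; exact Submodule.add_mem _ hx hy
    | smul a x _ hx => rw [map_smul]; exact Submodule.smul_mem _ _ hx
  rw [hdim_eq_of_exact (wordD sz' δ') (wordD sz δ) (wmap φ.toLinearMap) ⊤ _ _ hDD hG
    (fun _ _ => trivial) (fun x _ => hcomm x) (fun x _ => hcomm x)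
    (fun z _ hz _ => ⟨0, Submodule.zero_mem _, map_zero _, by rw [map_zero, hinj z hz]⟩)
    (fun z _ hz _ => ⟨0, Submodule.zero_mem _, map_zero _, by rw [map_zero, hinj z hz]⟩),
    hmap, hmap]

/-- Words matched at the first non-critical letter. -/
inductive WPair (P : Γ → Γ → Prop) : List Γ → List Γ → Prop
  | here (u d : Γ) (l : List Γ) (h : P u d) : WPair P (u :: l) (d :: l)
  | there (a : Γ) (u d : List Γ) (h1 : ∀ x, ¬ P a x) (h2 : ∀ x, ¬ P x a) (h : WPair P u d) :
      WPair P (a :: u) (a :: d)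

section Pairing

variable {P : Γ → Γ → Prop}
  (hP2 : ∀ u u' d, P u d → P u' d → u = u') (hP3 : ∀ x d u, P x d → ¬ P u x)
include hP3

theorem WPair.not_up {u x d : List Γ} (h : WPair P x d) : ¬ WPair P u x := by
  induction h generalizing u with
  | here x d l h =>
    intro h'
    cases h' with
    | here u _ _ h' => exact hP3 _ _ _ h h'
    | there _ _ _ h1 h2 => exact h1 _ h
  | there a x d h1 h2 h ih =>
    intro h'
    cases h' with
    | here u _ _ h' => exact h2 _ h'
    | there _ u _ _ _ h' => exact ih h'

omit hP3 in
include hP2 in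
theorem WPair.inj {u u' d : List Γ} (h : WPair P u d) (h' : WPair P u' d) : u = u' := by
  induction h generalizing u' with
  | here u d l h =>
    cases h' with
    | here u' _ _ h' => rw [hP2 _ _ _ h h']
    | there _ _ _ h1 h2 => exact absurd h (h2 _)
  | there a u d h1 h2 h ih =>
    cases h' with
    | here u' _ _ h' => exact absurd h' (h2 _)
    | there _ u' _ _ _ h' => rw [ih h']

section Differential

variable {sz : Γ → ℕ} {δ : Γ → (Γ →₀ k)}
  (hδ1 : ∀ u d, P u d → δ u = Finsupp.single d 1) (hδ2 : ∀ u, (∀ d, ¬ P u d) → δ u = 0)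
include hδ1 hδ2

theorem WPair.wordAux_ne_zero {u d : List Γ} (h : WPair P u d) : wordAux sz δ u d ≠ 0 := by
  induction h with
  | here u d l h =>
    rw [wordAux_cons_cons, hδ1 u d h, if_pos rfl, if_neg]
    · simp
    · rintro rfl
      exact hP3 _ _ _ h h
  | there a u d h1 h2 h ih =>
    rw [wordAux_cons_cons, hδ2 a h1, if_pos rfl]
    simpa using ih

omit hP3 in
theorem wordAux_cons_ne_zero {a c : Γ} {l l' : List Γ} (h : wordAux sz δ (a :: l) (c :: l') ≠ 0) :
    (P a c ∧ l = l') ∨ (a = c ∧ wordAux sz δ l l' ≠ 0) := by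
  rw [wordAux_cons_cons] at h
  by_cases h1 : P a c ∧ l = l'
  · exact Or.inl h1
  · refine Or.inr ?_
    have h2 : (if l = l' then δ a c else 0) = 0 := by
      split_ifs with hl
      · by_cases hd : ∃ d, P a d
        · obtain ⟨d, hd⟩ := hd
          rw [hδ1 a d hd, Finsupp.single_apply, if_neg]
          rintro rfl
          exact h1 ⟨hd, hl⟩
        · rw [hδ2 a (not_exists.1 hd)]; rfl
      · rfl
    rw [h2] at h
    by_cases h3 : a = c
    · exact ⟨h3, fun h0 => h (by simp [h0])⟩
    · simp [h3] at h

theorem WPair.eq_of_wordAux {u d u' d' : List Γ} (h : WPair P u d) (h' : WPair P u' d')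
    (hne : wordAux sz δ u d' ≠ 0) : d' = d := by
  induction h generalizing u' d' with
  | here u d l h =>
    cases h' with
    | here u' d' l' h' =>
      rcases wordAux_cons_ne_zero hδ1 hδ2 hne with ⟨h1, rfl⟩ | ⟨rfl, -⟩
      · have := (hδ1 _ _ h).symm.trans (hδ1 _ _ h1)
        rw [Finsupp.single_left_inj (one_ne_zero : (1 : k) ≠ 0)] at this
        rw [this]
      · exact absurd h' (hP3 _ _ _ h)
    | there a u' d' h1 h2 h' =>
      rcases wordAux_cons_ne_zero hδ1 hδ2 hne with ⟨h3, rfl⟩ | ⟨rfl, -⟩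
      · exact absurd h3 (h2 _)
      · exact absurd h (h1 _)
  | there a u d h1 h2 h ih =>
    cases h' with
    | here u' d' l' h' =>
      rcases wordAux_cons_ne_zero hδ1 hδ2 hne with ⟨h3, rfl⟩ | ⟨rfl, -⟩
      · exact absurd h3 (h1 _)
      · exact absurd h' (h2 _)
    | there a' u' d' h1' h2' h' =>
      rcases wordAux_cons_ne_zero hδ1 hδ2 hne with ⟨h3, rfl⟩ | ⟨rfl, h3⟩
      · exact absurd h3 (h1 _)
      · rw [ih h' h3]

omit hP3 in
theorem exists_target {x z : List Γ} (h : wordAux sz δ x z ≠ 0) : ∃ c ∈ z, ∃ u, P u c := by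
  induction x generalizing z with
  | nil => exact absurd rfl h
  | cons a l ih =>
    cases z with
    | nil => exact absurd (wordAux_nil_right _ _ _) h
    | cons c l' =>
      rcases wordAux_cons_ne_zero hδ1 hδ2 h with ⟨h1, rfl⟩ | ⟨rfl, h1⟩
      · exact ⟨c, by simp, a, h1⟩
      · obtain ⟨c, hc, hu⟩ := ih h1
        exact ⟨c, by simp [hc], hu⟩

end Differential

end Pairing

theorem exists_wpair (P : Γ → Γ → Prop) {S : Type*} (i : S → Γ)
    (hcov : ∀ a, (∃ s, i s = a) ∨ (∃ d, P a d) ∨ ∃ u, P u a)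
    (x : List Γ) : (∃ y : List S, y.map i = x) ∨ (∃ d, WPair P x d) ∨ ∃ u, WPair P u x := by
  induction x with
  | nil => exact Or.inl ⟨[], rfl⟩
  | cons a l ih =>
    by_cases hs : ∃ d, P a d
    · obtain ⟨d, hd⟩ := hs
      exact Or.inr (Or.inl ⟨_, .here a d l hd⟩)
    by_cases ht : ∃ u, P u a
    · obtain ⟨u, hu⟩ := ht
      exact Or.inr (Or.inr ⟨_, .here u a l hu⟩)
    obtain ⟨s, rfl⟩ := (hcov a).resolve_right (not_or.2 ⟨hs, ht⟩)
    rcases ih with ⟨y, rfl⟩ | ⟨d, h⟩ | ⟨u, h⟩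
    · exact Or.inl ⟨s :: y, rfl⟩
    · exact Or.inr (Or.inl ⟨_, .there _ _ _ (not_exists.1 hs) (not_exists.1 ht) h⟩)
    · exact Or.inr (Or.inr ⟨_, .there _ _ _ (not_exists.1 hs) (not_exists.1 ht) h⟩)

theorem hdim_zero_supported {Λ : Type*} {s : Set Λ} (hs : s.Finite) (G : Submodule k (Λ →₀ k)) :
    hdim (0 : (Λ →₀ k) →ₗ[k] (Λ →₀ k)) (Finsupp.supported k k s) G = Nat.card s := by
  have := finiteDimensional_supported (k := k) hs
  have : Fintype s := hs.fintype
  rw [hdim_eq_sub _ _ _ (by rw [Submodule.map_zero]; exact bot_le), Submodule.map_zero,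
    finrank_bot, LinearMap.ker_zero, inf_top_eq, Nat.sub_zero,
    (Finsupp.supportedEquivFinsupp (M := k) (R := k) s).finrank_eq, Module.finrank_finsupp_self,
    Nat.card_eq_fintype_card]

theorem hdim_wordD_eq_card [Finite Γ] {S : Type*} (P : Γ → Γ → Prop)
    (hP2 : ∀ u u' d, P u d → P u' d → u = u') (hP3 : ∀ x d u, P x d → ¬ P u x)
    (i : S → Γ) (hi : Function.Injective i)
    (hcov : ∀ a, (∃ s, i s = a) ∨ (∃ d, P a d) ∨ ∃ u, P u a)
    (hcrit : ∀ s u, ¬ P u (i s)) (hcrit' : ∀ s d, ¬ P (i s) d)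
    {lab : Γ → Mon (Fin t)} {sz : Γ → ℕ} {δ : Γ → (Γ →₀ k)}
    (hδ1 : ∀ u d, P u d → δ u = Finsupp.single d 1) (hδ2 : ∀ u, (∀ d, ¬ P u d) → δ u = 0)
    (hP : ∀ u d, P u d → lab d = lab u ∧ sz d + 1 = sz u) (α : Mon (Fin t)) (j : ℕ) :
    hdim (wordD sz δ) (Finsupp.supported k k (wordPiece lab sz α j))
      (Finsupp.supported k k (wordPiece lab sz α (j + 1))) =
    Nat.card (wordPiece (fun s => lab (i s)) (fun s => sz (i s)) α j) := by
  have hhom : ∀ a c, δ a c ≠ 0 → lab c = lab a ∧ sz c + 1 = sz a := by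
    intro a c hc
    by_cases hd : ∃ d, P a d
    · obtain ⟨d, hd⟩ := hd
      rw [hδ1 a d hd, Finsupp.single_apply] at hc
      split_ifs at hc with h
      · rw [← h]; exact hP a d hd
      · exact absurd rfl hc
    · rw [hδ2 a (not_exists.1 hd)] at hc
      exact absurd rfl hc
  have hdd : ∀ a, linδ δ (δ a) = 0 := by
    intro a
    by_cases hd : ∃ d, P a d
    · obtain ⟨d, hd⟩ := hd
      rw [hδ1 a d hd, linδ_single]
      exact hδ2 d fun e he => hP3 _ _ _ he hd
    · rw [hδ2 a (not_exists.1 hd), map_zero]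
  have hι : Function.Injective (List.map i) := List.map_injective_iff.2 hi
  have hRs : ∀ {u d : List Γ}, WPair P u d → (d.map lab = u.map lab ∧
      (d.map fun a => sz a + 1).sum + 1 = (u.map fun a => sz a + 1).sum) := fun h =>
    wordD_homog hhom (h.wordAux_ne_zero hP3 hδ1 hδ2)
  have hmain := hdim_eq_of_matching (wordD sz δ) (0 : (List S →₀ k) →ₗ[k] (List S →₀ k))
    (List.map i) hι Set.univ (wordPieceS lab sz α) (wordPieceS_finite lab sz α) (WPair P)
    (fun _ => (0 : ℕ)) (wordD_wordD sz δ (fun a c h => (hhom a c h).2) hdd)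
    (fun j y hy => wordD_mem_wordPieceS hhom α j y hy)
    (fun j x hx => by
      ext z
      rw [pullGood_apply, LinearMap.zero_apply, if_pos (Set.mem_univ _), wordD_single]
      by_contra hc
      obtain ⟨c, hc, u, hu⟩ := exists_target hδ1 hδ2 hc
      obtain ⟨s, -, rfl⟩ := List.mem_map.1 hc
      exact hcrit s u hu)
    (fun j x hx hn => by
      rcases exists_wpair P i hcov x with ⟨y, rfl⟩ | h | ⟨u, h⟩
      · exact absurd ⟨y, trivial, rfl⟩ hn
      · exact Or.inr h
      · refine Or.inl ⟨u, ?_, ?_, h⟩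
        · rintro ⟨y, -, rfl⟩
          clear hn hx
          generalize hz : y.map i = z at h
          induction h generalizing y with
          | here u d l h =>
            cases y with
            | nil => cases hz
            | cons s y =>
              rw [← (List.cons.inj hz).1] at h
              exact hcrit' _ _ h
          | there a u d h1 h2 h ih =>
            cases y with
            | nil => cases hz
            | cons s y => exact ih y (List.cons.inj hz).2
        · obtain ⟨h1, h2⟩ := hRs h
          obtain ⟨h3, h4, h5⟩ := hx
          exact ⟨by rwa [← h1], by rwa [← h1], by omega⟩)
    (fun x d u h => h.not_up hP3)
    (fun u u' d h h' => h.inj hP2 h')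
    (fun u d h => by rw [wordD_single]; exact h.wordAux_ne_zero hP3 hδ1 hδ2)
    (fun u d u' d' h h' hne hd => by
      rw [wordD_single] at hne
      exact absurd (h.eq_of_wordAux hP3 hδ1 hδ2 h' hne) hd) j
  have e : ∀ j, {y | y ∈ (Set.univ : Set (List S)) ∧ y.map i ∈ wordPieceS lab sz α (j + 1)} =
      wordPiece (fun s => lab (i s)) (fun s => sz (i s)) α j := by
    intro j
    rw [wordPieceS_succ]
    ext y
    simp [wordPiece, Function.comp_def]
  have : Finite S := Finite.of_injective i hi
  rw [e, e (j + 1), wordPieceS_succ, wordPieceS_succ] at hmain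
  rw [hmain, hdim_zero_supported]
  rw [← wordPieceS_succ]
  exact wordPieceS_finite _ _ _ _

end WordHomology

section AdaptedBasis

variable {k : Type*} [Field k] {t : ℕ} {Γ : Type*}

theorem linδ_filter {lab : Γ → Mon (Fin t)} {sz : Γ → ℕ} {δ : Γ → (Γ →₀ k)}
    (h : ∀ a c, δ a c ≠ 0 → lab c = lab a ∧ sz c + 1 = sz a) (a : Γ) (q : Γ →₀ k)
    (hq : linδ δ q = δ a) :
    linδ δ (q.filter fun c => (lab c, sz c) = (lab a, sz a)) = δ a := by
  have hh : Homog (fun c => (lab c, sz c)) (fun c => (lab c, sz c + 1)) (linδ δ) := by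
    intro b c hc
    rw [linδ_single] at hc
    obtain ⟨h1, h2⟩ := h b c hc
    exact Prod.ext h1 h2
  have h1 := hh.map_filter (lab a, sz a) q
  refine h1.trans ?_
  rw [hq]
  ext c
  rw [Finsupp.filter_apply]
  split_ifs with hc
  · rfl
  · by_contra hne
    obtain ⟨h1, h2⟩ := h a c (Ne.symm hne)
    exact hc (Prod.ext h1 h2)

theorem linδ_linδ {δ : Γ → (Γ →₀ k)} (hδ : ∀ a, linδ δ (δ a) = 0) (v : Γ →₀ k) :
    linδ δ (linδ δ v) = 0 := by
  induction v using finsupp_lin_induction with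
  | zero => simp only [map_zero]
  | add x₁ x₂ h₁ h₂ => simp only [map_add, h₁, h₂, add_zero]
  | smul c x₁ h₁ => simp only [map_smul, h₁, smul_zero]
  | single a => rw [linδ_single, hδ]

/-- Letters with independent differentials, together with these differentials, are independent. -/
theorem linearIndepOn_union_differential {δ : Γ → (Γ →₀ k)} (hδ : ∀ a, linδ δ (δ a) = 0)
    {U : Set Γ} (hU : LinearIndepOn k δ U) :
    LinearIndepOn k (Sum.elim (fun a => Finsupp.single a (1 : k)) δ)
      (Sum.inl '' U ∪ Sum.inr '' U) := by
  refine LinearIndepOn.union (LinearIndepOn.image_of_comp _ _ ?_)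
    (LinearIndepOn.image_of_comp _ _ hU) ?_
  · refine LinearIndepOn.of_comp (linδ δ) ?_
    have : linδ δ ∘ Sum.elim (fun a => Finsupp.single a (1 : k)) δ ∘ Sum.inl = δ :=
      funext fun a => linδ_single δ a
    rw [this]
    exact hU
  · rw [← Set.image_comp, ← Set.image_comp, Submodule.disjoint_def]
    intro x hx hx'
    change x ∈ Submodule.span k ((fun a => Finsupp.single a (1 : k)) '' U) at hx
    rw [← Finsupp.supported_eq_span_single] at hx
    refine (linearIndepOn_iff.1 hU) x hx ?_
    obtain ⟨q, -, rfl⟩ := (Finsupp.mem_span_image_iff_linearCombination k).1 hx'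
    exact linδ_linδ hδ q

theorem exists_critical_letters [Finite Γ] {lab : Γ → Mon (Fin t)} {sz : Γ → ℕ}
    {δ : Γ → (Γ →₀ k)} (h : ∀ a c, δ a c ≠ 0 → lab c = lab a ∧ sz c + 1 = sz a)
    (hδ : ∀ a, linδ δ (δ a) = 0) :
    ∃ S : Set Γ, (∀ a, δ a = 0 → (∀ c, δ c a = 0) → a ∈ S) ∧ ∀ α i,
      hdim (wordD sz δ) (Finsupp.supported k k (wordPiece lab sz α i))
        (Finsupp.supported k k (wordPiece lab sz α (i + 1))) =
      Nat.card (wordPiece (fun s : S => lab s) (fun s : S => sz s) α i) := by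
  have : Fintype Γ := Fintype.ofFinite Γ
  obtain ⟨U, -, -, hUspan, hUind⟩ := exists_linearIndepOn_extension
    (K := k) (v := δ) (linearIndepOn_empty k δ) (Set.subset_univ ∅)
  let v : Γ ⊕ Γ → (Γ →₀ k) := Sum.elim (fun a => Finsupp.single a 1) δ
  have hst : (Sum.inl '' U ∪ Sum.inr '' U : Set (Γ ⊕ Γ)) ⊆ Set.range Sum.inl ∪ Sum.inr '' U :=
    Set.union_subset_union_left _ (Set.image_subset_range _ _)
  have hU0 : ∀ a ∈ U, δ a ≠ 0 := fun a ha => hUind.ne_zero ha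
  obtain ⟨b, hbt, hsb, hspan, hb⟩ := exists_linearIndepOn_extension
    (linearIndepOn_union_differential hδ hUind) hst
  have hsingle : ∀ x, x ∈ Submodule.span k (v '' b) := by
    intro x
    rw [← Finsupp.sum_single x]
    refine Submodule.sum_mem _ fun a _ => ?_
    have h1 := (Submodule.span k (v '' b)).smul_mem (x a)
      (hspan ⟨Sum.inl a, Or.inl ⟨a, rfl⟩, rfl⟩)
    change x a • Finsupp.single a 1 ∈ _ at h1
    rwa [Finsupp.smul_single, smul_eq_mul, mul_one] at h1
  have hbr : ∀ a, Sum.inr a ∈ b → a ∈ U := by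
    intro a ha
    rcases hbt ha with ⟨c, hc⟩ | ⟨c, hc, hca⟩
    · cases hc
    · cases hca; exact hc
  have hp : ∀ a, ∃ p : Γ →₀ k, p ∈ Finsupp.supported k k {c | c ∈ U ∧ (lab c, sz c) = (lab a, sz a)} ∧
      (a ∈ U → p = 0) ∧ (a ∉ U → linδ δ p = δ a) := by
    intro a
    by_cases ha : a ∈ U
    · exact ⟨0, Submodule.zero_mem _, fun _ => rfl, fun h => absurd ha h⟩
    obtain ⟨q, hq, hqa⟩ := (Finsupp.mem_span_image_iff_linearCombination k).1
      (hUspan ⟨a, trivial, rfl⟩)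
    refine ⟨q.filter fun c => (lab c, sz c) = (lab a, sz a), fun c hc => ?_,
      fun h => absurd h ha, fun _ => linδ_filter h a q hqa⟩
    rw [Finset.mem_coe, Finsupp.support_filter, Finset.mem_filter] at hc
    exact ⟨hq hc.1, hc.2⟩
  choose p hp1 hp2 hp3 using hp
  let e : b → (Γ →₀ k) := fun x => Sum.elim (fun a => Finsupp.single a 1 - p a) δ x.1
  have heU : ∀ a, a ∈ U → Finsupp.single a (1 : k) ∈ Submodule.span k (Set.range e) := by
    intro a ha
    refine Submodule.subset_span ⟨⟨Sum.inl a, hsb (Or.inl ⟨a, ha, rfl⟩)⟩, ?_⟩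
    change Finsupp.single a 1 - p a = _
    rw [hp2 a ha, sub_zero]
  have hespan : ⊤ ≤ Submodule.span k (Set.range e) := by
    intro x _
    refine Submodule.span_le.2 ?_ (hsingle x)
    rintro _ ⟨a | a, ha, rfl⟩
    · change Finsupp.single a (1 : k) ∈ _
      rw [← sub_add_cancel (Finsupp.single a (1 : k)) (p a)]
      refine Submodule.add_mem _ (Submodule.subset_span ⟨⟨_, ha⟩, rfl⟩) ?_
      have := hp1 a
      rw [Finsupp.supported_eq_span_single] at this
      refine Submodule.span_le.2 ?_ this
      rintro _ ⟨c, hc, rfl⟩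
      exact heU c hc.1
    · exact Submodule.subset_span ⟨⟨_, ha⟩, rfl⟩
  have hcard : Fintype.card b = Module.finrank k (Γ →₀ k) := by
    refine (Module.finrank_eq_card_basis (Module.Basis.mk hb.linearIndependent ?_)).symm
    intro x _
    have := hsingle x
    rwa [Set.image_eq_range] at this
  let B := basisOfTopLeSpanOfCardEqFinrank e hespan hcard
  let φ : (b →₀ k) ≃ₗ[k] (Γ →₀ k) := B.repr.symm
  have hφ : ∀ x, φ (Finsupp.single x 1) = e x := by
    intro x
    change B.repr.symm _ = _
    rw [B.repr_symm_single_one]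
    exact congrFun (coe_basisOfTopLeSpanOfCardEqFinrank e hespan hcard) x
  let P : b → b → Prop := fun x y => ∃ a ∈ U, x.1 = Sum.inl a ∧ y.1 = Sum.inr a
  let δ' : b → (b →₀ k) := fun x =>
    if hx : ∃ d, P x d then Finsupp.single hx.choose 1 else 0
  have hP1 : ∀ u d d', P u d → P u d' → d = d' := by
    rintro u d d' ⟨a, -, h1, h2⟩ ⟨a', -, h1', h2'⟩
    rw [h1, Sum.inl.injEq] at h1'
    exact Subtype.ext (by rw [h2, h2', h1'])
  have hδ1 : ∀ u d, P u d → δ' u = Finsupp.single d 1 := by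
    intro u d hd
    have hx : ∃ d, P u d := ⟨d, hd⟩
    change dite _ _ _ = _
    rw [dif_pos hx, hP1 _ _ _ hx.choose_spec hd]
  have hδ2 : ∀ u, (∀ d, ¬ P u d) → δ' u = 0 := fun u hu => dif_neg (not_exists.2 hu)
  let lab' : b → Mon (Fin t) := fun x => Sum.elim lab lab x.1
  let sz' : b → ℕ := fun x => Sum.elim sz (fun a => sz a - 1) x.1
  have hPg : ∀ u d, P u d → lab' d = lab' u ∧ sz' d + 1 = sz' u := by
    rintro u d ⟨a, ha, h1, h2⟩
    obtain ⟨c, hc⟩ := Finsupp.ne_iff.1 (hU0 a ha)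
    have := (h a c hc).2
    change Sum.elim lab lab d.1 = Sum.elim lab lab u.1 ∧ Sum.elim sz (fun a => sz a - 1) d.1 + 1 =
      Sum.elim sz (fun a => sz a - 1) u.1
    rw [h1, h2]
    refine ⟨rfl, ?_⟩
    change sz a - 1 + 1 = sz a
    omega
  have hP3 : ∀ x d u, P x d → ¬ P u x := by
    rintro x d u ⟨a, -, h1, -⟩ ⟨a', -, -, h2⟩
    rw [h1] at h2
    cases h2
  refine ⟨{a | a ∉ U ∧ Sum.inl a ∈ b}, ?_, ?_⟩
  · intro a ha hc
    refine ⟨fun haU => hU0 a haU ha, ?_⟩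
    by_contra hab
    have h1 : Submodule.span k (v '' b) ≤ LinearMap.ker (Finsupp.lapply a) := by
      rw [Submodule.span_le]
      rintro _ ⟨c | c, hcb, rfl⟩
      · change (Finsupp.single c (1 : k)) a = 0
        rw [Finsupp.single_apply, if_neg]
        rintro rfl
        exact hab hcb
      · exact hc c
    have h2 : (Finsupp.single a (1 : k)) a = 0 := h1 (hsingle (Finsupp.single a 1))
    rw [Finsupp.single_eq_same] at h2
    exact one_ne_zero h2
  · intro α i
    rw [← hdim_wordD_congr (lab' := lab') (sz' := sz') (δ' := δ') (δ := δ) ?_ ?_ φ ?_ ?_ α i]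
    · refine hdim_wordD_eq_card P ?_ hP3
        (fun s : {a | a ∉ U ∧ Sum.inl a ∈ b} => ⟨Sum.inl s.1, s.2.2⟩) ?_ ?_ ?_ ?_ hδ1 hδ2 hPg α i
      · rintro u u' d ⟨a, -, h1, h2⟩ ⟨a', -, h1', h2'⟩
        rw [h2, Sum.inr.injEq] at h2'
        exact Subtype.ext (by rw [h1, h1', h2'])
      · intro s s' hs
        exact Subtype.ext (Sum.inl.inj (congrArg Subtype.val hs))
      · rintro ⟨a | a, ha⟩
        · by_cases haU : a ∈ U
          · exact Or.inr (Or.inl ⟨⟨Sum.inr a, hsb (Or.inr ⟨a, haU, rfl⟩)⟩, a, haU, rfl, rfl⟩)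
          · exact Or.inl ⟨⟨a, haU, ha⟩, rfl⟩
        · exact Or.inr (Or.inr ⟨⟨Sum.inl a, hsb (Or.inl ⟨a, hbr a ha, rfl⟩)⟩, a, hbr a ha, rfl, rfl⟩)
      · rintro s u ⟨a, -, -, h1⟩
        cases h1
      · rintro ⟨s, hs⟩ d ⟨a, ha, h1, -⟩
        cases h1
        exact hs.1 ha
    · intro a c hc
      by_cases hd : ∃ d, P a d
      · obtain ⟨d, hd⟩ := hd
        rw [hδ1 a d hd, Finsupp.single_apply] at hc
        split_ifs at hc with h
        · rw [← h]; exact hPg a d hd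
        · exact absurd rfl hc
      · rw [hδ2 a (not_exists.1 hd)] at hc
        exact absurd rfl hc
    · intro a
      by_cases hd : ∃ d, P a d
      · obtain ⟨d, hd⟩ := hd
        rw [hδ1 a d hd, linδ_single]
        exact hδ2 d fun e he => hP3 _ _ _ he hd
      · rw [hδ2 a (not_exists.1 hd), map_zero]
    · rintro ⟨a | a, ha⟩
      · rw [hφ]
        change _ = linδ δ (Finsupp.single a 1 - p a)
        rw [map_sub, linδ_single]
        by_cases haU : a ∈ U
        · rw [hδ1 _ ⟨Sum.inr a, hsb (Or.inr ⟨a, haU, rfl⟩)⟩ ⟨a, haU, rfl, rfl⟩, hφ, hp2 a haU,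
            map_zero, sub_zero]
          rfl
        · rw [hp3 a haU, sub_self, hδ2, map_zero]
          rintro d ⟨c, hc, h1, -⟩
          cases h1
          exact haU hc
      · rw [hφ, hδ2, map_zero]
        · exact (hδ a).symm
        · rintro d ⟨c, -, h1, -⟩
          cases h1
    · rintro ⟨a | a, ha⟩ c hc
      · change φ _ c ≠ 0 at hc
        rw [hφ] at hc
        change (Finsupp.single a 1 - p a : Γ →₀ k) c ≠ 0 at hc
        change (lab c, sz c) = (lab a, sz a)
        by_cases hpc : p a c = 0
        · rw [Finsupp.sub_apply, hpc, sub_zero, Finsupp.single_apply] at hc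
          split_ifs at hc with h
          · rw [h]
          · exact absurd rfl hc
        · exact (hp1 a (Finsupp.mem_support_iff.2 hpc)).2
      · change φ _ c ≠ 0 at hc
        rw [hφ] at hc
        change δ a c ≠ 0 at hc
        change (lab c, sz c) = (lab a, sz a - 1)
        obtain ⟨h1, h2⟩ := h a c hc
        rw [h1, ← h2, Nat.add_sub_cancel]

end AdaptedBasis

section CriticalLetters

variable {k : Type*} [Field k] {t n : ℕ} {m : Fin n → Mon (Fin t)}

theorem finite_primeB : Finite (PB m) := by
  have : (Set.range fun x : Option (Fin t) × Finset (Fin n) =>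
      ((x.1.elim (x.2.sup m) fun i => Pi.single i 1, x.2) : Blk t n)).Finite := Set.finite_range _
  refine (this.subset ?_ : Set.Finite {p | PrimeB m p})
  rintro p (⟨i, rfl⟩ | ⟨-, h⟩)
  · exact ⟨(some i, ∅), rfl⟩
  · exact ⟨(none, p.2), Prod.ext h.symm rfl⟩

theorem pbδ_ne_zero {a c : PB m} (h : pbδ k a c ≠ 0) : pbLab c = pbLab a ∧ pbSz c + 1 = pbSz a := by
  obtain ⟨s, hs, hc⟩ := blkD_ne_zero (k := k) (a := a.1) (c := c.1) h
  rw [pbLab, pbLab, pbSz, pbSz, hc]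
  exact ⟨rfl, Finset.card_erase_add_one hs⟩

theorem linδ_pbδ (hm : ∀ s, 2 ≤ mdeg (m s)) (a : PB m) : linδ (pbδ k) (pbδ k a) = 0 := by
  ext q
  have h0 := DFunLike.congr_fun (tayD_tayD (k := k) (Finsupp.single a.1 1)) q.1
  rw [tayD_single, tayD, Finsupp.linearCombination_apply, Finsupp.sum_apply] at h0
  rw [linδ, Finsupp.linearCombination_apply, Finsupp.sum_apply, Finsupp.zero_apply]
  rw [Finsupp.zero_apply] at h0
  refine Eq.trans ?_ h0
  refine Finset.sum_bij_ne_zero (fun c _ _ => c.1) (fun c h _ => ?_)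
    (fun c _ _ c' _ _ h => Subtype.ext h) (fun b hb hne => ?_) (fun c _ _ => rfl)
  · rw [Finsupp.mem_support_iff] at h ⊢
    exact h
  · rw [Finsupp.mem_support_iff] at hb
    replace hne : blkD k a.1 b * blkD k b q.1 ≠ 0 := hne
    obtain ⟨s, hs, rfl⟩ := blkD_ne_zero hb
    obtain ⟨s', hs', hq⟩ := blkD_ne_zero (right_ne_zero_of_mul hne)
    have hp : PrimeB m (a.1.1, a.1.2.erase s) := by
      refine PrimeB.of_erase hm hs' ?_ (hq ▸ q.2)
      have := a.2.blkV hm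
      exact ⟨this.1, fun x hx => this.2 x (Finset.mem_of_mem_erase hx)⟩
    refine ⟨⟨_, hp⟩, ?_, ?_, rfl⟩
    · rw [Finsupp.mem_support_iff]
      exact hb
    · exact hne

/-- The Tor dimensions count the normal words over a set of prime blocks which contains
all the variables. -/
theorem exists_torDim_eq_card (k : Type*) [Field k] (hm : ∀ s, 2 ≤ mdeg (m s)) :
    ∃ S : Set (PB m), (∀ p : PB m, p.1.2 = ∅ → p ∈ S) ∧
      ((∀ p : PB m, pbδ k p = 0) → ∀ p, p ∈ S) ∧ ∀ i α, torDim k (idealExp m) i α =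
        Nat.card (wordPiece (fun s : S => pbLab s.1) (fun s : S => pbSz s.1) α i) := by
  have := finite_primeB (m := m)
  obtain ⟨S, hS, hc⟩ := exists_critical_letters (k := k) (lab := pbLab (m := m)) (sz := pbSz)
    (δ := pbδ k) (fun a c => pbδ_ne_zero) (linδ_pbδ hm)
  refine ⟨S, fun p hp => hS p ?_ fun c => ?_, fun h p => hS p (h p) fun c => by rw [h c]; rfl,
    fun i α => ?_⟩
  · ext c
    by_contra h
    obtain ⟨s, hs, -⟩ := blkD_ne_zero (k := k) (a := p.1) (c := c.1) h
    rw [hp] at hs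
    simp at hs
  · by_contra h
    obtain ⟨s, hs, hpc⟩ := blkD_ne_zero (k := k) (a := c.1) (c := p.1) h
    have h1 : p.1.1 = c.1.1 := by rw [hpc]
    rcases p.2 with ⟨i, hi⟩ | ⟨hp', -⟩
    · rcases c.2 with ⟨j, hj⟩ | ⟨hc1, hc2⟩
      · rw [hj] at hs
        simp at hs
      · have h2 := two_le_mdeg_sup hm hc1.1
        rw [← hc2, ← h1, hi, mdeg_single] at h2
        omega
    · rw [hp] at hp'
      exact Finset.not_nonempty_empty hp'.1
  · rw [torDim_eq_hdim_btD, hdim_btD_eq_hdim_wordD hm, hc]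

end CriticalLetters

section Independence

variable {t : ℕ} {H R : Type*} [CommRing R]

theorem conf_comm {a b : Mon (Fin t)} : Conf a b ↔ Conf b a := by
  rw [Conf, Conf, ncf_comm]
  tauto

theorem conf_self {a : Mon (Fin t)} (h : 2 ≤ mdeg a) : Conf a a := by
  obtain ⟨i, hi⟩ := exists_ne_zero (a := a) fun h0 => by rw [h0] at h; simp [mdeg] at h
  exact ⟨⟨i, hi, hi⟩, h, h⟩

/-- A set of letters without conflicts. -/
def Indep (lab : H → Mon (Fin t)) (F : Finset H) : Prop :=
  ∀ x ∈ F, ∀ y ∈ F, x ≠ y → ¬ Conf (lab x) (lab y)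

/-- The alternating sum over the subsets of `Y` without conflicts. -/
def indSum (lab : H → Mon (Fin t)) (w : H → R) (Y : Finset H) : R :=
  ∑ F ∈ Y.powerset, if Indep lab F then ∏ g ∈ F, -w g else 0

variable {lab : H → Mon (Fin t)}

theorem indep_insert {a : H} {F : Finset H} (ha : a ∉ F) :
    Indep lab (insert a F) ↔ Indep lab F ∧ ∀ x ∈ F, ¬ Conf (lab x) (lab a) := by
  constructor
  · intro h
    refine ⟨fun x hx y hy => h x (Finset.mem_insert_of_mem hx) y (Finset.mem_insert_of_mem hy),
      fun x hx => h x (Finset.mem_insert_of_mem hx) a (Finset.mem_insert_self a F) ?_⟩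
    rintro rfl
    exact ha hx
  · rintro ⟨h1, h2⟩ x hx y hy hxy
    rcases Finset.mem_insert.1 hx with rfl | hxF
    · rcases Finset.mem_insert.1 hy with rfl | hyF
      · exact absurd rfl hxy
      · exact fun h => h2 y hyF (conf_comm.1 h)
    · rcases Finset.mem_insert.1 hy with rfl | hyF
      · exact h2 x hxF
      · exact h1 x hxF y hyF hxy

theorem indSum_insert (w : H → R) {a : H} {Y : Finset H} (ha : a ∉ Y) :
    indSum lab w (insert a Y) = indSum lab w Y -
      w a * indSum lab w (Y.filter fun x => ¬ Conf (lab x) (lab a)) := by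
  rw [indSum, Finset.sum_powerset_insert ha, sub_eq_add_neg, ← neg_mul, indSum, indSum,
    Finset.mul_sum]
  congr 1
  have : (Y.filter fun x => ¬ Conf (lab x) (lab a)).powerset =
      Y.powerset.filter fun F => ∀ x ∈ F, ¬ Conf (lab x) (lab a) := by
    ext F
    simp only [Finset.mem_powerset, Finset.mem_filter, Finset.subset_iff]
    exact ⟨fun h => ⟨fun x hx => (h hx).1, fun x hx => (h hx).2⟩, fun h x hx => ⟨h.1 hx, h.2 x hx⟩⟩
  rw [this, Finset.sum_filter]
  refine Finset.sum_congr rfl fun F hF => ?_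
  have haF : a ∉ F := fun h => ha (Finset.mem_powerset.1 hF h)
  rw [Finset.prod_insert haF]
  by_cases h1 : Indep lab F <;> by_cases h2 : ∀ x ∈ F, ¬ Conf (lab x) (lab a) <;>
    simp only [indep_insert haF, h1, h2, and_self, and_false, if_true, if_false,
      mul_zero, ite_self, true_and, false_and]

variable [Fintype H]

theorem indSum_compl (w : H → R) (h2 : ∀ h, 2 ≤ mdeg (lab h)) (B : Finset H) :
    indSum lab w Bᶜ = indSum lab w Finset.univ + ∑ g ∈ B, w g * indSum lab w
      (Finset.univ.filter fun h => ¬ Conf (lab h) (lab g) ∧ (h ∈ B → lk (lab g) ≤ lk (lab h))) := by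
  induction B using Finset.induction_on_max_value (fun h => lk (lab h)) with
  | empty => simp
  | insert a B ha hmax ih =>
    have h1 : Bᶜ = insert a (insert a B)ᶜ := by
      ext x
      simp only [Finset.mem_insert, Finset.mem_compl]
      by_cases h : x = a
      · subst h
        simp [ha]
      · simp [h]
    have h3 := indSum_insert (lab := lab) w (a := a) (Y := (insert a B)ᶜ) (by simp)
    rw [← h1, ih] at h3
    rw [Finset.sum_insert ha]
    have e1 : ∑ g ∈ B, w g * indSum lab w (Finset.univ.filter fun h =>
          ¬ Conf (lab h) (lab g) ∧ (h ∈ insert a B → lk (lab g) ≤ lk (lab h))) =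
        ∑ g ∈ B, w g * indSum lab w (Finset.univ.filter fun h =>
          ¬ Conf (lab h) (lab g) ∧ (h ∈ B → lk (lab g) ≤ lk (lab h))) := by
      refine Finset.sum_congr rfl fun g hg => ?_
      congr 2
      ext h
      simp only [Finset.mem_filter, Finset.mem_univ, true_and, Finset.mem_insert]
      refine and_congr_right fun _ => ⟨fun H hB => H (Or.inr hB), ?_⟩
      rintro H (rfl | hB)
      · exact hmax g hg
      · exact H hB
    have e2 : (Finset.univ.filter fun h =>
          ¬ Conf (lab h) (lab a) ∧ (h ∈ insert a B → lk (lab a) ≤ lk (lab h))) =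
        (insert a B)ᶜ.filter fun h => ¬ Conf (lab h) (lab a) := by
      ext h
      simp only [Finset.mem_filter, Finset.mem_univ, true_and, Finset.mem_insert, Finset.mem_compl]
      constructor
      · rintro ⟨hc, H⟩
        refine ⟨?_, hc⟩
        rintro (rfl | hB)
        · exact hc (conf_self (h2 _))
        · have := lk_injective (le_antisymm (hmax h hB) (H (Or.inr hB)))
          rw [this] at hc
          exact hc (conf_self (h2 _))
      · rintro ⟨hn, hc⟩
        exact ⟨hc, fun H => absurd H hn⟩
    rw [e1, e2]
    linear_combination -h3

end Independence

section Variables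

variable {t : ℕ} {R : Type*} [CommRing R]

theorem prod_one_add_eq (w : Fin t → R) (B : Finset (Fin t)) :
    ∏ i ∈ B, (1 + w i) = 1 + ∑ i ∈ B, w i *
      ∏ j ∈ B.filter fun j => lk (Pi.single j 1 : Mon (Fin t)) < lk (Pi.single i 1), (1 + w j) := by
  induction B using Finset.induction_on_max_value
    (fun i => lk (Pi.single i 1 : Mon (Fin t))) with
  | empty => simp
  | insert a B ha hmax ih =>
    rw [Finset.prod_insert ha, Finset.sum_insert ha]
    have e1 : ∑ i ∈ B, w i * ∏ j ∈ (insert a B).filter fun j =>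
          lk (Pi.single j 1 : Mon (Fin t)) < lk (Pi.single i 1), (1 + w j) =
        ∑ i ∈ B, w i * ∏ j ∈ B.filter fun j =>
          lk (Pi.single j 1 : Mon (Fin t)) < lk (Pi.single i 1), (1 + w j) := by
      refine Finset.sum_congr rfl fun i hi => ?_
      rw [Finset.filter_insert, if_neg (not_lt.2 (hmax i hi))]
    have e2 : ((insert a B).filter fun j =>
        lk (Pi.single j 1 : Mon (Fin t)) < lk (Pi.single a 1)) = B := by
      rw [Finset.filter_insert, if_neg (lt_irrefl _)]
      refine Finset.filter_true_of_mem fun j hj => lt_of_le_of_ne (hmax j hj) fun h => ?_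
      have h1 := congrFun (lk_injective h) j
      rw [Pi.single_eq_same, Pi.single_apply] at h1
      split_ifs at h1 with h2
      · exact ha (h2 ▸ hj)
    rw [e1, e2]
    linear_combination ih

end Variables

section Counting

variable {t : ℕ} {L : Type*}

/-- The weight of a letter, as an exponent vector. -/
def lwt (lab : L → Mon (Fin t)) (sz : L → ℕ) (g : L) : Option (Fin t) →₀ ℕ :=
  expOf (lab g) (sz g + 1)

/-- The words of given weight, normal with respect to `A`. -/
def wordSet (lab : L → Mon (Fin t)) (sz : L → ℕ) (A : Set (Mon (Fin t)))
    (e : Option (Fin t) →₀ ℕ) : Set (List L) :=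
  {y | NormalL A (y.map lab) ∧ (y.map (lwt lab sz)).sum = e}

/-- The generating series of the normal words. -/
def wordSeries (lab : L → Mon (Fin t)) (sz : L → ℕ) (A : Set (Mon (Fin t))) :
    MvPowerSeries (Option (Fin t)) ℤ :=
  fun e => (Nat.card (wordSet lab sz A e) : ℤ)

variable {lab : L → Mon (Fin t)} {sz : L → ℕ}

theorem lwt_none (g : L) : lwt lab sz g none = sz g + 1 := rfl

theorem lwt_some (g : L) (i : Fin t) : lwt lab sz g (some i) = lab g i := rfl

theorem sum_lwt_none (y : List L) :
    (y.map (lwt lab sz)).sum none = (y.map fun g => sz g + 1).sum := by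
  induction y with
  | nil => rfl
  | cons g y ih => rw [List.map_cons, List.sum_cons, Finsupp.add_apply, ih, lwt_none]; simp

theorem sum_lwt_some (y : List L) (i : Fin t) :
    (y.map (lwt lab sz)).sum (some i) = (y.map lab).sum i := by
  induction y with
  | nil => rfl
  | cons g y ih =>
    rw [List.map_cons, List.sum_cons, Finsupp.add_apply, ih, lwt_some, List.map_cons,
      List.sum_cons, Pi.add_apply]

theorem wordSet_univ (e : Option (Fin t) →₀ ℕ) :
    wordSet lab sz Set.univ e = wordPiece lab sz (fun i => e (some i)) (e none) := by
  ext y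
  refine and_congr_right fun _ => ⟨?_, ?_⟩
  · rintro rfl
    exact ⟨funext fun i => (sum_lwt_some y i).symm, (sum_lwt_none y).symm⟩
  · rintro ⟨h1, h2⟩
    ext o
    cases o with
    | none => rw [sum_lwt_none, h2]
    | some i => rw [sum_lwt_some, h1]

theorem wordSet_finite [Finite L] (A : Set (Mon (Fin t))) (e : Option (Fin t) →₀ ℕ) :
    (wordSet lab sz A e).Finite := by
  refine (finite_lists (Set.finite_univ (α := L)) (e none)).subset ?_
  rintro y ⟨-, rfl⟩
  refine ⟨fun _ _ => Set.mem_univ _, ?_⟩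
  rw [sum_lwt_none]
  simp

theorem wordSeries_eq [Fintype L] (A : Set (Mon (Fin t))) :
    wordSeries lab sz A = 1 + ∑ g, if lab g ∈ A then
      MvPowerSeries.monomial (lwt lab sz g) (1 : ℤ) * wordSeries lab sz (nextL A (lab g)) else 0 := by
  ext e
  rw [map_add, map_sum, MvPowerSeries.coeff_one]
  have hT : ∀ A e, (Nat.card (wordSet lab sz A e) : ℤ) =
      ((wordSet_finite (lab := lab) (sz := sz) A e).toFinset.card : ℤ) := fun A e => by
    rw [Nat.card_coe_set_eq, Set.ncard_eq_toFinset_card _ (wordSet_finite A e)]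
  have key : (wordSet_finite (lab := lab) (sz := sz) A e).toFinset =
      (if e = 0 then {[]} else ∅) ∪ (Finset.univ.filter fun g => lab g ∈ A ∧ lwt lab sz g ≤ e).biUnion
        fun g => (wordSet_finite (lab := lab) (sz := sz) (nextL A (lab g))
          (e - lwt lab sz g)).toFinset.image (List.cons g) := by
    ext y
    simp only [Set.Finite.mem_toFinset, Finset.mem_union, Finset.mem_biUnion, Finset.mem_filter,
      Finset.mem_univ, true_and, Finset.mem_image]
    cases y with
    | nil =>
      split_ifs with h
      · simp [wordSet, NormalL, h]
      · simp [wordSet, NormalL, Ne.symm h]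
    | cons g y =>
      constructor
      · rintro ⟨⟨h1, h2⟩, h3⟩
        rw [List.map_cons, List.sum_cons] at h3
        refine Or.inr ⟨g, ⟨h1, ?_⟩, y, ⟨h2, ?_⟩, rfl⟩
        · rw [← h3]; exact le_self_add
        · rw [← h3, add_tsub_cancel_left]
      · rintro (h | ⟨g', ⟨h1, h2⟩, y', ⟨h3, h4⟩, h5⟩)
        · split_ifs at h <;> simp at h
        · obtain ⟨rfl, rfl⟩ := List.cons.inj h5
          refine ⟨⟨h1, h3⟩, ?_⟩
          rw [List.map_cons, List.sum_cons, h4, add_tsub_cancel_of_le h2]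
  change (Nat.card (wordSet lab sz A e) : ℤ) = _
  rw [hT, key, Finset.card_union_of_disjoint, Finset.card_biUnion]
  · push_cast
    congr 1
    · split_ifs <;> simp
    · rw [Finset.sum_filter]
      refine Finset.sum_congr rfl fun g _ => ?_
      rw [Finset.card_image_of_injective _ List.cons_injective, ← hT]
      by_cases hA : lab g ∈ A
      · rw [if_pos hA, MvPowerSeries.coeff_monomial_mul, one_mul]
        simp only [hA, true_and]
        rfl
      · rw [if_neg hA, if_neg fun h => hA h.1, map_zero]
  · intro g _ g' _ hg
    rw [Function.onFun, Finset.disjoint_left]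
    intro y hy hy'
    obtain ⟨z, -, rfl⟩ := Finset.mem_image.1 hy
    obtain ⟨z', -, h⟩ := Finset.mem_image.1 hy'
    exact hg (List.cons.inj h).1.symm
  · rw [Finset.disjoint_left]
    intro y hy hy'
    obtain ⟨g, -, hy'⟩ := Finset.mem_biUnion.1 hy'
    obtain ⟨z, -, rfl⟩ := Finset.mem_image.1 hy'
    split_ifs at hy <;> simp at hy

theorem eq_zero_of_recursion [Fintype L]
    {D : Set (Mon (Fin t)) → MvPowerSeries (Option (Fin t)) ℤ}
    (hD : ∀ A, D A = ∑ g, if lab g ∈ A then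
      MvPowerSeries.monomial (lwt lab sz g) (1 : ℤ) * D (nextL A (lab g)) else 0)
    (A : Set (Mon (Fin t))) : D A = 0 := by
  ext e
  rw [map_zero]
  induction hN : e none using Nat.strong_induction_on generalizing e A with
  | _ N ih =>
    rw [hD A, map_sum]
    refine Finset.sum_eq_zero fun g _ => ?_
    split_ifs
    · rw [MvPowerSeries.coeff_monomial_mul]
      split_ifs with h
      · rw [ih _ ?_ _ _ rfl, mul_zero]
        have := h none
        rw [Finsupp.tsub_apply, lwt_none]
        rw [lwt_none] at this
        omega
      · rfl
    · exact map_zero _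

variable {H : Type*} [Fintype H] {lab : H → Mon (Fin t)} {sz : H → ℕ}

theorem indSum_mul_wordSeries (h2 : ∀ h, 2 ≤ mdeg (lab h)) (A : Set (Mon (Fin t)))
    (w : Fin t ⊕ H → MvPowerSeries (Option (Fin t)) ℤ)
    (hw : ∀ g, w g = MvPowerSeries.monomial (lwt (Sum.elim (fun i => Pi.single i 1) lab)
      (Sum.elim (fun _ => 0) sz) g) (1 : ℤ)) :
    indSum lab (fun h => w (Sum.inr h)) Finset.univ *
      wordSeries (Sum.elim (fun i => Pi.single i 1) lab) (Sum.elim (fun _ => 0) sz) A =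
    indSum lab (fun h => w (Sum.inr h)) (Finset.univ.filter fun h => lab h ∈ A)ᶜ *
      ∏ i ∈ Finset.univ.filter fun i : Fin t => (Pi.single i 1 : Mon (Fin t)) ∈ A,
        (1 + w (Sum.inl i)) := by
  set I := indSum lab (fun h => w (Sum.inr h)) with hI
  set lab' : Fin t ⊕ H → Mon (Fin t) := Sum.elim (fun i => Pi.single i 1) lab with hlab
  set sz' : Fin t ⊕ H → ℕ := Sum.elim (fun _ => 0) sz
  set X : Set (Mon (Fin t)) → Finset (Fin t) := fun A =>
    Finset.univ.filter fun i : Fin t => (Pi.single i 1 : Mon (Fin t)) ∈ A with hX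
  set Y : Set (Mon (Fin t)) → Finset H := fun A => (Finset.univ.filter fun h => lab h ∈ A)
  have hlt : ∀ i h, lk (Pi.single i 1 : Mon (Fin t)) < lk (lab h) := fun i h =>
    lk_lt_of_mdeg_lt (by rw [mdeg_single]; exact h2 h)
  have hnc : ∀ i l, ¬ Conf (Pi.single i 1 : Mon (Fin t)) l := fun i l h => by
    have := h.2.1
    rw [mdeg_single] at this
    omega
  have hnc' : ∀ i l, ¬ Conf l (Pi.single i 1 : Mon (Fin t)) := fun i l h => hnc i l (conf_comm.1 h)
  rw [← sub_eq_zero]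
  refine eq_zero_of_recursion (lab := lab') (sz := sz')
    (D := fun A => I Finset.univ * wordSeries lab' sz' A - I (Y A)ᶜ * ∏ i ∈ X A, (1 + w (Sum.inl i)))
    (fun A => ?_) A
  have hx1 : ∀ i, X (nextL A (Pi.single i 1)) =
      (X A).filter fun j => lk (Pi.single j 1 : Mon (Fin t)) < lk (Pi.single i 1) := fun i => by
    ext j
    simp [hX, nextL, hnc]
  have hx2 : ∀ i, Y (nextL A (Pi.single i 1)) = ∅ := fun i => by
    ext h
    simp [Y, nextL, hnc', (hlt i h).le]
  have hx3 : ∀ g, X (nextL A (lab g)) = X A := fun g => by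
    ext j
    simp [hX, nextL, hnc, hlt]
  have hx4 : ∀ g, (Y (nextL A (lab g)))ᶜ = (Finset.univ.filter fun h =>
      ¬ Conf (lab h) (lab g) ∧ (h ∈ Y A → lk (lab g) ≤ lk (lab h))) := fun g => by
    ext h
    simp [Y, nextL]
  have e1 := prod_one_add_eq (fun i => w (Sum.inl i)) (X A)
  have e2 := indSum_compl (fun h => w (Sum.inr h)) h2 (Y A)
  rw [← hI] at e2
  have e3 : ∀ g, (if lab' g ∈ A then MvPowerSeries.monomial (lwt lab' sz' g) (1 : ℤ) *
      (I Finset.univ * wordSeries lab' sz' (nextL A (lab' g)) - I (Y (nextL A (lab' g)))ᶜ *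
        ∏ i ∈ X (nextL A (lab' g)), (1 + w (Sum.inl i))) else 0) =
      I Finset.univ * (if lab' g ∈ A then MvPowerSeries.monomial (lwt lab' sz' g) (1 : ℤ) *
        wordSeries lab' sz' (nextL A (lab' g)) else 0) -
      (if lab' g ∈ A then w g * (I (Y (nextL A (lab' g)))ᶜ *
        ∏ i ∈ X (nextL A (lab' g)), (1 + w (Sum.inl i))) else 0) := fun g => by
    rw [hw g]
    split_ifs
    · ring
    · ring
  rw [Finset.sum_congr rfl fun g _ => e3 g, Finset.sum_sub_distrib, ← Finset.mul_sum,
    Fintype.sum_sum_type (fun g => if lab' g ∈ A then w g * (I (Y (nextL A (lab' g)))ᶜ *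
        ∏ i ∈ X (nextL A (lab' g)), (1 + w (Sum.inl i))) else 0)]
  have e4 : ∑ i, (if lab' (Sum.inl i) ∈ A then w (Sum.inl i) *
      (I (Y (nextL A (lab' (Sum.inl i))))ᶜ *
        ∏ j ∈ X (nextL A (lab' (Sum.inl i))), (1 + w (Sum.inl j))) else 0) =
      I Finset.univ * (∏ i ∈ X A, (1 + w (Sum.inl i)) - 1) := by
    rw [e1, add_sub_cancel_left, Finset.mul_sum, ← Finset.sum_filter]
    refine Finset.sum_congr rfl fun i _ => ?_
    change w (Sum.inl i) * (I (Y (nextL A (Pi.single i 1)))ᶜ *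
        ∏ j ∈ X (nextL A (Pi.single i 1)), (1 + w (Sum.inl j))) = _
    rw [hx1, hx2, Finset.compl_empty]
    ring
  have e5 : ∑ h, (if lab' (Sum.inr h) ∈ A then w (Sum.inr h) *
      (I (Y (nextL A (lab' (Sum.inr h))))ᶜ *
        ∏ j ∈ X (nextL A (lab' (Sum.inr h))), (1 + w (Sum.inl j))) else 0) =
      (I (Y A)ᶜ - I Finset.univ) * ∏ i ∈ X A, (1 + w (Sum.inl i)) := by
    rw [e2, add_sub_cancel_left, Finset.sum_mul, ← Finset.sum_filter]
    refine Finset.sum_congr rfl fun h _ => ?_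
    change w (Sum.inr h) * (I (Y (nextL A (lab h)))ᶜ *
        ∏ j ∈ X (nextL A (lab h)), (1 + w (Sum.inl j))) = _
    rw [hx3, hx4]
    ring
  rw [e4, e5, wordSeries_eq A]
  ring

end Counting

section Denominator

variable {t n : ℕ} {m : Fin n → Mon (Fin t)}

theorem card_wordPiece_congr {Γ Γ' : Type*} {lab : Γ → Mon (Fin t)} {lab' : Γ' → Mon (Fin t)}
    {sz : Γ → ℕ} {sz' : Γ' → ℕ} (f : Γ ≃ Γ') (hl : ∀ a, lab' (f a) = lab a)
    (hs : ∀ a, sz' (f a) = sz a) (α : Mon (Fin t)) (i : ℕ) :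
    Nat.card (wordPiece lab sz α i) = Nat.card (wordPiece lab' sz' α i) := by
  refine Nat.card_congr ((Equiv.listEquivOfEquiv f).subtypeEquiv fun y => ?_)
  have h1 : (List.map f y).map lab' = y.map lab := by
    rw [List.map_map]
    exact List.map_congr_left fun a _ => hl a
  have h2 : ((List.map f y).map fun a => sz' a + 1) = y.map fun a => sz a + 1 := by
    rw [List.map_map]
    exact List.map_congr_left fun a _ => congrArg (· + 1) (hs a)
  change _ ↔ NormalL Set.univ ((List.map f y).map lab') ∧ ((List.map f y).map lab').sum = α ∧
    ((List.map f y).map fun a => sz' a + 1).sum = i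
  rw [h1, h2]
  rfl

theorem pbδ_eq_zero {k : Type*} [Field k] (hm : ∀ s, 2 ≤ mdeg (m s))
    (h : ∀ C, Conn m C → C.card ≤ 1) (p : PB m) : pbδ k p = 0 := by
  ext c
  by_contra hne
  obtain ⟨s, hs, hc⟩ := blkD_ne_zero (k := k) (a := p.1) (c := c.1) hne
  have hcard := Finset.card_erase_add_one hs
  rcases p.2 with ⟨i, hi⟩ | ⟨hp, he⟩
  · rw [hi] at hs
    simp at hs
  · have hz : p.1.2.erase s = ∅ := by
      rw [← Finset.card_eq_zero]
      have := h _ hp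
      omega
    rw [hz] at hc
    rcases c.2 with ⟨i, hi⟩ | ⟨hc', -⟩
    · have := two_le_mdeg_sup hm hp.1
      rw [← he, (Prod.mk.inj (hc.symm.trans hi)).1, mdeg_single] at this
      omega
    · rw [hc] at hc'
      exact Finset.not_nonempty_empty hc'.1

/-- The labels of the variables and of the connected sets in `𝒞`. -/
def cLab (m : Fin n → Mon (Fin t)) (𝒞 : Finset (Finset (Fin n))) : Fin t ⊕ 𝒞 → Mon (Fin t) :=
  Sum.elim (fun i => Pi.single i 1) fun C => C.1.sup m

/-- The sizes of the variables and of the connected sets in `𝒞`. -/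
def cSz (t : ℕ) (𝒞 : Finset (Finset (Fin n))) : Fin t ⊕ 𝒞 → ℕ :=
  Sum.elim (fun _ => 0) fun C => C.1.card

theorem exists_poincareSeries_eq (k : Type*) [Field k] (hm : ∀ s, 2 ≤ mdeg (m s)) :
    ∃ 𝒞 : Finset (Finset (Fin n)), (∀ C ∈ 𝒞, Conn m C) ∧
      ((∀ C, Conn m C → C.card ≤ 1) → ∀ C, Conn m C → C ∈ 𝒞) ∧
      poincareSeries k (idealExp m) = wordSeries (cLab m 𝒞) (cSz t 𝒞) Set.univ := by
  obtain ⟨S, hS1, hS2, hS3⟩ := exists_torDim_eq_card k hm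
  set 𝒞 : Finset (Finset (Fin n)) := Finset.univ.filter fun C =>
    ∃ h : Conn m C, (⟨(C.sup m, C), Or.inr ⟨h, rfl⟩⟩ : PB m) ∈ S with h𝒞
  have hmem : ∀ C, C ∈ 𝒞 ↔ ∃ h : Conn m C, (⟨(C.sup m, C), Or.inr ⟨h, rfl⟩⟩ : PB m) ∈ S :=
    fun C => by simp [h𝒞]
  refine ⟨𝒞, fun C hC => ((hmem C).1 hC).1, fun h C hC => (hmem C).2 ⟨hC, hS2 (pbδ_eq_zero hm h) _⟩,
    ?_⟩
  let f : Fin t ⊕ 𝒞 → S := Sum.elim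
    (fun i => ⟨⟨(Pi.single i 1, ∅), Or.inl ⟨i, rfl⟩⟩, hS1 _ rfl⟩)
    fun C => ⟨⟨(C.1.sup m, C.1), Or.inr ⟨((hmem C.1).1 C.2).1, rfl⟩⟩, ((hmem C.1).1 C.2).2⟩
  have hf1 : ∀ i, (f (Sum.inl i)).1.1 = (Pi.single i 1, ∅) := fun _ => rfl
  have hf2 : ∀ C, (f (Sum.inr C)).1.1 = (C.1.sup m, C.1) := fun _ => rfl
  have hne : ∀ C : 𝒞, C.1 ≠ ∅ := fun C => (((hmem C.1).1 C.2).1.1).ne_empty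
  have hf : Function.Bijective f := by
    constructor
    · intro a b hab
      have hab' : (f a).1.1 = (f b).1.1 := by rw [hab]
      rcases a with i | C <;> rcases b with j | D <;> simp only [hf1, hf2, Prod.mk.injEq] at hab'
      · have h1 := congrFun hab'.1 i
        rw [Pi.single_eq_same, Pi.single_apply] at h1
        split_ifs at h1 with h2
        rw [h2]
      · exact absurd hab'.2.symm (hne D)
      · exact absurd hab'.2 (hne C)
      · rw [Subtype.ext hab'.2]
    · rintro ⟨⟨p, hp⟩, hpS⟩
      rcases hp with ⟨i, rfl⟩ | ⟨hc, he⟩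
      · exact ⟨Sum.inl i, rfl⟩
      · obtain ⟨β, C⟩ := p
        dsimp only at hc he
        subst he
        exact ⟨Sum.inr ⟨C, (hmem C).2 ⟨hc, hpS⟩⟩, rfl⟩
  ext e
  change (torDim k (idealExp m) (e none) (fun i => e (some i)) : ℤ) = (Nat.card _ : ℤ)
  rw [hS3, wordSet_univ]
  norm_cast
  refine (card_wordPiece_congr (Equiv.ofBijective f hf) ?_ ?_ _ _).symm
  · rintro (i | C) <;> rfl
  · rintro (i | C) <;> rfl

theorem map_indSum {H R R' : Type*} [CommRing R] [CommRing R'] (f : R →+* R')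
    (lab : H → Mon (Fin t)) (w : H → R) (Y : Finset H) :
    f (indSum lab w Y) = indSum lab (fun h => f (w h)) Y := by
  rw [indSum, indSum, map_sum]
  refine Finset.sum_congr rfl fun F _ => ?_
  split_ifs
  · rw [map_prod]
    exact Finset.prod_congr rfl fun g _ => map_neg f _
  · exact map_zero f

theorem expOf_single (i : Fin t) :
    expOf (Pi.single i 1) 1 = Finsupp.single (some i) 1 + Finsupp.single none 1 := by
  ext o
  cases o with
  | none => simp [expOf]
  | some j => simp [expOf, Finsupp.single_apply, Pi.single_apply, eq_comm]

theorem zSpecialize_monomial (α : Mon (Fin t)) (d : ℕ) :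
    zSpecialize (MvPolynomial.monomial (expOf α d) (1 : ℤ)) = Polynomial.X ^ d := by
  rw [zSpecialize, MvPolynomial.aeval_monomial, map_one, one_mul, Finsupp.prod_fintype _ _
    fun _ => pow_zero _, Fintype.prod_option]
  simp [expOf]

theorem zSpecialize_eq_indSum {k : Type*} [Field k] (hm : ∀ s, 2 ≤ mdeg (m s))
    {𝒞 : Finset (Finset (Fin n))} (h𝒞 : ∀ C ∈ 𝒞, Conn m C)
    (hP : poincareSeries k (idealExp m) = wordSeries (cLab m 𝒞) (cSz t 𝒞) Set.univ)
    {b : MvPolynomial (Option (Fin t)) ℤ} (hb : IsDenominator k (idealExp m) b) :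
    zSpecialize b = indSum (fun C : 𝒞 => C.1.sup m)
      (fun C => Polynomial.X ^ (C.1.card + 1)) Finset.univ := by
  set b' : MvPolynomial (Option (Fin t)) ℤ := indSum (fun C : 𝒞 => C.1.sup m)
    (fun C => MvPolynomial.monomial (expOf (C.1.sup m) (C.1.card + 1)) 1) Finset.univ with hb'
  have key := indSum_mul_wordSeries (lab := fun C : 𝒞 => C.1.sup m) (sz := fun C : 𝒞 => C.1.card)
    (fun C => two_le_mdeg_sup hm (h𝒞 C.1 C.2).1) Set.univ _ fun _ => rfl
  have hcoe : (b' : MvPowerSeries (Option (Fin t)) ℤ) =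
      indSum (fun C : 𝒞 => C.1.sup m) (fun C => MvPowerSeries.monomial
        (expOf (C.1.sup m) (C.1.card + 1)) (1 : ℤ)) Finset.univ := by
    have := map_indSum (MvPolynomial.coeToMvPowerSeries.ringHom (R := ℤ) (σ := Option (Fin t)))
      (fun C : 𝒞 => C.1.sup m)
      (fun C => MvPolynomial.monomial (expOf (C.1.sup m) (C.1.card + 1)) 1) Finset.univ
    rw [← hb'] at this
    refine this.trans ?_
    congr 1
    funext C
    exact MvPolynomial.coe_monomial _ _
  have hden : (b' : MvPowerSeries (Option (Fin t)) ℤ) * poincareSeries k (idealExp m) =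
      ∏ i : Fin t, (1 + MvPowerSeries.X (some i) * MvPowerSeries.X none) := by
    rw [hcoe, hP]
    refine Eq.trans key ?_
    simp only [Set.mem_univ, Finset.filter_true, Finset.compl_univ]
    have e2 : indSum (fun C : 𝒞 => C.1.sup m) (fun C => MvPowerSeries.monomial
        (lwt (Sum.elim (fun i => Pi.single i 1) fun C : 𝒞 => C.1.sup m)
          (Sum.elim (fun _ => 0) fun C : 𝒞 => C.1.card) (Sum.inr C)) (1 : ℤ)) ∅ = 1 := by
      simp [indSum, Indep]
    rw [e2, one_mul]
    refine Finset.prod_congr rfl fun i _ => ?_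
    congr 1
    rw [MvPowerSeries.X, MvPowerSeries.X, MvPowerSeries.monomial_mul_monomial, ← expOf_single,
      one_mul]
    rfl
  have hne : poincareSeries k (idealExp m) ≠ 0 := fun h0 => by
    rw [h0, mul_zero] at hden
    have := congrArg (MvPowerSeries.constantCoeff (σ := Option (Fin t)) (R := ℤ)) hden
    simp at this
  have hbb : b = b' := by
    refine MvPolynomial.coe_injective _ _ (mul_right_cancel₀ hne ?_)
    rw [hden]
    exact hb
  rw [hbb, hb']
  refine (map_indSum (MvPolynomial.aeval (R := ℤ) fun o : Option (Fin t) =>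
    Option.elim o (Polynomial.X : Polynomial ℤ) (fun _ => 1)).toRingHom _ _ _).trans ?_
  congr 1
  funext C
  exact zSpecialize_monomial _ _

end Denominator

section Degrees

variable {t n : ℕ} {m : Fin n → Mon (Fin t)}

theorem prod_neg_X_pow {H : Type*} (d : H → ℕ) (F : Finset H) :
    ∏ g ∈ F, -(Polynomial.X ^ d g : Polynomial ℤ) =
      Polynomial.C ((-1) ^ F.card) * Polynomial.X ^ ∑ g ∈ F, d g := by
  rw [Finset.prod_neg, Finset.prod_pow_eq_pow_sum]
  simp

theorem coeff_indSum {H : Type*} (lab : H → Mon (Fin t)) (d : H → ℕ) (Y : Finset H) (N : ℕ) :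
    (indSum lab (fun h => (Polynomial.X ^ d h : Polynomial ℤ)) Y).coeff N =
      ∑ F ∈ Y.powerset, if Indep lab F ∧ ∑ g ∈ F, d g = N then (-1) ^ F.card else 0 := by
  rw [indSum, Polynomial.finsetSum_coeff]
  refine Finset.sum_congr rfl fun F _ => ?_
  by_cases h : Indep lab F
  · rw [if_pos h, prod_neg_X_pow, Polynomial.coeff_C_mul_X_pow]
    simp only [h, true_and, eq_comm]
  · rw [if_neg h, if_neg fun h' => h h'.1, Polynomial.coeff_zero]

variable {𝒞 : Finset (Finset (Fin n))}

theorem Indep.pairwiseDisjoint (hm : ∀ s, 2 ≤ mdeg (m s)) (h𝒞 : ∀ C ∈ 𝒞, Conn m C)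
    {F : Finset 𝒞} (hF : Indep (fun C : 𝒞 => C.1.sup m) F) :
    (F : Set 𝒞).PairwiseDisjoint Subtype.val := fun C hC D hD hCD =>
  Cop.disjoint hm (cop_of_not_ncf fun h => hF C hC D hD hCD
    ⟨h, two_le_mdeg_sup hm (h𝒞 C.1 C.2).1, two_le_mdeg_sup hm (h𝒞 D.1 D.2).1⟩)

theorem Indep.sum_card_le (hm : ∀ s, 2 ≤ mdeg (m s)) (h𝒞 : ∀ C ∈ 𝒞, Conn m C)
    {F : Finset 𝒞} (hF : Indep (fun C : 𝒞 => C.1.sup m) F) :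
    ∑ C ∈ F, (C.1.card + 1) ≤ 2 * (F.biUnion Subtype.val).card := by
  rw [Finset.card_biUnion (hF.pairwiseDisjoint hm h𝒞), Finset.mul_sum]
  refine Finset.sum_le_sum fun C _ => ?_
  have := (h𝒞 C.1 C.2).1.card_pos
  omega

theorem not_ncf_of_sum_card_eq (hm : ∀ s, 2 ≤ mdeg (m s)) (h𝒞 : ∀ C ∈ 𝒞, Conn m C)
    {F : Finset 𝒞} (hF : Indep (fun C : 𝒞 => C.1.sup m) F)
    (h : ∑ C ∈ F, (C.1.card + 1) = 2 * n) {s s' : Fin n} (hs : s ≠ s') : ¬ NCF (m s) (m s') := by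
  have h1 := hF.sum_card_le hm h𝒞
  have h2 : (F.biUnion Subtype.val).card ≤ n := (Finset.card_le_univ _).trans (by simp)
  have h3 : F.biUnion Subtype.val = Finset.univ := by
    rw [← Finset.card_eq_iff_eq_univ, Fintype.card_fin]
    omega
  have h4 : ∀ C ∈ F, C.1.card + 1 = 2 * C.1.card := by
    refine (Finset.sum_eq_sum_iff_of_le fun C _ => ?_).1 ?_
    · have := (h𝒞 C.1 C.2).1.card_pos
      omega
    · rw [h, ← Finset.mul_sum, ← Finset.card_biUnion (hF.pairwiseDisjoint hm h𝒞), h3,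
        Finset.card_univ, Fintype.card_fin]
  have h5 : ∀ x, ∃ C ∈ F, C.1 = {x} := fun x => by
    have hx : x ∈ F.biUnion Subtype.val := h3 ▸ Finset.mem_univ x
    obtain ⟨C, hC, hxC⟩ := Finset.mem_biUnion.1 hx
    have := h4 C hC
    obtain ⟨y, hy⟩ := Finset.card_eq_one.1 (by omega : C.1.card = 1)
    rw [hy, Finset.mem_singleton] at hxC
    exact ⟨C, hC, hxC ▸ hy⟩
  obtain ⟨C, hC, hCs⟩ := h5 s
  obtain ⟨D, hD, hDs⟩ := h5 s'
  intro hncf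
  refine hF C hC D hD ?_ ⟨?_, two_le_mdeg_sup hm (h𝒞 C.1 C.2).1, two_le_mdeg_sup hm (h𝒞 D.1 D.2).1⟩
  · rintro rfl
    exact hs (Finset.singleton_injective (hCs.symm.trans hDs))
  · dsimp only
    rwa [hCs, hDs, Finset.sup_singleton, Finset.sup_singleton]

theorem conn_singleton (s : Fin n) : Conn m {s} :=
  ⟨⟨s, Finset.mem_singleton_self s⟩, fun _ hA hne _ => (Finset.subset_singleton_iff.1 hA).resolve_left
    hne.ne_empty⟩

theorem Conn.eq_singleton (hd : ∀ s s', s ≠ s' → ¬ NCF (m s) (m s')) {C : Finset (Fin n)}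
    (hC : Conn m C) : ∃ s, C = {s} := by
  obtain ⟨s, hs⟩ := hC.1
  refine ⟨s, (hC.2 {s} (Finset.singleton_subset_iff.2 hs) ⟨s, Finset.mem_singleton_self s⟩ ?_).symm⟩
  intro x hx y hy
  rw [Finset.mem_singleton] at hx
  rw [Finset.mem_sdiff, Finset.mem_singleton] at hy
  subst hx
  exact hd x y (Ne.symm hy.2)

theorem natDegree_zSpecialize {k : Type*} [Field k] (hm : ∀ s, 2 ≤ mdeg (m s))
    {b : MvPolynomial (Option (Fin t)) ℤ} (hb : IsDenominator k (idealExp m) b) :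
    (zSpecialize b).natDegree ≤ 2 * n ∧
      ((zSpecialize b).natDegree = 2 * n ↔ ∀ s s', s ≠ s' → ¬ NCF (m s) (m s')) := by
  obtain ⟨𝒞, h𝒞, hall, hP⟩ := exists_poincareSeries_eq (m := m) k hm
  rw [zSpecialize_eq_indSum hm h𝒞 hP hb]
  set q := indSum (fun C : 𝒞 => C.1.sup m)
    (fun C => (Polynomial.X ^ (C.1.card + 1) : Polynomial ℤ)) Finset.univ with hq
  have hcoeff : ∀ N, q.coeff N ≠ 0 → ∃ F : Finset 𝒞, Indep (fun C : 𝒞 => C.1.sup m) F ∧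
      ∑ C ∈ F, (C.1.card + 1) = N := fun N hN => by
    rw [hq, coeff_indSum] at hN
    obtain ⟨F, -, hF⟩ := Finset.exists_ne_zero_of_sum_ne_zero hN
    by_contra hne
    exact hF (if_neg fun h => hne ⟨F, h⟩)
  have hle : q.natDegree ≤ 2 * n := by
    by_cases h0 : q = 0
    · simp [h0]
    · obtain ⟨F, hF, hN⟩ := hcoeff q.natDegree (Polynomial.leadingCoeff_ne_zero.2 h0)
      have h1 := hF.sum_card_le hm h𝒞
      have h2 : (F.biUnion Subtype.val).card ≤ n := (Finset.card_le_univ _).trans (by simp)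
      omega
  refine ⟨hle, fun heq s s' hs => ?_, fun hd => le_antisymm hle ?_⟩
  · have h0 : q ≠ 0 := fun h0 => by
      rw [h0, Polynomial.natDegree_zero] at heq
      have := s.pos
      omega
    obtain ⟨F, hF, hN⟩ := hcoeff q.natDegree (Polynomial.leadingCoeff_ne_zero.2 h0)
    exact not_ncf_of_sum_card_eq hm h𝒞 hF (hN.trans heq) hs
  · have h1 : ∀ C : 𝒞, ∃ s, C.1 = {s} := fun C => (h𝒞 C.1 C.2).eq_singleton hd
    have h2 : ∀ s, {s} ∈ 𝒞 := fun s => by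
      refine hall (fun C hC => ?_) _ (conn_singleton s)
      obtain ⟨x, rfl⟩ := hC.eq_singleton hd
      simp
    have hsum : ∀ F : Finset 𝒞, ∑ C ∈ F, (C.1.card + 1) = 2 * F.card := fun F => by
      rw [Finset.sum_congr rfl fun C _ => ?_, Finset.sum_const, smul_eq_mul, mul_comm]
      obtain ⟨x, hx⟩ := h1 C
      rw [hx, Finset.card_singleton]
    have hcard : (Finset.univ : Finset 𝒞).card = n := by
      rw [Finset.card_univ, Fintype.card_coe]
      have : 𝒞 = Finset.univ.image fun s : Fin n => ({s} : Finset (Fin n)) := by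
        ext C
        simp only [Finset.mem_image, Finset.mem_univ, true_and]
        constructor
        · intro hC
          obtain ⟨s, hs⟩ := h1 ⟨C, hC⟩
          exact ⟨s, hs.symm⟩
        · rintro ⟨s, rfl⟩
          exact h2 s
      rw [this, Finset.card_image_of_injective _ Finset.singleton_injective, Finset.card_univ,
        Fintype.card_fin]
    have hind : Indep (fun C : 𝒞 => C.1.sup m) Finset.univ := fun C _ D _ hCD hc => by
      obtain ⟨s, hs⟩ := h1 C
      obtain ⟨s', hs'⟩ := h1 D
      have h := hc.1
      dsimp only at h
      rw [hs, hs', Finset.sup_singleton, Finset.sup_singleton] at h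
      refine hd s s' ?_ h
      rintro rfl
      exact hCD (Subtype.ext (hs.trans hs'.symm))
    refine Polynomial.le_natDegree_of_ne_zero ?_
    rw [hq, coeff_indSum, Finset.sum_eq_single Finset.univ, if_pos ⟨hind, by rw [hsum, hcard]⟩]
    · simp
    · intro F _ hF
      refine if_neg fun h => hF ?_
      rw [hsum] at h
      rw [← Finset.card_eq_iff_eq_univ, ← Finset.card_univ, hcard]
      omega
    · simp

theorem mem_expSet_iff {k : Type*} [Field k] {M : Finset (Mon (Fin t))}
    {I : Ideal (MvPolynomial (Fin t) k)} (hI : IsMonomialIdealOf M I) (β : Mon (Fin t)) :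
    β ∈ expSet I ↔ ∃ a ∈ M, a ≤ β := by
  have hI' : I = Ideal.span ((fun s => MvPolynomial.monomial s (1 : k)) ''
      ((fun a => Finsupp.equivFunOnFinite.symm a) '' (M : Set (Mon (Fin t))))) := by
    rw [Set.image_image]
    exact hI
  change MvPolynomial.monomial _ _ ∈ I ↔ _
  rw [hI', MvPolynomial.mem_ideal_span_monomial_image]
  constructor
  · intro h
    obtain ⟨_, ⟨a, ha, rfl⟩, hle⟩ := h (Finsupp.equivFunOnFinite.symm β)
      (by rw [MvPolynomial.mem_support_iff, MvPolynomial.coeff_monomial, if_pos rfl]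
          exact one_ne_zero)
    exact ⟨a, ha, fun i => hle i⟩
  · rintro ⟨a, ha, hle⟩ x hx
    have hx' := MvPolynomial.support_monomial_subset hx
    rw [Finset.mem_singleton] at hx'
    subst hx'
    exact ⟨_, ⟨a, ha, rfl⟩, fun i => hle i⟩

end Degrees

/-- **Corollary (degree bound, complete intersection case).**
With `R = k[x₁,…,x_t]/I`, `I` minimally generated by the set `M` of `n` monomials of
degree at least 2, one has `deg b_R(z) ≤ 2n`, with equality if and only if `R` is a
complete intersection, i.e. if and only if the monomials of `M` are pairwise without
common factors. -/
theorem degree_bound_complete_intersection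
    (t : ℕ) (k : Type) [Field k]
    (M : Finset (Mon (Fin t)))
    (I : Ideal (MvPolynomial (Fin t) k))
    (hgen : IsMonomialIdealOf M I)
    (hmin : IsAntichain' M)
    (hdeg : ∀ m ∈ M, 2 ≤ mdeg m)
    (b : MvPolynomial (Option (Fin t)) ℤ)
    (hb : IsDenominator k (expSet I) b) :
    (zSpecialize b).natDegree ≤ 2 * M.card ∧
      ((zSpecialize b).natDegree = 2 * M.card ↔ Discrete M) := by
  set m : Fin M.card → Mon (Fin t) := fun s => (M.equivFin.symm s).1 with hm
  have hmem : ∀ s, m s ∈ M := fun s => (M.equivFin.symm s).2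
  have hsurj : ∀ a ∈ M, ∃ s, m s = a := fun a ha => ⟨M.equivFin ⟨a, ha⟩, by simp [hm]⟩
  have hinj : Function.Injective m := Subtype.val_injective.comp M.equivFin.symm.injective
  have hJ : expSet I = idealExp m := by
    ext β
    rw [mem_expSet_iff hgen]
    constructor
    · rintro ⟨a, ha, hle⟩
      obtain ⟨s, rfl⟩ := hsurj a ha
      exact ⟨s, hle⟩
    · rintro ⟨s, hle⟩
      exact ⟨m s, hmem s, hle⟩
  rw [hJ] at hb
  obtain ⟨h1, h2⟩ := natDegree_zSpecialize (fun s => hdeg _ (hmem s)) hb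
  refine ⟨h1, h2.trans ⟨fun h a ha a' ha' hne => ?_, fun h s s' hs =>
    h _ (hmem s) _ (hmem s') (hinj.ne hs)⟩⟩
  obtain ⟨s, rfl⟩ := hsurj a ha
  obtain ⟨s', rfl⟩ := hsurj a' ha'
  exact h s s' fun hs => hne (by rw [hs])
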